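/- For every compact set K ⊆ ℝ³ there exists a map φ : ℝ² → ℝ³ that is C^∞ on D² (ContDiffOn ℝ ⊤ φ D²), injective on D², and an immersion at every point of D² (derivative injective), such that: φ(D²) ∩ K = ∅; φ(D²) ∩ H = φ(S¹); φ(S¹) ⊆ H \ {0}; the open part φ(D² \ S¹) is disjoint from H; and the boundary loop t ↦ φ(cos 2πt, sin 2πt) is not null-homotopic in H \ {0} (it is not path-homotopic within H \ {0} to a constant loop). (Lemma 8.2 of the paper, existence of a nice 2-disk avoiding K, stated without the transversality part of neatness.) -/

import Mathlib

open Set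

/-- The boundary circle parametrization `t ↦ (cos 2πt, sin 2πt)` in ℝ². -/
noncomputable def circlePt (t : ℝ) : EuclideanSpace ℝ (Fin 2) :=
  (EuclideanSpace.equiv (Fin 2) ℝ).symm ![Real.cos (2 * Real.pi * t), Real.sin (2 * Real.pi * t)]

open Topology Filter Function
open scoped ContDiff

/-- Smooth cutoff functions. -/
theorem exists_cutoff {E : Type*} [NormedAddCommGroup E] [NormedSpace ℝ E]
    [FiniteDimensional ℝ E] {C U : Set E} (hC : IsClosed C) (hU : IsOpen U) (hCU : C ⊆ U) :
    ∃ χ : E → ℝ, ContDiff ℝ ∞ χ ∧ (∀ᶠ x in 𝓝ˢ C, χ x = 1) ∧ (∀ x ∉ U, ∀ᶠ y in 𝓝 x, χ y = 0) ∧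
      ∀ x, χ x ∈ Icc (0 : ℝ) 1 := by
  obtain ⟨χ, h0, h1, h2⟩ := exists_contMDiffMap_zero_one_nhds_of_isClosed (n := ⊤)
    (modelWithCornersSelf ℝ E) hU.isClosed_compl hC (disjoint_compl_left_iff_subset.2 hCU)
  refine ⟨χ, χ.contMDiff.contDiff, h1, fun x hx => ?_, h2⟩
  exact (nhds_le_nhdsSet (show x ∈ Uᶜ from hx)) h0

theorem ContDiffOn.cutoff_smul {E F : Type*} [NormedAddCommGroup E] [NormedSpace ℝ E]
    [NormedAddCommGroup F] [NormedSpace ℝ F] {U : Set E} (hU : IsOpen U) {χ : E → ℝ}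
    (hχ : ContDiff ℝ ∞ χ) (h0 : ∀ x ∉ U, ∀ᶠ y in 𝓝 x, χ y = 0) {g : E → F}
    (hg : ContDiffOn ℝ ∞ g U) : ContDiff ℝ ∞ (fun x => χ x • g x) := by
  rw [contDiff_iff_contDiffAt]
  intro x
  by_cases hx : x ∈ U
  · exact hχ.contDiffAt.smul (hg.contDiffAt (hU.mem_nhds hx))
  · refine contDiffAt_const (c := (0 : F)) |>.congr_of_eventuallyEq ?_
    filter_upwards [h0 x hx] with y hy
    rw [hy, zero_smul]

/-- A smooth map whose derivative is invertible at `x₀` has a smooth local inverse. -/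
theorem exists_local_inverse {E : Type*} [NormedAddCommGroup E] [NormedSpace ℝ E]
    [FiniteDimensional ℝ E] {p : E → E} {x₀ : E} (hp : ContDiff ℝ ∞ p)
    (hp' : Injective (fderiv ℝ p x₀)) :
    ∃ e : OpenPartialHomeomorph E E, (∀ x, e x = p x) ∧ x₀ ∈ e.source ∧
      ContDiffOn ℝ ∞ e.symm e.target := by
  have : CompleteSpace E := FiniteDimensional.complete ℝ E
  let A : E ≃L[ℝ] E := (LinearEquiv.ofInjectiveEndo (fderiv ℝ p x₀ : E →ₗ[ℝ] E)
    hp').toContinuousLinearEquiv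
  have hA : (A : E →L[ℝ] E) = fderiv ℝ p x₀ := by ext v; rfl
  have hd : HasFDerivAt p (A : E →L[ℝ] E) x₀ := by
    rw [hA]; exact (hp.differentiable (by simp) x₀).hasFDerivAt
  let e₀ := hp.contDiffAt.toOpenPartialHomeomorph p hd (by simp)
  have hU : IsOpen {x | fderiv ℝ p x ∈ range ((↑) : (E ≃L[ℝ] E) → E →L[ℝ] E)} :=
    ContinuousLinearEquiv.isOpen.preimage (hp.continuous_fderiv (by simp))
  refine ⟨e₀.restrOpen _ hU, fun x => rfl, ⟨?_, A, hA⟩, ?_⟩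
  · exact hp.contDiffAt.mem_toOpenPartialHomeomorph_source hd (by simp)
  · intro y hy
    have hy' : y ∈ e₀.target ∧ e₀.symm y ∈
      {x | fderiv ℝ p x ∈ range ((↑) : (E ≃L[ℝ] E) → E →L[ℝ] E)} := hy
    obtain ⟨B, hB⟩ := hy'.2
    refine (e₀.contDiffAt_symm (f₀' := B) hy'.1 ?_ hp.contDiffAt).contDiffWithinAt
    rw [hB]
    exact (hp.differentiable (by simp) _).hasFDerivAt

/-- A smooth map whose derivative at `x₀` is injective has a smooth left inverse near `x₀`. -/
theorem exists_contDiff_leftInverse {E F : Type*} [NormedAddCommGroup E] [NormedSpace ℝ E]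
    [FiniteDimensional ℝ E] [NormedAddCommGroup F] [NormedSpace ℝ F] [FiniteDimensional ℝ F]
    {f : E → F} {x₀ : E} (hf : ContDiff ℝ ∞ f) (hinj : Injective (fderiv ℝ f x₀)) :
    ∃ θ : F → E, ContDiff ℝ ∞ θ ∧ ∀ᶠ x in 𝓝 x₀, θ (f x) = x := by
  obtain ⟨L₀, hL₀⟩ := LinearMap.exists_leftInverse_of_injective
    (fderiv ℝ f x₀ : E →ₗ[ℝ] F) (LinearMap.ker_eq_bot.2 hinj)
  let L : F →L[ℝ] E := LinearMap.toContinuousLinearMap L₀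
  have hp : ContDiff ℝ ∞ (fun x => L (f x)) := L.contDiff.comp hf
  have hp' : Injective (fderiv ℝ (fun x => L (f x)) x₀) := by
    have h1 := L.hasFDerivAt.comp x₀ (hf.differentiable (by simp) x₀).hasFDerivAt
    have h2 : fderiv ℝ (fun x => L (f x)) x₀ = L ∘L fderiv ℝ f x₀ := h1.fderiv
    rw [h2]
    refine LeftInverse.injective (g := id) fun v => ?_
    exact LinearMap.congr_fun hL₀ v
  obtain ⟨e, he, hx₀, hsymm⟩ := exists_local_inverse hp hp'
  have hx₀' : L (f x₀) ∈ e.target := by rw [← he]; exact e.map_source hx₀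
  obtain ⟨χ, hχ, hχ1, hχ0, -⟩ := exists_cutoff isClosed_singleton e.open_target
    (singleton_subset_iff.2 hx₀')
  rw [nhdsSet_singleton] at hχ1
  refine ⟨fun y => χ (L y) • e.symm (L y), (hsymm.cutoff_smul e.open_target hχ hχ0).comp
    L.contDiff, ?_⟩
  filter_upwards [e.open_source.mem_nhds hx₀,
    (L.continuous.comp hf.continuous).continuousAt.eventually hχ1] with x hx hx1
  have hx1' : χ (L (f x)) = 1 := hx1
  rw [hx1', one_smul, ← he, e.left_inv hx]

/-- Smooth diffeomorphisms of the plane. -/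
structure PlaneDiffeo where
  toHomeo : ℂ ≃ₜ ℂ
  smooth : ContDiff ℝ ∞ toHomeo
  smooth_symm : ContDiff ℝ ∞ toHomeo.symm

namespace PlaneDiffeo

noncomputable instance : CoeFun PlaneDiffeo (fun _ => ℂ → ℂ) := ⟨fun Φ => Φ.toHomeo⟩

noncomputable def refl : PlaneDiffeo := ⟨Homeomorph.refl ℂ, contDiff_id, contDiff_id⟩

noncomputable def symm (Φ : PlaneDiffeo) : PlaneDiffeo := ⟨Φ.toHomeo.symm, Φ.smooth_symm, Φ.smooth⟩

noncomputable def trans (Φ Ψ : PlaneDiffeo) : PlaneDiffeo :=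
  ⟨Φ.toHomeo.trans Ψ.toHomeo, Ψ.smooth.comp Φ.smooth, Φ.smooth_symm.comp Ψ.smooth_symm⟩

@[simp] theorem refl_apply (z : ℂ) : refl z = z := rfl
@[simp] theorem trans_apply (Φ Ψ : PlaneDiffeo) (z : ℂ) : Φ.trans Ψ z = Ψ (Φ z) := rfl
@[simp] theorem symm_apply_apply (Φ : PlaneDiffeo) (z : ℂ) : Φ.symm (Φ z) = z :=
  Φ.toHomeo.symm_apply_apply z
@[simp] theorem apply_symm_apply (Φ : PlaneDiffeo) (z : ℂ) : Φ (Φ.symm z) = z :=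
  Φ.toHomeo.apply_symm_apply z

theorem injective (Φ : PlaneDiffeo) : Injective Φ := Φ.toHomeo.injective

theorem continuous (Φ : PlaneDiffeo) : Continuous Φ := Φ.toHomeo.continuous

theorem differentiableAt (Φ : PlaneDiffeo) (z : ℂ) : DifferentiableAt ℝ Φ z :=
  Φ.smooth.differentiable (by simp) z

theorem fderiv_symm_comp (Φ : PlaneDiffeo) (z v : ℂ) :
    fderiv ℝ Φ.symm (Φ z) (fderiv ℝ Φ z v) = v := by
  have h := (Φ.symm.differentiableAt (Φ z)).hasFDerivAt.comp z (Φ.differentiableAt z).hasFDerivAt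
  have h2 : (Φ.symm ∘ Φ : ℂ → ℂ) = id := by ext; simp
  rw [h2] at h
  have := h.unique (hasFDerivAt_id z)
  exact DFunLike.congr_fun this v

theorem fderiv_injective (Φ : PlaneDiffeo) (z : ℂ) : Injective (fderiv ℝ Φ z) :=
  LeftInverse.injective (Φ.fderiv_symm_comp z)

/-- A smooth homeomorphism with injective derivatives is a diffeomorphism. -/
noncomputable def ofHomeomorph (Ψ : ℂ ≃ₜ ℂ) (hΨ : ContDiff ℝ ∞ Ψ)
    (hinj : ∀ z, Injective (fderiv ℝ Ψ z)) : PlaneDiffeo where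
  toHomeo := Ψ
  smooth := hΨ
  smooth_symm := by
    refine Ψ.contDiff_symm (f₀' := fun z => (LinearEquiv.ofInjectiveEndo
      (fderiv ℝ Ψ z : ℂ →ₗ[ℝ] ℂ) (hinj z)).toContinuousLinearEquiv) (fun z => ?_) hΨ
    exact (hΨ.differentiable (by simp) z).hasFDerivAt

/-- A perturbation of the identity by a smooth map with Lipschitz constant at most `1/2`. -/
theorem exists_of_lipschitz {V : ℂ → ℂ} (hV : ContDiff ℝ ∞ V) (hL : LipschitzWith (1/2) V) :
    ∃ Ψ : PlaneDiffeo, ∀ z, Ψ z = z + V z := by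
  have h1 : ApproximatesLinearOn (fun z => z + V z)
      ((ContinuousLinearEquiv.refl ℝ ℂ : ℂ ≃L[ℝ] ℂ) : ℂ →L[ℝ] ℂ) univ (1/2) := by
    intro x _ y _
    have := hL.norm_sub_le x y
    simpa [add_sub_add_comm] using this
  have hN : ‖((ContinuousLinearEquiv.refl ℝ ℂ).symm : ℂ →L[ℝ] ℂ)‖₊ = 1 := by
    ext; simp
  have hc : Subsingleton ℂ ∨ (1/2 : NNReal) <
      ‖((ContinuousLinearEquiv.refl ℝ ℂ).symm : ℂ →L[ℝ] ℂ)‖₊⁻¹ := by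
    right; rw [hN, inv_one]; exact NNReal.half_lt_self one_ne_zero
  let Ψ := h1.toHomeomorph _ hc
  have hΨ : ∀ z, Ψ z = z + V z := fun z => rfl
  have hsm : ContDiff ℝ ∞ Ψ := contDiff_id.add hV
  have hinj (a : ℂ) : Injective (fderiv ℝ Ψ a) := by
    have hd2 : fderiv ℝ Ψ a = ContinuousLinearMap.id ℝ ℂ + fderiv ℝ V a :=
      ((hasFDerivAt_id a).add (hV.differentiable (by simp) a).hasFDerivAt).fderiv
    rw [injective_iff_map_eq_zero]
    intro v hv
    rw [hd2] at hv
    have h3 : ‖fderiv ℝ V a v‖ ≤ (1/2) * ‖v‖ := by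
      refine (fderiv ℝ V a).le_of_opNorm_le ?_ v
      have := norm_fderiv_le_of_lipschitz ℝ hL (x₀ := a)
      simpa using this
    have h4 : v = - fderiv ℝ V a v := eq_neg_of_add_eq_zero_left (by simpa using hv)
    have h5 : ‖v‖ = ‖fderiv ℝ V a v‖ := by
      conv_lhs => rw [h4, norm_neg]
    exact norm_le_zero_iff.1 (by linarith [norm_nonneg v])
  exact ⟨ofHomeomorph Ψ hsm hinj, hΨ⟩

end PlaneDiffeo

/-- Parametrized smooth simple closed curves in the plane, of period `1`. -/
structure IsLoop (γ : ℝ → ℂ) : Prop where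
  smooth : ContDiff ℝ ∞ γ
  periodic : Periodic γ 1
  deriv_ne : ∀ t, deriv γ t ≠ 0
  inj : ∀ s t, γ s = γ t → ∃ k : ℤ, t = s + k

theorem Function.Periodic.add_int {F : Type*} {γ : ℝ → F} (h : Periodic γ 1) (t : ℝ) (k : ℤ) :
    γ (t + k) = γ t := by
  have := (h.int_mul k) t
  simpa using this

theorem Function.Periodic.range_eq_image_Icc {F : Type*} {γ : ℝ → F} (h : Periodic γ 1) (a : ℝ) :
    range γ = γ '' Icc a (a + 1) := by
  refine subset_antisymm ?_ (image_subset_range _ _)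
  rintro _ ⟨t, rfl⟩
  obtain ⟨s, hs, hst⟩ := h.exists_mem_Ico (zero_lt_one) t a
  exact ⟨s, Ico_subset_Icc_self hs, hst.symm⟩

namespace IsLoop

variable {γ : ℝ → ℂ}

theorem differentiableAt (h : IsLoop γ) (t : ℝ) : DifferentiableAt ℝ γ t :=
  h.smooth.differentiable (by simp) t

theorem isCompact_range (h : IsLoop γ) : IsCompact (range γ) := by
  rw [h.periodic.range_eq_image_Icc 0]
  exact isCompact_Icc.image h.smooth.continuous

theorem comp (h : IsLoop γ) (Φ : PlaneDiffeo) : IsLoop (fun t => Φ (γ t)) where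
  smooth := Φ.smooth.comp h.smooth
  periodic t := by simp [h.periodic t]
  deriv_ne t := by
    have := (Φ.differentiableAt (γ t)).hasFDerivAt.comp_hasDerivAt t (h.differentiableAt t).hasDerivAt
    erw [this.deriv]
    intro h0
    exact h.deriv_ne t (Φ.fderiv_injective (γ t) (by rw [h0, map_zero]))
  inj s t hst := h.inj s t (Φ.injective hst)

/-- Smooth functions along a loop extend to smooth functions of the plane. -/
theorem exists_extension (h : IsLoop γ) {F : Type*} [NormedAddCommGroup F] [NormedSpace ℝ F]
    {η : ℝ → F} (hη : ContDiff ℝ ∞ η) (hper : Periodic η 1) :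
    ∃ V : ℂ → F, ContDiff ℝ ∞ V ∧ ∀ t, V (γ t) = η t := by
  have hconv (z : ℂ) : Convex ℝ {v : F | ∀ t, γ t = z → v = η t} := by
    intro u hu v hv a b _ _ hab t ht
    rw [hu t ht, hv t ht, ← add_smul, hab, one_smul]
  have hloc (z : ℂ) : ∃ U ∈ 𝓝 z, ∃ g : ℂ → F,
      ContMDiffOn (modelWithCornersSelf ℝ ℂ) (modelWithCornersSelf ℝ F) ∞ g U ∧
      ∀ y ∈ U, g y ∈ {v : F | ∀ t, γ t = y → v = η t} := by
    by_cases hz : z ∈ range γ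
    · obtain ⟨t₀, rfl⟩ := hz
      have hinj : Injective (fderiv ℝ γ t₀) := by
        rw [injective_iff_map_eq_zero]
        intro v hv
        rw [fderiv_eq_smul_deriv] at hv
        exact (smul_eq_zero.1 hv).resolve_right (h.deriv_ne t₀)
      obtain ⟨θ, hθ, hθ'⟩ := exists_contDiff_leftInverse h.smooth hinj
      obtain ⟨ε, hε, hball⟩ := Metric.eventually_nhds_iff.1 hθ'
      set S := γ '' {t ∈ Icc t₀ (t₀ + 1) | ε ≤ |t - t₀| ∧ ε ≤ |t - (t₀ + 1)|}
      have hS : IsCompact S := by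
        refine IsCompact.image (isCompact_Icc.inter_right ?_) h.smooth.continuous
        exact (isClosed_le continuous_const (continuous_id.sub continuous_const).abs).inter
          (isClosed_le continuous_const (continuous_id.sub continuous_const).abs)
      have hnS : γ t₀ ∉ S := by
        rintro ⟨t, ⟨⟨h1, h2⟩, h3, h4⟩, h5⟩
        obtain ⟨k, hk⟩ := h.inj t t₀ h5
        have hk1 : -1 ≤ k := by exact_mod_cast (by linarith : (-1 : ℝ) ≤ k)
        have hk2 : k ≤ 0 := by exact_mod_cast (by linarith : (k : ℝ) ≤ 0)
        obtain rfl | rfl : k = 0 ∨ k = -1 := by omega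
        · rw [hk] at h3; simp at h3; linarith
        · rw [hk] at h4; simp at h4; linarith
      refine ⟨Sᶜ, hS.isClosed.isOpen_compl.mem_nhds hnS, fun y => η (θ y),
        (hη.comp hθ).contMDiff.contMDiffOn, ?_⟩
      rintro y hy t rfl
      obtain ⟨s, hs, hst⟩ := h.periodic.exists_mem_Ico zero_lt_one t t₀
      obtain ⟨k, rfl⟩ := h.inj _ _ hst
      rw [hst] at hy ⊢
      rw [← hper.add_int t k]
      generalize t + k = s at *
      by_cases h1 : |s - t₀| < ε
      · dsimp only
        rw [hball (by rwa [Real.dist_eq])]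
      by_cases h2 : |s - (t₀ + 1)| < ε
      · have h3 : γ s = γ (s - 1) := by rw [← h.periodic (s - 1)]; simp
        dsimp only
        rw [h3, hball (by rwa [Real.dist_eq, sub_sub, add_comm 1]), ← hper (s - 1)]
        simp
      · exact absurd ⟨s, ⟨Ico_subset_Icc_self hs, not_lt.1 h1, not_lt.1 h2⟩, rfl⟩ hy
    · refine ⟨(range γ)ᶜ, h.isCompact_range.isClosed.isOpen_compl.mem_nhds hz, fun _ => 0,
        contMDiffOn_const, ?_⟩
      rintro y hy t rfl
      exact absurd (mem_range_self t) hy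

  obtain ⟨V, hV⟩ := exists_contMDiffMap_forall_mem_convex_of_local (n := ⊤) _ hconv hloc
  exact ⟨V, V.contMDiff.contDiff, fun t => hV _ t rfl⟩

theorem exists_lipschitz_extension (h : IsLoop γ) {F : Type*} [NormedAddCommGroup F]
    [NormedSpace ℝ F] {η : ℝ → F} (hη : ContDiff ℝ ∞ η) (hper : Periodic η 1) :
    ∃ V : ℂ → F, ContDiff ℝ ∞ V ∧ ∃ C, LipschitzWith C V ∧ ∀ t, V (γ t) = η t := by
  obtain ⟨V, hV, hVγ⟩ := h.exists_extension hη hper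
  obtain ⟨R, hR⟩ := h.isCompact_range.isBounded.subset_ball 0
  obtain ⟨χ, hχ, hχ1, hχ0, -⟩ := exists_cutoff h.isCompact_range.isClosed
    Metric.isOpen_ball hR
  have hW : ContDiff ℝ ∞ (fun z => χ z • V z) := ContDiff.smul hχ hV
  have hWc : HasCompactSupport (fun z => χ z • V z) := by
    refine HasCompactSupport.intro (isCompact_closedBall (0 : ℂ) R) fun z hz => ?_
    have h2 : χ z = 0 := (hχ0 z fun h => hz (Metric.ball_subset_closedBall h)).self_of_nhds
    rw [h2, zero_smul]
  obtain ⟨C, hC⟩ := hW.lipschitzWith_of_hasCompactSupport hWc (by simp)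
  refine ⟨_, hW, C, hC, fun t => ?_⟩
  have h2 : χ (γ t) = 1 := (hχ1.filter_mono (nhds_le_nhdsSet (mem_range_self t))).self_of_nhds
  rw [h2, one_smul, hVγ]

end IsLoop

/-- Two parametrized loops differ by a diffeomorphism of the plane. -/
def LoopEquiv (γ₀ γ₁ : ℝ → ℂ) : Prop := ∃ Ψ : PlaneDiffeo, ∀ t, γ₁ t = Ψ (γ₀ t)

namespace LoopEquiv

variable {γ₀ γ₁ γ₂ : ℝ → ℂ}

theorem symm : LoopEquiv γ₀ γ₁ → LoopEquiv γ₁ γ₀ := fun ⟨Ψ, h⟩ => ⟨Ψ.symm, fun t => by simp [h]⟩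

theorem trans : LoopEquiv γ₀ γ₁ → LoopEquiv γ₁ γ₂ → LoopEquiv γ₀ γ₂ :=
  fun ⟨Ψ, h⟩ ⟨Ψ', h'⟩ => ⟨Ψ.trans Ψ', fun t => by simp [h, h']⟩

/-- Isotopy extension for straight-line isotopies of loops. -/
theorem of_straight (h : ∀ τ ∈ Icc (0 : ℝ) 1, IsLoop (fun t => γ₀ t + τ * (γ₁ t - γ₀ t))) :
    LoopEquiv γ₀ γ₁ := by
  have h0 : IsLoop γ₀ := by simpa using h 0 (by simp)
  have h1 : IsLoop γ₁ := by simpa using h 1 (by simp)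
  let G : ℝ → ℝ → ℂ := fun τ t => γ₀ t + τ * (γ₁ t - γ₀ t)
  have key := isPreconnected_Icc.induction₂' (s := Icc (0 : ℝ) 1)
    (fun σ τ => LoopEquiv (G σ) (G τ))
    ?_ (fun _ _ _ _ _ _ hab hbc => trans hab hbc) (left_mem_Icc.2 zero_le_one)
    (right_mem_Icc.2 zero_le_one)
  · simpa [G] using key
  intro τ₀ hτ₀
  suffices hs : ∀ᶠ τ : ℝ in 𝓝 τ₀, LoopEquiv (G τ₀) (G τ) from
    nhdsWithin_le_nhds (hs.mono fun τ hτ => ⟨hτ, hτ.symm⟩)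
  obtain ⟨V, hV, C, hC, hVγ⟩ := (h τ₀ hτ₀).exists_lipschitz_extension (h1.smooth.sub h0.smooth)
    (fun t => by simp [h0.periodic t, h1.periodic t])
  have hcont : ∀ᶠ τ : ℝ in 𝓝 τ₀, |τ - τ₀| * C < 1 / 2 := by
    have : Tendsto (fun τ : ℝ => |τ - τ₀| * C) (𝓝 τ₀) (𝓝 (|τ₀ - τ₀| * C)) :=
      Continuous.tendsto (by fun_prop) _
    exact this.eventually_lt_const (by simp)
  filter_upwards [hcont] with τ hτ
  have hL : LipschitzWith (1 / 2) (fun z => (τ - τ₀) • V z) := by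
    refine LipschitzWith.of_dist_le_mul fun x y => ?_
    rw [dist_smul₀, Real.norm_eq_abs]
    have h2 := hC.dist_le_mul x y
    have h3 : ((1 / 2 : NNReal) : ℝ) = 1 / 2 := by simp
    rw [h3]
    nlinarith [abs_nonneg (τ - τ₀), dist_nonneg (x := x) (y := y)]
  have hS : ContDiff ℝ ∞ (fun z => (τ - τ₀) • V z) := hV.const_smul (τ - τ₀)
  obtain ⟨Ψ, hΨ⟩ := PlaneDiffeo.exists_of_lipschitz hS hL
  refine ⟨Ψ, fun t => ?_⟩
  rw [hΨ, hVγ, Complex.real_smul]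
  push_cast
  ring

end LoopEquiv

/-- The standard parametrization of the unit circle. -/
noncomputable def circ (t : ℝ) : ℂ := Complex.exp (2 * Real.pi * t * Complex.I)

/-- Loops which are images of the standard circle under a diffeomorphism of the plane. -/
def Good (γ : ℝ → ℂ) : Prop := LoopEquiv circ γ

section

open MeasureTheory Convolution

/-- `Win π n a b`: on `[a, b]` the path `π` moves in the direction of the functional `n` with at
least unit speed. -/
def Win (π : ℝ → ℂ) (n : ℂ →L[ℝ] ℝ) (a b : ℝ) : Prop :=
  ∀ ⦃s s'⦄, a ≤ s → s ≤ s' → s' ≤ b → s' - s ≤ n (π s' - π s)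

/-- Injectivity of a `1`-periodic path modulo its period. -/
def LoopInj (π : ℝ → ℂ) : Prop := ∀ s t, π s = π t → ∃ k : ℤ, t = s + k

namespace Win
variable {π : ℝ → ℂ} {n : ℂ →L[ℝ] ℝ} {a b c : ℝ}

theorem mono {a' b' : ℝ} (h : Win π n a b) (ha : a ≤ a') (hb : b' ≤ b) : Win π n a' b' :=
  fun _ _ h1 h2 h3 => h (ha.trans h1) h2 (h3.trans hb)

theorem concat (h : Win π n a b) (h' : Win π n b c) : Win π n a c := by
  intro s s' h1 h2 h3
  rcases le_total s' b with hb | hb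
  · exact h h1 h2 hb
  rcases le_total s b with hs | hs
  · have e1 := h h1 hs le_rfl
    have e2 := h' le_rfl hb h3
    simp only [map_sub] at *
    linarith
  · exact h' hs h2 h3

theorem congr {π' : ℝ → ℂ} (h : Win π n a b) (he : ∀ t ∈ Icc a b, π' t = π t) : Win π' n a b := by
  intro s s' h1 h2 h3
  rw [he s ⟨h1, h2.trans h3⟩, he s' ⟨h1.trans h2, h3⟩]
  exact h h1 h2 h3

theorem scale {κ : ℝ} (hκ : 0 < κ)
    (h : ∀ ⦃s s'⦄, a ≤ s → s ≤ s' → s' ≤ b → κ * (s' - s) ≤ n (π s' - π s)) :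
    Win π (κ⁻¹ • n) a b := by
  intro s s' h1 h2 h3
  have := h h1 h2 h3
  rw [_root_.smul_apply, smul_eq_mul, inv_mul_eq_div, le_div_iff₀ hκ]
  linarith

theorem eq_of_eq (h : Win π n a b) {s s' : ℝ} (h1 : a ≤ s) (h2 : s ≤ s') (h3 : s' ≤ b)
    (he : π s = π s') : s = s' := by
  have := h h1 h2 h3
  rw [he, sub_self, map_zero] at this
  linarith

theorem convexCombo {π' : ℝ → ℂ} (h : Win π n a b) (h' : Win π' n a b) {τ : ℝ}
    (hτ : τ ∈ Icc (0 : ℝ) 1) : Win (fun t => π t + τ * (π' t - π t)) n a b := by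
  intro s s' h1 h2 h3
  have e1 := h h1 h2 h3
  have e2 := h' h1 h2 h3
  have : n (π s' + τ * (π' s' - π s') - (π s + τ * (π' s - π s)))
      = (1 - τ) * n (π s' - π s) + τ * n (π' s' - π' s) := by
    rw [← smul_eq_mul (1 - τ), ← smul_eq_mul τ (n _), ← map_smul, ← map_smul, ← map_add]
    congr 1
    simp only [Complex.real_smul]
    push_cast
    ring
  rw [this]
  nlinarith [hτ.1, hτ.2]

theorem deriv_ne_zero (h : Win π n a b) {t : ℝ} (ht : t ∈ Ioo a b)
    (hd : DifferentiableAt ℝ π t) : deriv π t ≠ 0 := by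
  intro h0
  have h1 : HasDerivAt (fun s => n (π s) - s) (n (deriv π t) - 1) t :=
    (n.hasFDerivAt.comp_hasDerivAt t hd.hasDerivAt).sub (hasDerivAt_id t)
  have h2 : MonotoneOn (fun s => n (π s) - s) (Icc a b) := by
    intro s hs s' hs' hss
    have := h hs.1 hss hs'.2
    rw [map_sub] at this
    simp only
    linarith
  have h3 : 0 ≤ derivWithin (fun s => n (π s) - s) (Icc a b) t := h2.derivWithin_nonneg
  rw [derivWithin_of_mem_nhds (Icc_mem_nhds ht.1 ht.2), h1.deriv, h0, map_zero] at h3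
  linarith

end Win

/-- The standard sequence of mollifiers. -/
noncomputable def mollifier (k : ℕ) : ContDiffBump (0 : ℝ) :=
  ⟨1 / (2 * (k + 1)), 1 / (k + 1), by positivity, by
    apply one_div_lt_one_div_of_lt <;> · have : (0 : ℝ) < k + 1 := by positivity
                                         linarith⟩

/-- Mollification of a path. -/
noncomputable def mollify (k : ℕ) (π : ℝ → ℂ) (x : ℝ) : ℂ :=
  ∫ u, (mollifier k).normed volume u • π (x - u)

namespace mollify
variable {π : ℝ → ℂ} {k : ℕ}

theorem integrable (hπ : Continuous π) (x : ℝ) :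
    Integrable (fun u => (mollifier k).normed volume u • π (x - u)) := by
  apply Continuous.integrable_of_hasCompactSupport
  · exact (mollifier k).continuous_normed.smul (by fun_prop)
  · exact (mollifier k).hasCompactSupport_normed.smul_right

theorem contDiff (hπ : Continuous π) : ContDiff ℝ ∞ (mollify k π) :=
  (mollifier k).hasCompactSupport_normed.contDiff_convolution_left (ContinuousLinearMap.lsmul ℝ ℝ)
    (mollifier k).contDiff_normed hπ.locallyIntegrable

theorem periodic (hp : Periodic π 1) : Periodic (mollify k π) 1 := by
  intro x
  unfold mollify
  congr 1
  ext u
  rw [show x + 1 - u = (x - u) + 1 by ring, hp]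

theorem dist_le (hπ : Continuous π) {ε : ℝ}
    (h : ∀ x y : ℝ, |x - y| < 1 / ((k : ℝ) + 1) → dist (π x) (π y) ≤ ε) (x : ℝ) :
    dist (mollify k π x) (π x) ≤ ε :=
  ContDiffBump.dist_normed_convolution_le hπ.aestronglyMeasurable fun y hy => h y x (by simpa [mollifier, Real.dist_eq] using hy)

theorem win {n : ℂ →L[ℝ] ℝ} {a b r : ℝ} (hπ : Continuous π) (h : Win π n (a - r) (b + r))
    (hr : 1 / (k + 1) ≤ r) : Win (mollify k π) n a b := by
  intro s s' h1 h2 h3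
  have e : n (mollify k π s' - mollify k π s)
      = ∫ u, (mollifier k).normed volume u * n (π (s' - u) - π (s - u)) := by
    unfold mollify
    have := ContinuousLinearMap.integral_comp_comm n
      ((integrable (k := k) hπ s').sub (integrable (k := k) hπ s))
    simp only [Pi.sub_apply] at this
    rw [← integral_sub (integrable hπ _) (integrable hπ _), ← this]
    congr 1
    ext u
    rw [← smul_sub, map_smul, smul_eq_mul]
  have e1 : s' - s = ∫ u, (mollifier k).normed volume u * (s' - s) := by
    rw [integral_mul_const, ContDiffBump.integral_normed, one_mul]
  rw [e, e1]
  apply integral_mono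
  · exact (mollifier k).integrable_normed.mul_const _
  · have := n.integrable_comp ((integrable (k := k) hπ s').sub (integrable (k := k) hπ s))
    refine this.congr (ae_of_all _ fun u => ?_)
    simp only [Pi.sub_apply]
    rw [← smul_sub, map_smul, smul_eq_mul]
  · intro u
    by_cases hu : u ∈ Metric.ball (0 : ℝ) (mollifier k).rOut
    · have hu' : |u| < 1 / (k + 1) := by simpa [mollifier] using hu
      have := abs_lt.1 hu'
      apply mul_le_mul_of_nonneg_left _ ((mollifier k).nonneg_normed u)
      have := h (s := s - u) (s' := s' - u) (by linarith) (by linarith) (by linarith)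
      linarith
    · rw [← ContDiffBump.support_normed_eq (μ := volume), notMem_support] at hu
      simp [hu]

theorem affine (A : ℂ ≃L[ℝ] ℂ) (b : ℂ) (hπ : Continuous π) :
    mollify k (fun t => A (π t) + b) = fun t => A (mollify k π t) + b := by
  ext x
  unfold mollify
  have h1 : (fun u => (mollifier k).normed volume u • (A (π (x - u)) + b))
      = fun u => A ((mollifier k).normed volume u • π (x - u)) + (mollifier k).normed volume u • b := by
    ext u
    rw [smul_add, map_smul]
  rw [h1, integral_add, ContDiffBump.integral_normed_smul]
  · congr 1
    exact ContinuousLinearMap.integral_comp_comm (A : ℂ →L[ℝ] ℂ) (integrable hπ x)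
  · exact ContinuousLinearMap.integrable_comp (A : ℂ →L[ℝ] ℂ) (integrable hπ x)
  · exact (mollifier k).integrable_normed.smul_const _

theorem shift (c : ℝ) : mollify k (fun t => π (t + c)) = fun t => mollify k π (t + c) := by
  ext x
  unfold mollify
  congr 1
  ext u
  simp only [show x - u + c = x + c - u by ring]

theorem reverse : mollify k (fun t => π (-t)) = fun t => mollify k π (-t) := by
  ext x
  unfold mollify
  rw [← integral_neg_eq_self]
  congr 1
  ext u
  simp only [ContDiffBump.normed_neg, show -(x - -u) = -x - u by ring]

end mollify

/-- Paths whose mollifications are eventually good. -/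
def Good' (π : ℝ → ℂ) : Prop := ∀ᶠ k in atTop, Good (mollify k π)

theorem LoopEquiv.good_iff {γ₀ γ₁ : ℝ → ℂ} (h : LoopEquiv γ₀ γ₁) : Good γ₀ ↔ Good γ₁ :=
  ⟨fun h' => h'.trans h, fun h' => h'.trans h.symm⟩

theorem PlaneDiffeo.good_comp {γ : ℝ → ℂ} (Ψ : PlaneDiffeo) :
    Good (fun t => Ψ (γ t)) ↔ Good γ :=
  (LoopEquiv.good_iff ⟨Ψ, fun _ => rfl⟩).symm

/-- Affine automorphisms of the plane as diffeomorphisms. -/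
noncomputable def PlaneDiffeo.affine (A : ℂ ≃L[ℝ] ℂ) (b : ℂ) : PlaneDiffeo where
  toHomeo := A.toHomeomorph.trans (Homeomorph.addRight b)
  smooth := by
    show ContDiff ℝ ∞ (fun z => A z + b)
    exact A.contDiff.add contDiff_const
  smooth_symm := by
    have : ContDiff ℝ ∞ (fun z => A.symm (z + -b)) :=
      A.symm.contDiff.comp (contDiff_id.add contDiff_const)
    exact this

@[simp] theorem PlaneDiffeo.affine_apply (A : ℂ ≃L[ℝ] ℂ) (b z : ℂ) :
    PlaneDiffeo.affine A b z = A z + b := rfl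

theorem circ_add (t c : ℝ) : circ (t + c) = circ c * circ t := by
  rw [circ, circ, circ, ← Complex.exp_add]
  congr 1
  push_cast
  ring

theorem circ_neg (t : ℝ) : circ (-t) = (starRingEnd ℂ) (circ t) := by
  rw [circ, circ, ← Complex.exp_conj]
  congr 1
  simp [map_ofNat]

theorem circ_ne_zero (t : ℝ) : circ t ≠ 0 := Complex.exp_ne_zero _

/-- Multiplication by a nonzero complex number as a real linear equivalence. -/
noncomputable def mulEquiv (c : ℂ) (hc : c ≠ 0) : ℂ ≃L[ℝ] ℂ :=
  ContinuousLinearEquiv.equivOfInverse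
    (ContinuousLinearMap.mul ℝ ℂ c) (ContinuousLinearMap.mul ℝ ℂ c⁻¹)
    (fun z => by simp [hc]) (fun z => by simp [hc])

@[simp] theorem mulEquiv_apply (c : ℂ) (hc : c ≠ 0) (z : ℂ) : mulEquiv c hc z = c * z := rfl

theorem good_circ : Good circ := ⟨PlaneDiffeo.refl, fun t => by simp⟩

theorem Good.shift {γ : ℝ → ℂ} (h : Good γ) (c : ℝ) : Good (fun t => γ (t + c)) := by
  obtain ⟨Ψ, hΨ⟩ := h
  have : Good (fun t => Ψ (PlaneDiffeo.affine (mulEquiv (circ c) (circ_ne_zero c)) 0 (circ t))) := by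
    rw [PlaneDiffeo.good_comp, PlaneDiffeo.good_comp]
    exact good_circ
  convert this using 2 with t
  rw [hΨ, circ_add]
  simp

theorem Good.reverse {γ : ℝ → ℂ} (h : Good γ) : Good (fun t => γ (-t)) := by
  obtain ⟨Ψ, hΨ⟩ := h
  have : Good (fun t => Ψ (PlaneDiffeo.affine Complex.conjCLE 0 (circ t))) := by
    rw [PlaneDiffeo.good_comp, PlaneDiffeo.good_comp]
    exact good_circ
  convert this using 2 with t
  rw [hΨ, circ_neg]
  simp

theorem good_shift {γ : ℝ → ℂ} (c : ℝ) : Good (fun t => γ (t + c)) ↔ Good γ :=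
  ⟨fun h => by simpa using h.shift (-c), fun h => h.shift c⟩

theorem good_reverse {γ : ℝ → ℂ} : Good (fun t => γ (-t)) ↔ Good γ :=
  ⟨fun h => by simpa using h.reverse, fun h => h.reverse⟩

theorem good'_shift {π : ℝ → ℂ} (c : ℝ) : Good' (fun t => π (t + c)) ↔ Good' π := by
  simp only [Good', mollify.shift, good_shift]

theorem good'_reverse {π : ℝ → ℂ} : Good' (fun t => π (-t)) ↔ Good' π := by
  simp only [Good', mollify.reverse, good_reverse (γ := mollify _ π)]

theorem good'_affine {π : ℝ → ℂ} (hπ : Continuous π) (A : ℂ ≃L[ℝ] ℂ) (b : ℂ) :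
    Good' (fun t => A (π t) + b) ↔ Good' π := by
  simp only [Good', mollify.affine A b hπ]
  exact eventually_congr (Eventually.of_forall fun k =>
    (PlaneDiffeo.affine A b).good_comp (γ := mollify k π))

end

theorem LoopInj.exists_separation {π : ℝ → ℂ} (hc : Continuous π) (hp : Periodic π 1)
    (hi : LoopInj π) {r : ℝ} (hr : 0 < r) :
    ∃ m > 0, ∀ s t : ℝ, (∀ k : ℤ, r ≤ |s - t - k|) → m ≤ dist (π s) (π t) := by
  let S : Set (ℝ × ℝ) := (Icc 0 1 ×ˢ Icc 0 1) ∩ {p | ∀ k : ℤ, r ≤ |p.1 - p.2 - k|}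
  have hS : IsCompact S := by
    apply (isCompact_Icc.prod isCompact_Icc).inter_right
    simp only [Set.ofPred_forall]
    exact isClosed_iInter fun k => isClosed_le continuous_const (by fun_prop)
  have hpos : ∀ p ∈ S, 0 < dist (π p.1) (π p.2) := by
    rintro ⟨s, t⟩ ⟨-, h⟩
    rw [dist_pos]
    intro he
    obtain ⟨k, hk⟩ := hi s t he
    have := h (-k)
    simp only [hk] at this
    norm_num at this
    linarith
  obtain ⟨m, hm, hm'⟩ : ∃ m > 0, ∀ p ∈ S, m ≤ dist (π p.1) (π p.2) := by
    rcases S.eq_empty_or_nonempty with h | h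
    · exact ⟨1, one_pos, by simp [h]⟩
    · obtain ⟨p, hpS, hp⟩ := hS.exists_isMinOn h
        (f := fun p : ℝ × ℝ => dist (π p.1) (π p.2)) (by fun_prop)
      exact ⟨_, hpos p hpS, fun q hq => hp hq⟩
  refine ⟨m, hm, fun s t h => ?_⟩
  have hs : π (Int.fract s) = π s := by
    rw [← hp.add_int (Int.fract s) ⌊s⌋, Int.fract_add_floor]
  have ht : π (Int.fract t) = π t := by
    rw [← hp.add_int (Int.fract t) ⌊t⌋, Int.fract_add_floor]
  rw [← hs, ← ht]
  refine hm' (Int.fract s, Int.fract t) ⟨⟨⟨Int.fract_nonneg _, (Int.fract_lt_one _).le⟩,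
    ⟨Int.fract_nonneg _, (Int.fract_lt_one _).le⟩⟩, fun k => ?_⟩
  have := h (k + ⌊s⌋ - ⌊t⌋)
  simp only [Int.fract]
  convert this using 2
  push_cast
  ring

theorem LoopInj.of_close {π₀ π : ℝ → ℂ} {r m : ℝ} {n : ℝ → ℂ →L[ℝ] ℝ} (hp : Periodic π 1)
    (hm : ∀ s t : ℝ, (∀ k : ℤ, r ≤ |s - t - k|) → m ≤ dist (π₀ s) (π₀ t))
    (hw : ∀ c, Win π (n c) (c - r) (c + r)) (hd : ∀ t, dist (π t) (π₀ t) < m / 2) :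
    LoopInj π := by
  intro s t hst
  by_contra hk
  push Not at hk
  have : ∃ k : ℤ, |s - t - k| < r := by
    by_contra h
    push Not at h
    have h1 := hm s t h
    have h2 := dist_triangle4_right (π₀ s) (π₀ t) (π s) (π t)
    have h3 := hd s
    have h4 := hd t
    rw [hst, dist_self] at h2
    rw [dist_comm] at h3 h4
    rw [hst] at h3
    linarith
  obtain ⟨k, hk'⟩ := this
  have h5 := abs_lt.1 hk'
  have h6 : π s = π (t + k) := by rw [hp.add_int, hst]
  have : s = t + k := by
    rcases le_total s (t + k) with h | h
    · exact (hw s).eq_of_eq (by linarith) h (by linarith) h6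
    · exact ((hw s).eq_of_eq (by linarith) h (by linarith) h6.symm).symm
  exact hk (-k) (by rw [this]; simp)

theorem IsLoop.of_win {γ : ℝ → ℂ} {r : ℝ} {n : ℝ → ℂ →L[ℝ] ℝ} (hs : ContDiff ℝ ∞ γ)
    (hp : Periodic γ 1) (hi : LoopInj γ) (hr : 0 < r) (hw : ∀ c, Win γ (n c) (c - r) (c + r)) :
    IsLoop γ :=
  ⟨hs, hp, fun t => (hw t).deriv_ne_zero ⟨by linarith, by linarith⟩
    (hs.differentiable (by simp) t), hi⟩

theorem eventually_mollify_dist {π : ℝ → ℂ} (hc : Continuous π) (hp : Periodic π 1) {ε : ℝ}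
    (hε : 0 < ε) : ∀ᶠ k in atTop, ∀ x, dist (mollify k π x) (π x) ≤ ε := by
  have hu : UniformContinuous π := by
    have hl : Continuous hp.lift := continuous_quot_lift _ hc
    have h1 : UniformContinuous ((↑) : ℝ → AddCircle (1 : ℝ)) :=
      uniformContinuous_addMonoidHom_of_continuous
        (f := QuotientAddGroup.mk' (AddSubgroup.zmultiples (1 : ℝ))) continuous_quot_mk
    exact (CompactSpace.uniformContinuous_of_continuous hl).comp h1
  obtain ⟨δ, hδ, h⟩ := Metric.uniformContinuous_iff.1 hu ε hε
  obtain ⟨N, hN⟩ := exists_nat_one_div_lt hδ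
  filter_upwards [eventually_ge_atTop N] with k hk x
  refine mollify.dist_le hc (fun x y hxy => (h (hxy.trans (lt_of_le_of_lt ?_ hN))).le) x
  exact Nat.one_div_le_one_div hk

/-- Two smooth loops that are close to a given injective path and have the same windows are
equivalent. -/
theorem loopEquiv_of_close {π₀ γ₀ γ₁ : ℝ → ℂ} {r m : ℝ} {n : ℝ → ℂ →L[ℝ] ℝ} (hr : 0 < r)
    (hm : ∀ s t : ℝ, (∀ k : ℤ, r ≤ |s - t - k|) → m ≤ dist (π₀ s) (π₀ t))
    (hs₀ : ContDiff ℝ ∞ γ₀) (hp₀ : Periodic γ₀ 1) (hw₀ : ∀ c, Win γ₀ (n c) (c - r) (c + r))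
    (hd₀ : ∀ t, dist (γ₀ t) (π₀ t) < m / 2)
    (hs₁ : ContDiff ℝ ∞ γ₁) (hp₁ : Periodic γ₁ 1) (hw₁ : ∀ c, Win γ₁ (n c) (c - r) (c + r))
    (hd₁ : ∀ t, dist (γ₁ t) (π₀ t) < m / 2) : LoopEquiv γ₀ γ₁ := by
  apply LoopEquiv.of_straight
  intro τ hτ
  have hp : Periodic (fun t => γ₀ t + τ * (γ₁ t - γ₀ t)) 1 := by
    intro t
    simp only [hp₀ t, hp₁ t]
  have hw : ∀ c, Win (fun t => γ₀ t + τ * (γ₁ t - γ₀ t)) (n c) (c - r) (c + r) :=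
    fun c => (hw₀ c).convexCombo (hw₁ c) hτ
  refine IsLoop.of_win ?_ hp (LoopInj.of_close hp hm hw fun t => ?_) hr hw
  · exact hs₀.add (contDiff_const.mul (hs₁.sub hs₀))
  · have := (convex_ball (π₀ t) (m / 2)).add_smul_sub_mem (x := γ₀ t) (y := γ₁ t) (hd₀ t) (hd₁ t) hτ
    simpa [Complex.real_smul] using this

/-- Stability of injectivity and of `Good'` under small perturbations with common windows. -/
theorem good'_stable {π₀ : ℝ → ℂ} (hc₀ : Continuous π₀) (hp₀ : Periodic π₀ 1) (hi₀ : LoopInj π₀)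
    {r : ℝ} (hr : 0 < r) {n : ℝ → ℂ →L[ℝ] ℝ} (hw₀ : ∀ c, Win π₀ (n c) (c - r) (c + r)) :
    ∃ m > 0, ∀ π : ℝ → ℂ, Continuous π → Periodic π 1 → (∀ c, Win π (n c) (c - r) (c + r)) →
      (∀ t, dist (π t) (π₀ t) < m) →
      LoopInj π ∧ (Good' π ↔ Good' π₀) ∧ (IsLoop π → (Good π ↔ Good' π₀)) := by
  obtain ⟨m, hm, hsep⟩ := hi₀.exists_separation hc₀ hp₀ (half_pos hr)
  refine ⟨m / 4, by positivity, fun π hc hp hw hd => ?_⟩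
  obtain ⟨N, hN⟩ := exists_nat_one_div_lt (half_pos hr)
  have hwin : ∀ k ≥ N, ∀ π : ℝ → ℂ, Continuous π → (∀ c, Win π (n c) (c - r) (c + r)) →
      ∀ c, Win (mollify k π) (n c) (c - r / 2) (c + r / 2) := by
    intro k hk π hc hw c
    apply mollify.win (r := r / 2) hc
    · apply (hw c).mono <;> linarith
    · exact (Nat.one_div_le_one_div hk).trans hN.le
  have hw2 : ∀ c, Win π (n c) (c - r / 2) (c + r / 2) :=
    fun c => (hw c).mono (by linarith) (by linarith)
  have hd2 : ∀ t, dist (π t) (π₀ t) < m / 2 := fun t => (hd t).trans (by linarith)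
  have hmol : ∀ᶠ k in atTop, LoopEquiv (mollify k π) (mollify k π₀) ∧
      (IsLoop π → LoopEquiv π (mollify k π₀)) := by
    filter_upwards [eventually_ge_atTop N,
      eventually_mollify_dist hc₀ hp₀ (ε := m / 4) (by positivity),
      eventually_mollify_dist hc hp (ε := m / 5) (by positivity)] with k hk h0 h1
    have e0 : ∀ t, dist (mollify k π₀ t) (π₀ t) < m / 2 := fun t => (h0 t).trans_lt (by linarith)
    have e1 : ∀ t, dist (mollify k π t) (π₀ t) < m / 2 := fun t => by
      have := dist_triangle (mollify k π t) (π t) (π₀ t)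
      have := h1 t
      have := hd t
      linarith
    exact ⟨loopEquiv_of_close (half_pos hr) hsep (mollify.contDiff hc) (mollify.periodic hp)
      (hwin k hk π hc hw) e1 (mollify.contDiff hc₀) (mollify.periodic hp₀)
      (hwin k hk π₀ hc₀ hw₀) e0, fun h =>
      loopEquiv_of_close (half_pos hr) hsep h.smooth hp hw2 hd2 (mollify.contDiff hc₀)
        (mollify.periodic hp₀) (hwin k hk π₀ hc₀ hw₀) e0⟩
  refine ⟨LoopInj.of_close hp hsep hw2 hd2, eventually_congr ?_, fun h => ?_⟩
  · filter_upwards [hmol] with k hk using hk.1.good_iff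
  · have : Good' π₀ ↔ ∀ᶠ _ : ℕ in atTop, Good π := by
      apply eventually_congr
      filter_upwards [hmol] with k hk using (hk.2 h).good_iff.symm
    rw [this, eventually_const]

/-- Paths which are uniformly monotone in some direction near each parameter. -/
def HasWin (π : ℝ → ℂ) : Prop := ∀ t, ∃ n, ∃ ε > 0, Win π n (t - ε) (t + ε)

theorem Win.add_int {π : ℝ → ℂ} (hp : Periodic π 1) {n : ℂ →L[ℝ] ℝ} {a b : ℝ} (h : Win π n a b)
    (k : ℤ) : Win π n (a + k) (b + k) := by
  intro s s' h1 h2 h3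
  have := h (s := s - k) (s' := s' - k) (by linarith) (by linarith) (by linarith)
  have e : ∀ x, π (x - k) = π x := fun x => by rw [← hp.add_int (x - k) k, sub_add_cancel]
  rw [e, e] at this
  linarith

/-- Local windows give windows of uniform size. -/
theorem exists_uniform_win {F : Filter (ℝ → ℂ)} (hF : ∀ᶠ π in F, Periodic π 1)
    (h : ∀ t, ∃ n : ℂ →L[ℝ] ℝ, ∃ ε > 0, ∀ᶠ π in F, Win π n (t - ε) (t + ε)) :
    ∃ r > 0, ∃ n : ℝ → ℂ →L[ℝ] ℝ, ∀ᶠ π in F, ∀ c, Win π (n c) (c - r) (c + r) := by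
  have key : ∃ r > 0, ∃ n : ℝ → ℂ →L[ℝ] ℝ, ∀ᶠ π in F, ∀ c ∈ Icc (0 : ℝ) 1,
      Win π (n c) (c - r) (c + r) := by
    refine isCompact_Icc.induction_on (p := fun S => ∃ r > 0, ∃ n : ℝ → ℂ →L[ℝ] ℝ, ∀ᶠ π in F,
      ∀ c ∈ S, Win π (n c) (c - r) (c + r)) ⟨1, one_pos, 0, by simp⟩ ?_ ?_ ?_
    · rintro S T hST ⟨r, hr, n, hn⟩
      exact ⟨r, hr, n, hn.mono fun π hπ c hc => hπ c (hST hc)⟩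
    · classical
      rintro S T ⟨r, hr, n, hn⟩ ⟨r', hr', n', hn'⟩
      refine ⟨min r r', lt_min hr hr', fun c => if c ∈ S then n c else n' c, ?_⟩
      filter_upwards [hn, hn'] with π h1 h2 c hc
      by_cases hcS : c ∈ S
      · simp only [hcS, if_true]
        exact (h1 c hcS).mono (by linarith [min_le_left r r']) (by linarith [min_le_left r r'])
      · simp only [hcS, if_false]
        exact (h2 c (hc.resolve_left hcS)).mono (by linarith [min_le_right r r'])
          (by linarith [min_le_right r r'])
    · intro t _
      obtain ⟨n, ε, hε, hn⟩ := h t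
      refine ⟨_, mem_nhdsWithin_of_mem_nhds (Metric.ball_mem_nhds t (half_pos hε)), ε / 2,
        half_pos hε, fun _ => n, hn.mono fun π hπ c hc => ?_⟩
      rw [Metric.mem_ball, Real.dist_eq, abs_lt] at hc
      exact hπ.mono (by linarith) (by linarith)
  obtain ⟨r, hr, n, hn⟩ := key
  refine ⟨r, hr, fun c => n (Int.fract c), ?_⟩
  filter_upwards [hF, hn] with π hp hπ c
  have := (hπ (Int.fract c) ⟨Int.fract_nonneg _, (Int.fract_lt_one _).le⟩).add_int hp ⌊c⌋
  convert this using 1 <;> rw [Int.fract] <;> ring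

theorem good_iff_good' {γ : ℝ → ℂ} (h : IsLoop γ) (hw : HasWin γ) : Good γ ↔ Good' γ := by
  obtain ⟨r, hr, n, hn⟩ := exists_uniform_win (F := pure γ) (by simpa using h.periodic)
    (by simpa [HasWin] using hw)
  obtain ⟨m, hm, H⟩ := good'_stable h.smooth.continuous h.periodic h.inj hr (by simpa using hn)
  exact (H γ h.smooth.continuous h.periodic (by simpa using hn) (by simpa using hm)).2.2 h

/-- Local constancy of `Good'`: filter version, with convergence and windows assumed locally. -/
theorem eventually_good'_iff {ι : Type*} {𝓕 : Filter ι} {Γ : ι → ℝ → ℂ} {π₀ : ℝ → ℂ}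
    (hc₀ : Continuous π₀) (hp₀ : Periodic π₀ 1) (hi₀ : LoopInj π₀)
    (hc : ∀ᶠ i in 𝓕, Continuous (Γ i)) (hp : ∀ᶠ i in 𝓕, Periodic (Γ i) 1)
    (hlim : ∀ t, Tendsto (fun q : ι × ℝ => Γ q.1 q.2) (𝓕 ×ˢ 𝓝 t) (𝓝 (π₀ t)))
    (hw : ∀ t, ∃ n, ∃ ε > 0, Win π₀ n (t - ε) (t + ε) ∧ ∀ᶠ i in 𝓕, Win (Γ i) n (t - ε) (t + ε)) :
    ∀ᶠ i in 𝓕, LoopInj (Γ i) ∧ (Good' (Γ i) ↔ Good' π₀) ∧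
      (IsLoop (Γ i) → (Good (Γ i) ↔ Good' π₀)) := by
  obtain ⟨r, hr, n, hn⟩ := exists_uniform_win (F := pure π₀ ⊔ map Γ 𝓕)
    (by simpa using ⟨hp₀, hp⟩) (by simpa [HasWin] using hw)
  obtain ⟨hn₀, hn⟩ : (∀ c, Win π₀ (n c) (c - r) (c + r)) ∧
      ∀ᶠ i in 𝓕, ∀ c, Win (Γ i) (n c) (c - r) (c + r) := by simpa using hn
  obtain ⟨m, hm, H⟩ := good'_stable hc₀ hp₀ hi₀ hr hn₀
  have hclose : ∀ᶠ i in 𝓕, ∀ t ∈ Icc (0 : ℝ) 1, dist (Γ i t) (π₀ t) < m := by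
    refine isCompact_Icc.induction_on (p := fun S => ∀ᶠ i in 𝓕, ∀ t ∈ S, dist (Γ i t) (π₀ t) < m)
      (by simp) (fun S T hST h => h.mono fun i hi t ht => hi t (hST ht)) (fun S T h1 h2 => ?_)
      fun t _ => ?_
    · filter_upwards [h1, h2] with i h1 h2 t ht using ht.elim (h1 t) (h2 t)
    · have h1 := (hlim t).dist ((hc₀.tendsto t).comp tendsto_snd)
      rw [dist_self] at h1
      obtain ⟨P, hP, Q, hQ, hPQ⟩ := eventually_prod_iff.1 (h1.eventually (gt_mem_nhds hm))
      exact ⟨{x | Q x}, mem_nhdsWithin_of_mem_nhds hQ, hP.mono fun i hi s hs => hPQ hi hs⟩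
  filter_upwards [hc, hp, hn, hclose] with i h1 h2 h3 h4
  refine H _ h1 h2 h3 fun t => ?_
  have e := h4 (Int.fract t) ⟨Int.fract_nonneg _, (Int.fract_lt_one _).le⟩
  have e1 := h2.add_int (Int.fract t) ⌊t⌋
  have e2 := hp₀.add_int (Int.fract t) ⌊t⌋
  rw [Int.fract_add_floor] at e1 e2
  rwa [← e1, ← e2] at e

theorem Win.concat_inter {π : ℝ → ℂ} {n : ℂ →L[ℝ] ℝ} {a b c : ℝ} (h : Win π n a (min c b))
    (h' : Win π n (max a b) c) : Win π n a c := by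
  intro s s' h1 h2 h3
  rcases le_total s' b with hb | hb
  · exact h h1 h2 (le_min h3 hb)
  rcases le_total s b with hs | hs
  · have e1 := h h1 hs (le_min (hb.trans h3) le_rfl)
    have e2 := h' (max_le (h1.trans hs) le_rfl) hb h3
    simp only [map_sub] at *
    linarith
  · exact h' (max_le h1 hs) h2 h3

theorem Win.smul {π : ℝ → ℂ} {n : ℂ →L[ℝ] ℝ} {a b κ : ℝ} (h : Win π n a b) (h0 : 0 < κ)
    (h1 : κ ≤ 1) : Win π (κ⁻¹ • n) a b :=
  Win.scale h0 fun s s' h2 h3 h4 => by nlinarith [h h2 h3 h4]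

/-- Replacement of `π` on `[l, r]` by its chord. -/
noncomputable def chordFun (π : ℝ → ℂ) (l r t : ℝ) : ℂ :=
  π (min t l) + π (max t r) - π r + max 0 (min 1 ((t - l) / (r - l))) • (π r - π l)

namespace chordFun
variable {π : ℝ → ℂ} {l r t : ℝ}

theorem of_le (hlr : l ≤ r) (h : t ≤ l) : chordFun π l r t = π t := by
  have : (t - l) / (r - l) ≤ 0 := div_nonpos_of_nonpos_of_nonneg (by linarith) (by linarith)
  rw [chordFun, min_eq_left h, max_eq_right (h.trans hlr), max_eq_left ((min_le_right _ _).trans this)]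
  simp

theorem of_mem (h : l ≤ t) (h' : t ≤ r) :
    chordFun π l r t = π l + ((t - l) / (r - l)) • (π r - π l) := by
  have h1 : 0 ≤ (t - l) / (r - l) := div_nonneg (by linarith) (by linarith)
  have h2 : (t - l) / (r - l) ≤ 1 := div_le_one_of_le₀ (by linarith) (by linarith)
  rw [chordFun, min_eq_right h, max_eq_right h', min_eq_right h2, max_eq_right h1]
  simp

theorem of_ge (hlr : l ≤ r) (h : r ≤ t) : chordFun π l r t = π t := by
  rcases hlr.eq_or_lt with rfl | hlr'
  · rw [chordFun, min_eq_right h, max_eq_left h]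
    simp
  · have : 1 ≤ (t - l) / (r - l) := by rw [one_le_div (by linarith)]; linarith
    rw [chordFun, min_eq_right (hlr.trans h), max_eq_left h, min_eq_left this]
    simp

theorem continuous (hc : Continuous π) : Continuous (chordFun π l r) := by
  unfold chordFun
  fun_prop

theorem continuousAt (hc : Continuous π) {l₀ r₀ t₀ : ℝ} :
    ContinuousAt (fun q : (ℝ × ℝ) × ℝ => chordFun π q.1.1 q.1.2 q.2) ((l₀, r₀), t₀) := by
  unfold chordFun
  refine ContinuousAt.add (by fun_prop) ?_
  rcases eq_or_ne l₀ r₀ with rfl | h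
  · have h1 : Tendsto (fun q : (ℝ × ℝ) × ℝ => π q.1.2 - π q.1.1) (𝓝 ((l₀, l₀), t₀)) (𝓝 0) := by
      have : Continuous (fun q : (ℝ × ℝ) × ℝ => π q.1.2 - π q.1.1) := by fun_prop
      exact this.tendsto' _ _ (sub_self _)
    rw [ContinuousAt]
    simp only [sub_self, smul_zero]
    refine squeeze_zero_norm (fun q => ?_) (by simpa using h1.norm)
    rw [norm_smul, Real.norm_eq_abs, abs_of_nonneg (le_max_left _ _)]
    exact mul_le_of_le_one_left (norm_nonneg _) (max_le zero_le_one (min_le_left _ _))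
  · have : ContinuousAt (fun q : (ℝ × ℝ) × ℝ => (q.2 - q.1.1) / (q.1.2 - q.1.1))
        ((l₀, r₀), t₀) := by
      apply ContinuousAt.div (by fun_prop) (by fun_prop)
      simpa [sub_eq_zero] using h.symm
    exact (continuousAt_const.max (continuousAt_const.min this)).smul
      (Continuous.continuousAt (by fun_prop))

end chordFun

/-- Periodic replacement of a `1`-periodic path by its chord on `[l, r] ⊆ [a, a + 1]`. -/
noncomputable def chord (a : ℝ) (π : ℝ → ℂ) (l r t : ℝ) : ℂ :=
  AddCircle.liftIco 1 a (chordFun π l r) (t : AddCircle (1 : ℝ))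

namespace chord
variable {π : ℝ → ℂ} {a l r t : ℝ}

theorem periodic : Periodic (chord a π l r) 1 := fun t => by
  rw [chord, chord, AddCircle.coe_add_period]

theorem continuous (hc : Continuous π) (hp : Periodic π 1) (h1 : a ≤ l) (h2 : l ≤ r)
    (h3 : r ≤ a + 1) : Continuous (chord a π l r) := by
  refine (AddCircle.liftIco_continuous ?_ (chordFun.continuous hc).continuousOn).comp
    continuous_quot_mk
  rw [chordFun.of_le h2 h1, chordFun.of_ge h2 h3, hp]

theorem eq_chordFun (hp : Periodic π 1) (h1 : a ≤ l) (h2 : l ≤ r) (h3 : r ≤ a + 1)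
    (ht : t ∈ Icc a (a + 1)) : chord a π l r t = chordFun π l r t := by
  rcases ht.2.eq_or_lt with rfl | h
  · rw [periodic, chord, AddCircle.liftIco_coe_apply ⟨le_rfl, by linarith⟩, chordFun.of_le h2 h1,
      chordFun.of_ge h2 h3, hp]
  · rw [chord, AddCircle.liftIco_coe_apply ⟨ht.1, h⟩]

theorem eq_of_mem (hp : Periodic π 1) (h1 : a ≤ l) (h2 : l ≤ r) (h3 : r ≤ a + 1)
    (ht : t ∈ Icc l r) : chord a π l r t = π l + ((t - l) / (r - l)) • (π r - π l) := by
  rw [eq_chordFun hp h1 h2 h3 ⟨h1.trans ht.1, ht.2.trans h3⟩, chordFun.of_mem ht.1 ht.2]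

theorem eq_of_ge (hp : Periodic π 1) (h1 : a ≤ l) (h2 : l ≤ r) (h3 : r ≤ a + 1)
    (ht : t ∈ Icc r (l + 1)) : chord a π l r t = π t := by
  rcases le_total t (a + 1) with h | h
  · rw [eq_chordFun hp h1 h2 h3 ⟨(h1.trans h2).trans ht.1, h⟩, chordFun.of_ge h2 ht.1]
  · have e : chord a π l r (t - 1 + 1) = chord a π l r (t - 1) := periodic _
    have e' : π (t - 1 + 1) = π (t - 1) := hp _
    rw [sub_add_cancel] at e e'
    rw [e, e', eq_chordFun hp h1 h2 h3 ⟨by linarith, by linarith [ht.2]⟩,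
      chordFun.of_le h2 (by linarith [ht.2])]

theorem eq_of_le (hp : Periodic π 1) (h1 : a ≤ l) (h2 : l ≤ r) (h3 : r ≤ a + 1)
    (ht : t ∈ Icc (r - 1) l) : chord a π l r t = π t := by
  have e : chord a π l r (t + 1) = chord a π l r t := periodic _
  rw [← e, ← hp t, eq_of_ge hp h1 h2 h3 ⟨by linarith [ht.1], by linarith [ht.2]⟩]

theorem self (hp : Periodic π 1) (h1 : a ≤ l) (h3 : l ≤ a + 1) : chord a π l l = π := by
  ext t
  have ht : t = l + Int.fract (t - l) + ⌊t - l⌋ := by rw [Int.fract]; ring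
  rw [ht, periodic.add_int, hp.add_int, eq_of_ge hp h1 le_rfl h3
    ⟨by linarith [Int.fract_nonneg (t - l)], by linarith [Int.fract_lt_one (t - l)]⟩]

theorem win (hp : Periodic π 1) (h1 : a ≤ l) (h2 : l ≤ r) (h3 : r ≤ a + 1) {n : ℂ →L[ℝ] ℝ}
    {A B : ℝ} (hA : r - 1 ≤ A) (hB : B ≤ l + 1) (hwl : Win π n A (min B l))
    (hwr : Win π n (max A r) B) (hn : A < r → l < B → r - l ≤ n (π r - π l)) :
    Win (chord a π l r) n A B := by
  apply Win.concat_inter (b := l)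
  · exact hwl.congr fun t ht => eq_of_le hp h1 h2 h3 ⟨hA.trans ht.1, ht.2.trans (min_le_right _ _)⟩
  apply Win.concat_inter (b := r)
  · intro s s' hs hss hs'
    rcases hss.eq_or_lt with rfl | hss
    · simp
    obtain ⟨hs1, hs2⟩ := max_le_iff.1 hs
    obtain ⟨hs3, hs4⟩ := le_min_iff.1 hs'
    rw [eq_of_mem hp h1 h2 h3 ⟨hs2, hss.le.trans hs4⟩, eq_of_mem hp h1 h2 h3 ⟨hs2.trans hss.le, hs4⟩,
      add_sub_add_left_eq_sub, ← sub_smul, map_smul, ← sub_div, smul_eq_mul, sub_sub_sub_cancel_right,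
      div_mul_eq_mul_div, le_div_iff₀ (by linarith)]
    exact mul_le_mul_of_nonneg_left (hn (by linarith) (by linarith)) (by linarith)
  · refine (hwr.mono ?_ le_rfl).congr fun t ht => eq_of_ge hp h1 h2 h3
      ⟨(le_max_right _ _).trans ht.1, ht.2.trans hB⟩
    exact max_le_max (le_max_left _ _) le_rfl

end chord

theorem eventually_chord_good'_iff {π : ℝ → ℂ} (hc : Continuous π) (hp : Periodic π 1)
    (hw : HasWin π) {a l₀ r₀ : ℝ} (ha : a < l₀) (hlr : l₀ ≤ r₀) (hb : r₀ < a + 1)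
    (hi : LoopInj (chord a π l₀ r₀))
    (hl : l₀ < r₀ → ∃ n, ∃ ε > 0, Win π n (l₀ - ε) (l₀ + ε) ∧ 0 < n (π r₀ - π l₀))
    (hr : l₀ < r₀ → ∃ n, ∃ ε > 0, Win π n (r₀ - ε) (r₀ + ε) ∧ 0 < n (π r₀ - π l₀)) :
    ∀ᶠ q : ℝ × ℝ in 𝓝 (l₀, r₀), q.1 ≤ q.2 → LoopInj (chord a π q.1 q.2) ∧
      (Good' (chord a π q.1 q.2) ↔ Good' (chord a π l₀ r₀)) := by
  let S : Set (ℝ × ℝ) := {q | q.1 ≤ q.2}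
  suffices h : ∀ᶠ q : ℝ × ℝ in 𝓝[S] (l₀, r₀), LoopInj (chord a π q.1 q.2) ∧
      (Good' (chord a π q.1 q.2) ↔ Good' (chord a π l₀ r₀)) ∧
      (IsLoop (chord a π q.1 q.2) → (Good (chord a π q.1 q.2) ↔ Good' (chord a π l₀ r₀))) by
    filter_upwards [eventually_nhdsWithin_iff.1 h] with q hq hq' using ⟨(hq hq').1, (hq hq').2.1⟩
  have hfst : Tendsto Prod.fst (𝓝[S] (l₀, r₀)) (𝓝 l₀) :=
    (continuous_fst.tendsto (l₀, r₀)).mono_left nhdsWithin_le_nhds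
  have hsnd : Tendsto Prod.snd (𝓝[S] (l₀, r₀)) (𝓝 r₀) :=
    (continuous_snd.tendsto (l₀, r₀)).mono_left nhdsWithin_le_nhds
  have hbase : ∀ᶠ q : ℝ × ℝ in 𝓝[S] (l₀, r₀), a ≤ q.1 ∧ q.1 ≤ q.2 ∧ q.2 ≤ a + 1 := by
    filter_upwards [hfst.eventually (lt_mem_nhds ha), hsnd.eventually (gt_mem_nhds hb),
      self_mem_nhdsWithin] with q h1 h2 h3 using ⟨h1.le, h3, h2.le⟩
  have hself : ∀ {P : ℝ × ℝ → Prop}, (∀ᶠ q in 𝓝[S] (l₀, r₀), P q) → P (l₀, r₀) :=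
    fun {P} h => mem_of_mem_nhdsWithin hlr h
  have hdiff : Tendsto (fun q : ℝ × ℝ => π q.2 - π q.1) (𝓝[S] (l₀, r₀)) (𝓝 (π r₀ - π l₀)) :=
    ((hc.tendsto _).comp hsnd).sub ((hc.tendsto _).comp hfst)
  have hpoint : ∀ t, ∃ s ∈ Ico a (a + 1), ∃ k : ℤ, t = s + k := fun t => by
    refine ⟨t - ⌊t - a⌋, ⟨?_, ?_⟩, ⌊t - a⌋, by ring⟩
    · linarith [Int.floor_le (t - a)]
    · linarith [Int.lt_floor_add_one (t - a)]
  refine eventually_good'_iff (chord.continuous hc hp ha.le hlr hb.le) chord.periodic hi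
    (hbase.mono fun q hq => chord.continuous hc hp hq.1 hq.2.1 hq.2.2)
    (Eventually.of_forall fun q => chord.periodic) (fun t => ?_) fun t => ?_
  · obtain ⟨s, hs, k, rfl⟩ := hpoint t
    suffices h : Tendsto (fun q : (ℝ × ℝ) × ℝ => chord a π q.1.1 q.1.2 q.2)
        (𝓝[S] (l₀, r₀) ×ˢ 𝓝 s) (𝓝 (chord a π l₀ r₀ s)) by
      rw [chord.periodic.add_int]
      have h2 : Tendsto (fun x : ℝ => x - k) (𝓝 (s + k)) (𝓝 s) := by
        have : ContinuousAt (fun x : ℝ => x - k) (s + k) := by fun_prop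
        simpa [ContinuousAt] using this
      refine (h.comp (tendsto_id.prodMap h2)).congr fun q => ?_
      simp only [comp_apply, Prod.map, id]
      rw [← chord.periodic.add_int _ k, sub_add_cancel]
    rcases lt_or_ge s l₀ with hsl | hsl
    · rw [chord.eq_of_le hp ha.le hlr hb.le ⟨by linarith [hs.1], hsl.le⟩]
      refine Tendsto.congr' ?_ ((hc.tendsto s).comp tendsto_snd)
      filter_upwards [(hbase.and ((hfst.eventually (lt_mem_nhds (show (s + l₀) / 2 < l₀ by
        linarith))).and (hsnd.eventually (gt_mem_nhds (show r₀ < (r₀ + (a + 1)) / 2 by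
        linarith))))).prod_mk (Ioo_mem_nhds (show s - (a + 1 - r₀) / 2 < s by linarith)
        (show s < (s + l₀) / 2 by linarith))] with q ⟨⟨h1, h2, h3⟩, h4⟩
      exact (chord.eq_of_le hp h1.1 h1.2.1 h1.2.2
        ⟨by linarith [h4.1, hs.1], by linarith [h4.2]⟩).symm
    · rw [chord.eq_chordFun hp ha.le hlr hb.le (Ico_subset_Icc_self hs)]
      have h := chordFun.continuousAt hc (l₀ := l₀) (r₀ := r₀) (t₀ := s)
      rw [ContinuousAt, nhds_prod_eq] at h
      refine (h.mono_left (Filter.prod_mono_left _ nhdsWithin_le_nhds)).congr' ?_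
      filter_upwards [hbase.prod_mk (Ioo_mem_nhds (ha.trans_le hsl) hs.2)] with q ⟨h1, h2⟩
      exact (chord.eq_chordFun hp h1.1 h1.2.1 h1.2.2 ⟨h2.1.le, h2.2.le⟩).symm
  · obtain ⟨s, hs, k, rfl⟩ := hpoint t
    suffices h : ∃ n : ℂ →L[ℝ] ℝ, ∃ ε > 0, ∀ᶠ q : ℝ × ℝ in 𝓝[S] (l₀, r₀),
        Win (chord a π q.1 q.2) n (s - ε) (s + ε) by
      obtain ⟨n, ε, hε, h⟩ := h
      have h' : ∀ᶠ q : ℝ × ℝ in 𝓝[S] (l₀, r₀),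
          Win (chord a π q.1 q.2) n (s + k - ε) (s + k + ε) := h.mono fun q hq => by
        convert hq.add_int chord.periodic k using 1 <;> ring
      exact ⟨n, ε, hε, hself h', h'⟩
    suffices h : ∃ n : ℂ →L[ℝ] ℝ, ∃ ε > 0, ε < l₀ - a ∧ ε < a + 1 - r₀ ∧ ε < l₀ + 1 - s ∧
        ε < s - (r₀ - 1) ∧
        ∀ᶠ q : ℝ × ℝ in 𝓝[S] (l₀, r₀), Win π n (s - ε) (min (s + ε) q.1) ∧
          Win π n (max (s - ε) q.2) (s + ε) ∧
          (s - ε < q.2 → q.1 < s + ε → q.2 - q.1 ≤ n (π q.2 - π q.1)) by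
      obtain ⟨n, ε, hε, -, -, h3, h4, h⟩ := h
      refine ⟨n, ε, hε, ?_⟩
      filter_upwards [h, hbase, hfst.eventually (lt_mem_nhds (show s + ε - 1 < l₀ by linarith)),
        hsnd.eventually (gt_mem_nhds (show r₀ < s - ε + 1 by linarith))] with q h5 h6 h7 h8
      exact chord.win hp h6.1 h6.2.1 h6.2.2 (by linarith) (by linarith) h5.1 h5.2.1 h5.2.2
    suffices h : ∃ n : ℂ →L[ℝ] ℝ, ∃ ε₀ > 0, ∀ ε > 0, ε ≤ ε₀ →
        ∀ᶠ q : ℝ × ℝ in 𝓝[S] (l₀, r₀), Win π n (s - ε) (min (s + ε) q.1) ∧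
          Win π n (max (s - ε) q.2) (s + ε) ∧
          (s - ε < q.2 → q.1 < s + ε → q.2 - q.1 ≤ n (π q.2 - π q.1)) by
      obtain ⟨n, ε₀, hε₀, h⟩ := h
      obtain ⟨ε, hε, h5⟩ := exists_between (show 0 < min ε₀ (min (l₀ - a) (min (a + 1 - r₀)
        (min (l₀ + 1 - s) (s - (r₀ - 1))))) by
          simp only [lt_min_iff]
          exact ⟨hε₀, by linarith, by linarith, by linarith [hs.2], by linarith [hs.1]⟩)
      simp only [lt_min_iff] at h5
      exact ⟨n, ε, hε, h5.2.1, h5.2.2.1, h5.2.2.2.1, h5.2.2.2.2, h ε hε h5.1.le⟩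
    have hsub : ∀ {n ε₀ ε}, Win π n (s - ε₀) (s + ε₀) → ε ≤ ε₀ → ∀ q : ℝ × ℝ,
        Win π n (s - ε) (min (s + ε) q.1) ∧ Win π n (max (s - ε) q.2) (s + ε) :=
      fun hn hε q => ⟨hn.mono (by linarith) ((min_le_left _ _).trans (by linarith)),
        hn.mono ((by linarith : s - _ ≤ s - _).trans (le_max_left _ _)) (by linarith)⟩
    have hcorner : l₀ < r₀ → (∃ n, ∃ ε > 0, Win π n (s - ε) (s + ε) ∧ 0 < n (π r₀ - π l₀)) →
        ∃ n : ℂ →L[ℝ] ℝ, ∃ ε₀ > 0, ∀ ε > 0, ε ≤ ε₀ →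
        ∀ᶠ q : ℝ × ℝ in 𝓝[S] (l₀, r₀), Win π n (s - ε) (min (s + ε) q.1) ∧
          Win π n (max (s - ε) q.2) (s + ε) ∧
          (s - ε < q.2 → q.1 < s + ε → q.2 - q.1 ≤ n (π q.2 - π q.1)) := by
      rintro hlr' ⟨n, ε₀, hε₀, hn, hpos⟩
      obtain ⟨κ, hκ, hκ'⟩ := exists_between (show 0 < min 1 (n (π r₀ - π l₀)) from
        lt_min one_pos hpos)
      rw [lt_min_iff] at hκ'
      refine ⟨κ⁻¹ • n, ε₀, hε₀, fun ε hε hεε => ?_⟩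
      filter_upwards [((n.continuous.tendsto _).comp hdiff).eventually (lt_mem_nhds hκ'.2),
        hbase, hfst.eventually (lt_mem_nhds ha)] with q h1 h2 h3
      refine ⟨(hsub (hn.smul hκ hκ'.1.le) hεε q).1, (hsub (hn.smul hκ hκ'.1.le) hεε q).2,
        fun _ _ => ?_⟩
      rw [_root_.smul_apply, smul_eq_mul, inv_mul_eq_div, le_div_iff₀ hκ]
      simp only [comp_apply] at h1
      nlinarith [h2.1, h2.2.2]
    rcases lt_trichotomy s l₀ with hsl | rfl | hsl
    · obtain ⟨n, ε₀, hε₀, hn⟩ := hw s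
      refine ⟨n, min ε₀ ((l₀ - s) / 2), lt_min hε₀ (by linarith), fun ε hε hεε => ?_⟩
      have := le_min_iff.1 hεε
      filter_upwards [hfst.eventually (lt_mem_nhds (show s + ε < l₀ by linarith))] with q hq
      exact ⟨(hsub hn this.1 q).1, (hsub hn this.1 q).2, fun _ h => by linarith⟩
    · rcases hlr.eq_or_lt with rfl | hlr'
      · obtain ⟨n, ε₀, hε₀, hn⟩ := hw s
        refine ⟨n, ε₀, hε₀, fun ε hε hεε => ?_⟩
        filter_upwards [hfst.eventually (lt_mem_nhds (show s - ε₀ < s by linarith)),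
          hsnd.eventually (gt_mem_nhds (show s < s + ε₀ by linarith)), hbase] with q h1 h2 h3
        exact ⟨(hsub hn hεε q).1, (hsub hn hεε q).2, fun _ _ => hn h1.le h3.2.1 h2.le⟩
      · exact hcorner hlr' (hl hlr')
    rcases lt_trichotomy s r₀ with hsr | rfl | hsr
    · have hne : π r₀ - π l₀ ≠ 0 := by
        intro h0
        have h1 : chord a π l₀ r₀ r₀ = chord a π l₀ r₀ l₀ := by
          rw [chord.eq_of_le hp ha.le hlr hb.le ⟨by linarith, le_rfl⟩,
            chord.eq_of_ge hp ha.le hlr hb.le ⟨le_rfl, by linarith⟩, sub_eq_zero.1 h0]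
        obtain ⟨k, hk⟩ := hi _ _ h1
        have h2 : (-1 : ℝ) < k := by linarith
        have h3 : (k : ℝ) < 0 := by linarith
        norm_cast at h2 h3
        omega
      refine ⟨(2 / ‖π r₀ - π l₀‖ ^ 2) • innerSL ℝ (π r₀ - π l₀), min ((s - l₀) / 2) ((r₀ - s) / 2),
        lt_min (by linarith) (by linarith), fun ε hε hεε => ?_⟩
      have hεε := le_min_iff.1 hεε
      set n := (2 / ‖π r₀ - π l₀‖ ^ 2) • innerSL ℝ (π r₀ - π l₀) with hn
      have hn1 : 1 < n (π r₀ - π l₀) := by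
        rw [hn, _root_.smul_apply, innerSL_apply_apply, real_inner_self_eq_norm_sq, smul_eq_mul,
          div_mul_cancel₀]
        · norm_num
        · simpa using hne
      filter_upwards [((n.continuous.tendsto _).comp hdiff).eventually (lt_mem_nhds hn1), hbase,
        hfst.eventually (gt_mem_nhds (show l₀ < s - ε by linarith)),
        hsnd.eventually (lt_mem_nhds (show s + ε < r₀ by linarith))] with q h1 h2 h3 h4
      refine ⟨fun x y hx hxy hy => ?_, fun x y hx hxy hy => ?_, fun _ _ => ?_⟩
      · linarith [min_le_right (s + ε) q.1]
      · linarith [le_max_right (s - ε) q.2]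
      · simp only [comp_apply] at h1
        linarith
    · exact hcorner hsl (hr hsl)
    · obtain ⟨n, ε₀, hε₀, hn⟩ := hw s
      refine ⟨n, min ε₀ ((s - r₀) / 2), lt_min hε₀ (by linarith), fun ε hε hεε => ?_⟩
      have := le_min_iff.1 hεε
      filter_upwards [hsnd.eventually (gt_mem_nhds (show r₀ < s - ε by linarith))] with q hq
      exact ⟨(hsub hn this.1 q).1, (hsub hn this.1 q).2, fun h _ => by linarith⟩

theorem LoopInj.of_Ico {π : ℝ → ℂ} (hp : Periodic π 1) (a : ℝ)
    (h : ∀ s ∈ Ico a (a + 1), ∀ t ∈ Ico a (a + 1), s ≤ t → π s = π t → s = t) : LoopInj π := by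
  intro s t hst
  have key : ∀ x : ℝ, x - ⌊x - a⌋ ∈ Ico a (a + 1) := fun x =>
    ⟨by linarith [Int.floor_le (x - a)], by linarith [Int.lt_floor_add_one (x - a)]⟩
  have e : ∀ x : ℝ, π (x - ⌊x - a⌋) = π x := fun x => by
    rw [← hp.add_int (x - ⌊x - a⌋) ⌊x - a⌋, sub_add_cancel]
  have : s - ⌊s - a⌋ = t - ⌊t - a⌋ := by
    rcases le_total (s - ⌊s - a⌋) (t - ⌊t - a⌋) with hle | hle
    · exact h _ (key s) _ (key t) hle (by rw [e, e, hst])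
    · exact (h _ (key t) _ (key s) hle (by rw [e, e, hst])).symm
  refine ⟨⌊t - a⌋ - ⌊s - a⌋, ?_⟩
  push_cast
  linarith

theorem LoopInj.eq_of_abs_lt {π : ℝ → ℂ} (h : LoopInj π) {s t : ℝ} (hst : |s - t| < 1)
    (he : π s = π t) : s = t := by
  obtain ⟨k, rfl⟩ := h s t he
  have hk : |(k : ℝ)| < 1 := by simpa using hst
  have : k = 0 := by
    rw [← Int.abs_lt_one_iff]
    exact_mod_cast hk
  simp [this]

theorem chord.loopInj {π : ℝ → ℂ} (hp : Periodic π 1) (hi : LoopInj π) {a l r : ℝ}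
    (h1 : a ≤ l) (h2 : l ≤ r) (h3 : r ≤ a + 1) (h4 : r < l + 1)
    (hseg : l < r → ∀ t ∈ Ioo r (l + 1), ∀ θ ∈ Icc (0 : ℝ) 1, π t ≠ π l + θ • (π r - π l)) :
    LoopInj (chord a π l r) := by
  rcases h2.eq_or_lt with rfl | h2'
  · rwa [chord.self hp h1 h3]
  refine LoopInj.of_Ico chord.periodic l fun s hs t ht hst he => ?_
  have hpos : 0 < r - l := by linarith
  rcases le_total t r with htr | htr
  · rw [chord.eq_of_mem hp h1 h2 h3 ⟨hs.1, hst.trans htr⟩, chord.eq_of_mem hp h1 h2 h3 ⟨ht.1, htr⟩,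
      add_right_inj] at he
    have hne : π r - π l ≠ 0 := by
      rw [sub_ne_zero]
      intro h
      exact h2'.ne' (hi.eq_of_abs_lt (abs_lt.2 ⟨by linarith, by linarith⟩) h)
    have := smul_left_injective ℝ hne he
    simp only [div_left_inj' hpos.ne'] at this
    linarith
  rw [chord.eq_of_ge hp h1 h2 h3 ⟨htr, ht.2.le⟩] at he
  rcases le_total s r with hsr | hsr
  · rw [chord.eq_of_mem hp h1 h2 h3 ⟨hs.1, hsr⟩] at he
    rcases htr.eq_or_lt with rfl | htr
    · have hne : π r - π l ≠ 0 := by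
        rw [sub_ne_zero]
        intro h
        exact h2'.ne' (hi.eq_of_abs_lt (abs_lt.2 ⟨by linarith, by linarith⟩) h)
      have e : ((s - l) / (r - l)) • (π r - π l) = (1 : ℝ) • (π r - π l) := by
        rw [one_smul]
        exact eq_sub_of_add_eq' he
      have := smul_left_injective ℝ hne e
      simp only [div_eq_one_iff_eq hpos.ne'] at this
      linarith
    · exact absurd he.symm (hseg h2' t ⟨htr, ht.2⟩ _ ⟨div_nonneg (by linarith [hs.1]) hpos.le,
        div_le_one_of_le₀ (by linarith) hpos.le⟩)
  · rw [chord.eq_of_ge hp h1 h2 h3 ⟨hsr, hs.2.le⟩] at he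
    exact hi.eq_of_abs_lt (abs_lt.2 ⟨by linarith [hs.1, ht.2], by linarith⟩) he

/-- `Tails π t v w ε`: within `ε` of `t`, the path `π` is affine on either side of `t`, with
incoming velocity `w` and outgoing velocity `v`. -/
structure Tails (π : ℝ → ℂ) (t : ℝ) (v w : ℂ) (ε : ℝ) : Prop where
  pos : 0 < ε
  right : ∀ s ∈ Icc 0 ε, π (t + s) = π t + s • v
  left : ∀ s ∈ Icc 0 ε, π (t - s) = π t - s • w

/-- Simple closed polygons without horizontal edges. -/
structure IsPolyLoop (π : ℝ → ℂ) : Prop where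
  continuous : Continuous π
  periodic : Periodic π 1
  inj : LoopInj π
  tails : ∀ t, ∃ v w ε, v.im ≠ 0 ∧ w.im ≠ 0 ∧ Tails π t v w ε

namespace Tails
variable {π : ℝ → ℂ} {t : ℝ} {v w : ℂ} {ε : ℝ}

theorem mono (h : Tails π t v w ε) {δ : ℝ} (h0 : 0 < δ) (hδ : δ ≤ ε) : Tails π t v w δ :=
  ⟨h0, fun s hs => h.right s ⟨hs.1, hs.2.trans hδ⟩, fun s hs => h.left s ⟨hs.1, hs.2.trans hδ⟩⟩

theorem eq_right (h : Tails π t v w ε) {s : ℝ} (h1 : t ≤ s) (h2 : s ≤ t + ε) :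
    π s = π t + (s - t) • v := by
  rw [← h.right (s - t) ⟨by linarith, by linarith⟩, add_sub_cancel]

theorem eq_left (h : Tails π t v w ε) {s : ℝ} (h1 : s ≤ t) (h2 : t - ε ≤ s) :
    π s = π t + (s - t) • w := by
  have := h.left (t - s) ⟨by linarith, by linarith⟩
  rw [sub_sub_cancel] at this
  rw [this, sub_eq_add_neg, ← neg_smul, neg_sub]

theorem of_eq (hε : 0 < ε) (h1 : ∀ s, t ≤ s → s ≤ t + ε → π s = π t + (s - t) • v)
    (h2 : ∀ s, s ≤ t → t - ε ≤ s → π s = π t + (s - t) • w) : Tails π t v w ε :=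
  ⟨hε, fun s hs => by rw [h1 (t + s) (by linarith [hs.1]) (by linarith [hs.2]), add_sub_cancel_left],
    fun s hs => by
      rw [h2 (t - s) (by linarith [hs.1]) (by linarith [hs.2]), sub_sub_cancel_left, neg_smul,
        sub_eq_add_neg]⟩

theorem congr {π' : ℝ → ℂ} (h : Tails π t v w ε) (he : ∀ s ∈ Icc (t - ε) (t + ε), π' s = π s) :
    Tails π' t v w ε := by
  have ht := he t ⟨by linarith [h.pos], by linarith [h.pos]⟩
  refine ⟨h.pos, fun s hs => ?_, fun s hs => ?_⟩
  · rw [ht, he (t + s) ⟨by linarith [hs.1, h.pos], by linarith [hs.2]⟩, h.right s hs]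
  · rw [ht, he (t - s) ⟨by linarith [hs.2], by linarith [hs.1, h.pos]⟩, h.left s hs]

theorem exists_win (h : Tails π t v w ε) {n : ℂ →L[ℝ] ℝ} (hv : 0 < n v) (hw : 0 < n w) :
    ∃ κ : ℝ, 0 < κ ∧ Win π (κ⁻¹ • n) (t - ε) (t + ε) := by
  have hκ : 0 < min (n v) (n w) := lt_min hv hw
  refine ⟨min (n v) (n w), hκ, Win.concat (b := t) (Win.scale hκ ?_) (Win.scale hκ ?_)⟩
  · intro s s' h1 h2 h3
    rw [h.eq_left h3 (h1.trans h2), h.eq_left (h2.trans h3) h1, add_sub_add_left_eq_sub, ← sub_smul,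
      map_smul, sub_sub_sub_cancel_right, smul_eq_mul, mul_comm]
    exact mul_le_mul_of_nonneg_left (min_le_right _ _) (by linarith)
  · intro s s' h1 h2 h3
    rw [h.eq_right (h1.trans h2) h3, h.eq_right h1 (h2.trans h3), add_sub_add_left_eq_sub,
      ← sub_smul, map_smul, sub_sub_sub_cancel_right, smul_eq_mul, mul_comm]
    exact mul_le_mul_of_nonneg_left (min_le_left _ _) (by linarith)

theorem ne_neg_smul (h : Tails π t v w ε) (hi : LoopInj π) {c : ℝ} (hc : 0 < c) :
    v ≠ -(c • w) := by
  rintro rfl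
  obtain ⟨s, hs, hs'⟩ := exists_between (show 0 < min ε (min (ε / c) (1 / (1 + c))) from
    lt_min h.pos (lt_min (div_pos h.pos hc) (by positivity)))
  simp only [lt_min_iff] at hs'
  rw [lt_div_iff₀ hc, lt_div_iff₀ (by positivity)] at hs'
  have h1 := h.right s ⟨hs.le, hs'.1.le⟩
  have h2 := h.left (s * c) ⟨by positivity, hs'.2.1.le⟩
  have h3 : π (t + s) = π (t - s * c) := by
    rw [h1, h2, smul_neg, smul_smul, sub_eq_add_neg]
  have := hi.eq_of_abs_lt (by
    rw [abs_of_pos] <;> nlinarith) h3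
  nlinarith

theorem reverse (h : Tails π t v w ε) : Tails (fun s => π (-s)) (-t) (-w) (-v) ε := by
  refine ⟨h.pos, fun s hs => ?_, fun s hs => ?_⟩
  · simp only [neg_neg]
    rw [show -(-t + s) = t - s by ring, h.left s hs, smul_neg, sub_eq_add_neg]
  · simp only [neg_neg]
    rw [show -(-t - s) = t + s by ring, h.right s hs, smul_neg, sub_neg_eq_add]

theorem add_int (h : Tails π t v w ε) (hp : Periodic π 1) (k : ℤ) : Tails π (t + k) v w ε := by
  refine ⟨h.pos, fun s hs => ?_, fun s hs => ?_⟩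
  · rw [show t + k + s = t + s + k by ring, hp.add_int, hp.add_int, h.right s hs]
  · rw [show t + k - s = t - s + k by ring, hp.add_int, hp.add_int, h.left s hs]

end Tails

/-- A functional that is positive on two given vectors. -/
theorem exists_functional_pos {v w : ℂ} (hv : v ≠ 0) (hw : w ≠ 0)
    (h : ∀ c : ℝ, 0 < c → v ≠ -(c • w)) : ∃ n : ℂ →L[ℝ] ℝ, 0 < n v ∧ 0 < n w := by
  have hv' := norm_pos_iff.2 hv
  have hw' := norm_pos_iff.2 hw
  have hlt : 0 < ‖v‖ * ‖w‖ + inner ℝ v w := by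
    have h1 := neg_le_of_abs_le (abs_real_inner_le_norm v w)
    rcases h1.eq_or_lt with h1 | h1
    · exfalso
      have h2 : inner ℝ v (-w) = ‖v‖ * ‖-w‖ := by rw [inner_neg_right, norm_neg, ← h1, neg_neg]
      rw [inner_eq_norm_mul_iff_real, norm_neg] at h2
      refine h (‖w‖⁻¹ * ‖v‖) (by positivity) ?_
      rw [mul_smul, ← smul_neg, ← smul_neg, ← h2, smul_smul, inv_mul_cancel₀ hw'.ne', one_smul]
    · linarith
  refine ⟨innerSL ℝ (‖w‖ • v + ‖v‖ • w), ?_, ?_⟩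
  · rw [innerSL_apply_apply, inner_add_left, real_inner_smul_left, real_inner_smul_left,
      real_inner_self_eq_norm_sq, real_inner_comm]
    nlinarith [mul_pos hv' hlt]
  · rw [innerSL_apply_apply, inner_add_left, real_inner_smul_left, real_inner_smul_left,
      real_inner_self_eq_norm_sq]
    nlinarith [mul_pos hw' hlt]

namespace IsPolyLoop
variable {π : ℝ → ℂ}

theorem hasWin (h : IsPolyLoop π) : HasWin π := by
  intro t
  obtain ⟨v, w, ε, hv, hw, ht⟩ := h.tails t
  obtain ⟨n, hn, hn'⟩ := exists_functional_pos (fun h0 => hv (by simp [h0]))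
    (fun h0 => hw (by simp [h0])) fun c hc => ht.ne_neg_smul h.inj hc
  obtain ⟨κ, -, hκ⟩ := ht.exists_win hn hn'
  exact ⟨_, ε, ht.pos, hκ⟩

theorem reverse (h : IsPolyLoop π) : IsPolyLoop (fun t => π (-t)) where
  continuous := h.continuous.comp continuous_neg
  periodic := fun t => by
    simp only [neg_add', h.periodic.sub_eq]
  inj := fun s t hst => by
    obtain ⟨k, hk⟩ := h.inj _ _ hst
    exact ⟨-k, by push_cast; linarith⟩
  tails := fun t => by
    obtain ⟨v, w, ε, hv, hw, ht⟩ := h.tails (-t)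
    refine ⟨-w, -v, ε, by simpa using hw, by simpa using hv, ?_⟩
    simpa using ht.reverse

theorem chord (h : IsPolyLoop π) {a l r : ℝ} (h1 : a ≤ l) (h2 : l < r) (h3 : r ≤ a + 1)
    (h4 : r < l + 1) (him : (π l).im ≠ (π r).im) (hi : LoopInj (chord a π l r)) :
    IsPolyLoop (chord a π l r) := by
  refine ⟨chord.continuous h.continuous h.periodic h1 h2.le h3, chord.periodic, hi, fun t => ?_⟩
  set χ := _root_.chord a π l r with hχ
  have hge : ∀ s, r ≤ s → s ≤ l + 1 → χ s = π s := fun s hs hs' =>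
    chord.eq_of_ge h.periodic h1 h2.le h3 ⟨hs, hs'⟩
  have hle : ∀ s, r - 1 ≤ s → s ≤ l → χ s = π s := fun s hs hs' =>
    chord.eq_of_le h.periodic h1 h2.le h3 ⟨hs, hs'⟩
  set u := (r - l)⁻¹ • (π r - π l) with hu
  have hmid : ∀ s, l ≤ s → s ≤ r → χ s = π l + (s - l) • u := fun s hs hs' => by
    rw [hχ, chord.eq_of_mem h.periodic h1 h2.le h3 ⟨hs, hs'⟩, hu, smul_smul, div_eq_mul_inv]
  have hmid2 : ∀ s s', l ≤ s → s ≤ r → l ≤ s' → s' ≤ r → χ s' = χ s + (s' - s) • u := by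
    intro s s' e1 e2 e3 e4
    rw [hmid s e1 e2, hmid s' e3 e4, add_assoc, ← add_smul]
    congr 2
    ring
  have huim : u.im ≠ 0 := by
    rw [hu, Complex.smul_im, smul_eq_mul]
    refine mul_ne_zero (inv_ne_zero (by linarith)) ?_
    rw [Complex.sub_im, sub_ne_zero]
    exact him.symm
  suffices H : ∀ s ∈ Ico l (l + 1), ∃ v w ε, v.im ≠ 0 ∧ w.im ≠ 0 ∧ Tails χ s v w ε by
    obtain ⟨v, w, ε, hv, hw, ht⟩ := H (t - ⌊t - l⌋)
      ⟨by linarith [Int.floor_le (t - l)], by linarith [Int.lt_floor_add_one (t - l)]⟩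
    exact ⟨v, w, ε, hv, hw, by simpa using ht.add_int chord.periodic ⌊t - l⌋⟩
  rintro s ⟨hs1, hs2⟩
  obtain ⟨v, w, ε, hv, hw, ht⟩ := h.tails s
  rcases hs1.eq_or_lt with rfl | hs1
  · have hδ : 0 < min ε (min (r - l) (l - (r - 1))) :=
      lt_min ht.pos (lt_min (by linarith) (by linarith))
    have hδ' := ht.mono hδ (min_le_left _ _)
    have e1 := min_le_right ε (min (r - l) (l - (r - 1)))
    rw [le_min_iff] at e1
    refine ⟨u, w, _, huim, hw, Tails.of_eq hδ (fun s hs hs' => ?_) fun s hs hs' => ?_⟩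
    · exact hmid2 _ _ le_rfl h2.le hs (by linarith)
    · rw [hle s (by linarith) hs, hle l (by linarith) le_rfl, hδ'.eq_left hs hs']
  rcases lt_trichotomy s r with hsr | rfl | hsr
  · refine ⟨u, u, min (s - l) (r - s), huim, huim, Tails.of_eq (lt_min (by linarith) (by linarith))
      (fun x hx hx' => ?_) fun x hx hx' => ?_⟩
    · exact hmid2 _ _ hs1.le hsr.le (by linarith) (by linarith [min_le_right (s - l) (r - s)])
    · exact hmid2 _ _ hs1.le hsr.le (by linarith [min_le_left (s - l) (r - s)]) (by linarith)
  · have hδ : 0 < min ε (min (s - l) (l + 1 - s)) :=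
      lt_min ht.pos (lt_min (by linarith) (by linarith))
    have hδ' := ht.mono hδ (min_le_left _ _)
    have e1 := min_le_right ε (min (s - l) (l + 1 - s))
    rw [le_min_iff] at e1
    refine ⟨v, u, _, hv, huim, Tails.of_eq hδ (fun x hs hs' => ?_) fun x hs hs' => ?_⟩
    · rw [hge x hs (by linarith), hge s le_rfl (by linarith), hδ'.eq_right hs hs']
    · exact hmid2 _ _ h2.le le_rfl (by linarith) hs
  · have hδ : 0 < min ε (min (s - r) (l + 1 - s)) :=
      lt_min ht.pos (lt_min (by linarith) (by linarith))
    have e1 := min_le_right ε (min (s - r) (l + 1 - s))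
    rw [le_min_iff] at e1
    exact ⟨v, w, _, hv, hw, (ht.mono hδ (min_le_left _ _)).congr fun x hx =>
      hge x (by linarith [hx.1]) (by linarith [hx.2])⟩

end IsPolyLoop

/-- `Good'` is constant along a connected family of chord replacements. -/
theorem good'_chord_iff_of_preconnected {X : Type*} [TopologicalSpace X] {S : Set X}
    (hS : IsPreconnected S) {π : ℝ → ℂ} (hc : Continuous π) (hp : Periodic π 1) (hw : HasWin π)
    {a : ℝ} {l r : X → ℝ} (hl : ContinuousOn l S) (hr : ContinuousOn r S)
    (hbase : ∀ x ∈ S, a < l x ∧ l x ≤ r x ∧ r x < a + 1)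
    (hi : ∀ x ∈ S, LoopInj (chord a π (l x) (r x)))
    (hcl : ∀ x ∈ S, l x < r x →
      ∃ n, ∃ ε > 0, Win π n (l x - ε) (l x + ε) ∧ 0 < n (π (r x) - π (l x)))
    (hcr : ∀ x ∈ S, l x < r x →
      ∃ n, ∃ ε > 0, Win π n (r x - ε) (r x + ε) ∧ 0 < n (π (r x) - π (l x)))
    {x y : X} (hx : x ∈ S) (hy : y ∈ S) :
    Good' (chord a π (l x) (r x)) ↔ Good' (chord a π (l y) (r y)) := by
  refine hS.induction₂' (fun x y => Good' (chord a π (l x) (r x)) ↔ Good' (chord a π (l y) (r y)))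
    (fun x hx => ?_) (fun _ _ _ _ _ _ hab hbc => hab.trans hbc) hx hy
  have := eventually_chord_good'_iff hc hp hw (hbase x hx).1 (hbase x hx).2.1 (hbase x hx).2.2
    (hi x hx) (hcl x hx) (hcr x hx)
  filter_upwards [((hl x hx).prodMk_nhds (hr x hx)).eventually this, self_mem_nhdsWithin]
    with y h hy
  have h2 := (h (hbase y hy).2.1).2
  exact ⟨h2.symm, h2⟩

theorem exists_continuous_inverse {h : ℝ → ℝ} {a b : ℝ} (hab : a ≤ b)
    (hc : ContinuousOn h (Icc a b)) (hm : StrictMonoOn h (Icc a b)) :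
    ∃ l : ℝ → ℝ, Continuous l ∧ ∀ y ∈ Icc (h a) (h b), l y ∈ Icc a b ∧ h (l y) = y := by
  have him : h '' Icc a b = Icc (h a) (h b) := by
    refine subset_antisymm ?_ (intermediate_value_Icc hab hc)
    rintro _ ⟨x, hx, rfl⟩
    exact ⟨hm.monotoneOn ⟨le_rfl, hab⟩ hx hx.1, hm.monotoneOn hx ⟨hab, le_rfl⟩ hx.2⟩
  let e : Icc a b ≃o Icc (h a) (h b) := (hm.orderIso h _).trans (OrderIso.setCongr _ _ him)
  have hle : h a ≤ h b := hm.monotoneOn ⟨le_rfl, hab⟩ ⟨hab, le_rfl⟩ hab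
  refine ⟨fun y => (IccExtend hle e.symm y : Icc a b), ?_, fun y hy => ⟨Subtype.coe_prop _, ?_⟩⟩
  · exact continuous_subtype_val.comp e.symm.continuous.Icc_extend'
  · simp only [IccExtend_of_mem hle _ hy]
    have : (e (e.symm ⟨y, hy⟩) : ℝ) = y := by rw [e.apply_symm_apply]
    exact this

/-- The local maxima of the height function of a closed path, up to periods. -/
def peaks (π : ℝ → ℂ) : Set (AddCircle (1 : ℝ)) :=
  (fun t : ℝ => (t : AddCircle (1 : ℝ))) '' {t | IsLocalMax (fun s => (π s).im) t}

theorem Tails.im_right {π : ℝ → ℂ} {t : ℝ} {v w : ℂ} {ε : ℝ} (h : Tails π t v w ε) {s : ℝ}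
    (h1 : t ≤ s) (h2 : s ≤ t + ε) : (π s).im = (π t).im + (s - t) * v.im := by
  rw [h.eq_right h1 h2]
  simp

theorem Tails.im_left {π : ℝ → ℂ} {t : ℝ} {v w : ℂ} {ε : ℝ} (h : Tails π t v w ε) {s : ℝ}
    (h1 : s ≤ t) (h2 : t - ε ≤ s) : (π s).im = (π t).im + (s - t) * w.im := by
  rw [h.eq_left h1 h2]
  simp

theorem not_isLocalMax_of_right {h : ℝ → ℝ} {t ε : ℝ} (hε : 0 < ε)
    (H : ∀ s, t < s → s < t + ε → h t < h s) : ¬ IsLocalMax h t := by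
  intro hm
  have h1 : ∀ᶠ s in 𝓝[>] t, h s ≤ h t := hm.filter_mono nhdsWithin_le_nhds
  have h2 : ∀ᶠ s in 𝓝[>] t, s ∈ Ioo t (t + ε) := Ioo_mem_nhdsGT (by linarith)
  obtain ⟨s, hs, hs'⟩ := (h1.and h2).exists
  exact absurd hs (not_le.2 (H s hs'.1 hs'.2))

theorem not_isLocalMax_of_left {h : ℝ → ℝ} {t ε : ℝ} (hε : 0 < ε)
    (H : ∀ s, t - ε < s → s < t → h t < h s) : ¬ IsLocalMax h t := by
  intro hm
  have h1 : ∀ᶠ s in 𝓝[<] t, h s ≤ h t := hm.filter_mono nhdsWithin_le_nhds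
  have h2 : ∀ᶠ s in 𝓝[<] t, s ∈ Ioo (t - ε) t := Ioo_mem_nhdsLT (by linarith)
  obtain ⟨s, hs, hs'⟩ := (h1.and h2).exists
  exact absurd hs (not_le.2 (H s hs'.1 hs'.2))

theorem Tails.im_pos_of_isLocalMax {π : ℝ → ℂ} {t : ℝ} {v w : ℂ} {ε : ℝ} (h : Tails π t v w ε)
    (hw : w.im ≠ 0) (hm : IsLocalMax (fun s => (π s).im) t) : 0 < w.im := by
  refine hw.symm.lt_of_le
    (not_lt.1 fun hv => not_isLocalMax_of_left h.pos (fun s h1 h2 => ?_) hm)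
  rw [h.im_left h2.le h1.le]
  nlinarith

theorem isLocalMax_add_int {h : ℝ → ℝ} (hp : Periodic h 1) {t : ℝ} (ht : IsLocalMax h t) (k : ℤ) :
    IsLocalMax h (t + k) := by
  have hc : Tendsto (fun s : ℝ => s - k) (𝓝 (t + k)) (𝓝 t) := by
    have : Continuous fun s : ℝ => s - k := by fun_prop
    simpa using this.tendsto (t + k)
  filter_upwards [hc.eventually ht] with s hs
  rw [hp.add_int]
  rwa [← hp.add_int (s - k) k, sub_add_cancel] at hs

theorem isLocalMax_comp_neg {h : ℝ → ℝ} {t : ℝ} (ht : IsLocalMax h t) :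
    IsLocalMax (fun s => h (-s)) (-t) := by
  have : Tendsto (fun s : ℝ => -s) (𝓝 (-t)) (𝓝 t) := by
    simpa using (continuous_neg (G := ℝ)).tendsto (-t)
  filter_upwards [this.eventually ht] with s hs
  simpa using hs

namespace IsPolyLoop
variable {π : ℝ → ℂ}

theorem continuous_im (h : IsPolyLoop π) : Continuous fun t => (π t).im :=
  Complex.continuous_im.comp h.continuous

theorem periodic_im (h : IsPolyLoop π) : Periodic (fun t => (π t).im) 1 := fun t => by
  simp only [h.periodic t]

theorem finite_isLocalMax (h : IsPolyLoop π) :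
    (Icc (0 : ℝ) 1 ∩ {t | IsLocalMax (fun s => (π s).im) t}).Finite := by
  refine isCompact_Icc.induction_on
    (p := fun S => (S ∩ {t | IsLocalMax (fun s => (π s).im) t}).Finite) (by simp)
    (fun S T hST hT => hT.subset (inter_subset_inter_left _ hST))
    (fun S T hS hT => by rw [union_inter_distrib_right]; exact hS.union hT) fun t _ => ?_
  obtain ⟨v, w, ε, hv, hw, ht⟩ := h.tails t
  refine ⟨Ioo (t - ε) (t + ε),
    mem_nhdsWithin_of_mem_nhds (Ioo_mem_nhds (by linarith [ht.pos]) (by linarith [ht.pos])),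
    (finite_singleton t).subset ?_⟩
  rintro s ⟨⟨h1, h2⟩, hs⟩
  by_contra hne
  rcases lt_or_gt_of_ne hne with hlt | hlt
  · have key : ∀ x, t - ε < x → x < t → (π x).im = (π t).im + (x - t) * w.im :=
      fun x hx hx' => ht.im_left hx'.le hx.le
    rcases lt_or_gt_of_ne hw with hw | hw
    · refine not_isLocalMax_of_left (ε := s - (t - ε)) (by linarith) (fun x hx hx' => ?_) hs
      rw [key x (by linarith) (by linarith), key s (by linarith) (by linarith)]
      nlinarith
    · refine not_isLocalMax_of_right (ε := t - s) (by linarith) (fun x hx hx' => ?_) hs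
      rw [key x (by linarith) (by linarith), key s (by linarith) (by linarith)]
      nlinarith
  · have key : ∀ x, t < x → x < t + ε → (π x).im = (π t).im + (x - t) * v.im :=
      fun x hx hx' => ht.im_right hx.le hx'.le
    rcases lt_or_gt_of_ne hv with hw | hw
    · refine not_isLocalMax_of_left (ε := s - t) (by linarith) (fun x hx hx' => ?_) hs
      rw [key x (by linarith) (by linarith), key s (by linarith) (by linarith)]
      nlinarith
    · refine not_isLocalMax_of_right (ε := t + ε - s) (by linarith) (fun x hx hx' => ?_) hs
      rw [key x (by linarith) (by linarith), key s (by linarith) (by linarith)]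
      nlinarith

theorem isLocalMax_fract (h : IsPolyLoop π) {t : ℝ} (ht : IsLocalMax (fun s => (π s).im) t) :
    Int.fract t ∈ Icc (0 : ℝ) 1 ∩ {t | IsLocalMax (fun s => (π s).im) t} := by
  refine ⟨⟨Int.fract_nonneg t, (Int.fract_lt_one t).le⟩, ?_⟩
  have := isLocalMax_add_int h.periodic_im ht (-⌊t⌋)
  rwa [Int.cast_neg, ← sub_eq_add_neg] at this

theorem finite_peaks (h : IsPolyLoop π) : (peaks π).Finite := by
  refine (h.finite_isLocalMax.image fun t : ℝ => (t : AddCircle (1 : ℝ))).subset ?_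
  rintro _ ⟨t, ht, rfl⟩
  refine ⟨_, h.isLocalMax_fract ht, QuotientAddGroup.eq.2 ⟨⌊t⌋, ?_⟩⟩
  rw [← sub_eq_neg_add, Int.self_sub_fract]
  simp

theorem exists_lowest_isLocalMax (h : IsPolyLoop π) : ∃ ζ,
    IsLocalMax (fun s => (π s).im) ζ ∧
      ∀ t, IsLocalMax (fun s => (π s).im) t → (π ζ).im ≤ (π t).im := by
  have hfr : ∀ t, (π (Int.fract t)).im = (π t).im := fun t => by
    have := h.periodic_im.add_int (Int.fract t) ⌊t⌋
    simpa using this.symm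
  obtain ⟨x, hx, hmax⟩ := isCompact_Icc.exists_isMaxOn (nonempty_Icc.2 (zero_le_one (α := ℝ)))
    h.continuous_im.continuousOn
  have hx' : IsLocalMax (fun s => (π s).im) x := Eventually.of_forall fun t => by
    simp only
    rw [← hfr t]
    exact hmax ⟨Int.fract_nonneg t, (Int.fract_lt_one t).le⟩
  obtain ⟨ζ, hζ, hmin⟩ := Set.exists_min_image _ (fun t => (π t).im) h.finite_isLocalMax ⟨x, hx, hx'⟩
  exact ⟨ζ, hζ.2, fun t ht => (hmin _ (h.isLocalMax_fract ht)).trans_eq (hfr t)⟩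

theorem exists_left_valley (h : IsPolyLoop π) {ζ : ℝ} (hζ : IsLocalMax (fun s => (π s).im) ζ) :
    ∃ α, α < ζ ∧ ζ - 1 < α ∧ StrictMonoOn (fun s => (π s).im) (Icc α ζ) ∧
      ∃ v w ε, 0 < v.im ∧ w.im < 0 ∧ Tails π α v w ε := by
  set g := fun s => (π s).im with hg
  set A := {t | t ≤ ζ ∧ StrictMonoOn g (Icc t ζ)} with hA
  obtain ⟨v, w, ε, hv, hw, hT⟩ := h.tails ζ
  have hw := hT.im_pos_of_isLocalMax hw hζ
  have hεA : ζ - ε ∈ A := by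
    refine ⟨by linarith [hT.pos], fun x hx y hy hxy => ?_⟩
    simp only [hg]
    rw [hT.im_left hx.2 hx.1, hT.im_left hy.2 hy.1]
    nlinarith
  have hbdd : ∀ t ∈ A, ζ - 1 ≤ t := fun t ht => by
    by_contra! hlt
    have := ht.2 ⟨hlt.le, by linarith⟩ ⟨ht.1, le_rfl⟩ (show ζ - 1 < ζ by linarith)
    simp only [hg] at this
    rw [h.periodic.sub_eq] at this
    exact lt_irrefl _ this
  have hα1 : sInf A ≤ ζ - ε := csInf_le ⟨ζ - 1, hbdd⟩ hεA
  have hα2 : ζ - 1 ≤ sInf A := le_csInf ⟨_, hεA⟩ hbdd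
  set α := sInf A with hαdef
  have hlt : α < ζ := by linarith [hT.pos]
  have hmono' : StrictMonoOn g (Ioc α ζ) := by
    intro x hx y hy hxy
    obtain ⟨t, ht, htx⟩ := exists_lt_of_csInf_lt ⟨_, hεA⟩ hx.1
    exact ht.2 ⟨htx.le, hx.2⟩ ⟨(htx.trans hxy).le, hy.2⟩ hxy
  have hmono : StrictMonoOn g (Icc α ζ) := by
    have hle : ∀ z ∈ Ioc α ζ, g α ≤ g z := by
      intro z hz
      refine le_of_tendsto (h.continuous_im.continuousWithinAt (s := Ioi α) (x := α)) ?_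
      filter_upwards [Ioo_mem_nhdsGT hz.1] with x hx
      exact (hmono' ⟨hx.1, hx.2.le.trans hz.2⟩ hz hx.2).le
    intro x hx y hy hxy
    rcases hx.1.eq_or_lt with rfl | hx1
    · have h1 := hle ((α + y) / 2) ⟨by linarith, by linarith [hy.2]⟩
      exact h1.trans_lt (hmono' ⟨by linarith, by linarith [hy.2]⟩ ⟨hxy, hy.2⟩ (by linarith))
    · exact hmono' ⟨hx1, hx.2⟩ ⟨hx1.trans hxy, hy.2⟩ hxy
  refine ⟨α, hlt, hα2.lt_of_ne fun he => ?_, hmono, ?_⟩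
  · have := hmono ⟨le_rfl, hlt.le⟩ ⟨hlt.le, le_rfl⟩ hlt
    simp only [hg] at this
    rw [← he, h.periodic.sub_eq] at this
    exact lt_irrefl _ this
  obtain ⟨v, w, ε, hv, hw, hT⟩ := h.tails α
  have hε := hT.pos
  refine ⟨v, w, ε, ?_, ?_, hT⟩
  · have hm : 0 < min ε (ζ - α) := lt_min hT.pos (by linarith)
    have h1 : g (α + min ε (ζ - α)) = g α + (α + min ε (ζ - α) - α) * v.im :=
      hT.im_right (by linarith) (by linarith [min_le_left ε (ζ - α)])
    have h2 := hmono ⟨le_rfl, hlt.le⟩ ⟨by linarith, by linarith [min_le_right ε (ζ - α)]⟩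
      (show α < α + min ε (ζ - α) by linarith)
    rw [h1, add_sub_cancel_left] at h2
    exact pos_of_mul_pos_right (by linarith) hm.le
  · refine hw.lt_of_le (not_lt.1 fun hw => ?_)
    have : α - ε ∈ A := by
      refine ⟨by linarith, fun x hx y hy hxy => ?_⟩
      have key : ∀ z, α - ε ≤ z → z ≤ α → g z = g α + (z - α) * w.im :=
        fun z h1 h2 => hT.im_left h2 h1
      rcases le_total y α with hy' | hy'
      · rw [key x hx.1 (by linarith), key y hy.1 hy']
        nlinarith
      · rcases le_total α x with hx' | hx'
        · exact hmono ⟨hx', hx.2⟩ ⟨hy', hy.2⟩ hxy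
        · have h2 := hmono.monotoneOn ⟨le_rfl, hlt.le⟩ ⟨hy', hy.2⟩ hy'
          rw [key x hx.1 hx']
          rcases hx'.eq_or_lt with rfl | hx'
          · simpa using hmono ⟨le_rfl, hlt.le⟩ ⟨hy', hy.2⟩ hxy
          · nlinarith
    linarith [csInf_le ⟨ζ - 1, hbdd⟩ this]

theorem exists_right_valley (h : IsPolyLoop π) {ζ : ℝ} (hζ : IsLocalMax (fun s => (π s).im) ζ) :
    ∃ β, ζ < β ∧ β < ζ + 1 ∧ StrictAntiOn (fun s => (π s).im) (Icc ζ β) ∧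
      ∃ v w ε, 0 < v.im ∧ w.im < 0 ∧ Tails π β v w ε := by
  obtain ⟨α, h1, h2, h3, v, w, ε, hv, hw, hT⟩ :=
    h.reverse.exists_left_valley (isLocalMax_comp_neg hζ)
  refine ⟨-α, by linarith, by linarith, fun x hx y hy hxy => ?_, -w, -v, ε, by simpa using hw,
    by simpa using hv, by simpa using hT.reverse⟩
  have := h3 (a := -y) ⟨by linarith [hy.2], by linarith [hy.1]⟩ (b := -x)
    ⟨by linarith [hx.2], by linarith [hx.1]⟩ (by linarith)
  simpa using this

end IsPolyLoop

/-- The two monotone legs `[α, ζ]` and `[ζ, β]` around a lowest local maximum `ζ`. -/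
structure Hill (π : ℝ → ℂ) (α ζ β : ℝ) : Prop where
  poly : IsPolyLoop π
  left_lt : α < ζ
  lt_right : ζ < β
  le_add_one : β ≤ α + 1
  mono : StrictMonoOn (fun s => (π s).im) (Icc α ζ)
  anti : StrictAntiOn (fun s => (π s).im) (Icc ζ β)
  tails_left : ∃ v w ε, 0 < v.im ∧ w.im < 0 ∧ Tails π α v w ε
  tails_right : ∃ v w ε, 0 < v.im ∧ w.im < 0 ∧ Tails π β v w ε
  isLocalMax : IsLocalMax (fun s => (π s).im) ζ
  lowest : ∀ t, IsLocalMax (fun s => (π s).im) t → (π ζ).im ≤ (π t).im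

theorem IsPolyLoop.exists_hill {π : ℝ → ℂ} (h : IsPolyLoop π) : ∃ α ζ β, Hill π α ζ β := by
  obtain ⟨ζ, hζ, hlow⟩ := h.exists_lowest_isLocalMax
  obtain ⟨α, ha1, ha2, ha3, hα⟩ := h.exists_left_valley hζ
  obtain ⟨β, hb1, hb2, hb3, hβ⟩ := h.exists_right_valley hζ
  refine ⟨α, ζ, β, h, ha1, hb1, ?_, ha3, hb3, hα, hβ, hζ, hlow⟩
  by_contra! hlt
  obtain ⟨v, w, ε, hv, -, hT⟩ := hα
  have hT := hT.add_int h.periodic 1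
  rw [Int.cast_one] at hT
  have hε : 0 < min ε (β - (α + 1)) := lt_min hT.pos (by linarith)
  have h1 := hT.im_right (s := α + 1 + min ε (β - (α + 1))) (by linarith)
    (by linarith [min_le_left ε (β - (α + 1))])
  have h2 := hb3 (a := α + 1) ⟨by linarith, by linarith⟩ (b := α + 1 + min ε (β - (α + 1)))
    ⟨by linarith, by linarith [min_le_right ε (β - (α + 1))]⟩ (by linarith)
  simp only [h1, add_sub_cancel_left] at h2
  nlinarith

namespace Hill
variable {π : ℝ → ℂ} {α ζ β : ℝ}

theorem reverse (h : Hill π α ζ β) : Hill (fun t => π (-t)) (-β) (-ζ) (-α) where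
  poly := h.poly.reverse
  left_lt := by linarith [h.lt_right]
  lt_right := by linarith [h.left_lt]
  le_add_one := by linarith [h.le_add_one]
  mono := fun x hx y hy hxy => h.anti (a := -y) ⟨by linarith [hy.2], by linarith [hy.1]⟩ (b := -x)
    ⟨by linarith [hx.2], by linarith [hx.1]⟩ (by linarith)
  anti := fun x hx y hy hxy => h.mono (a := -y) ⟨by linarith [hy.2], by linarith [hy.1]⟩ (b := -x)
    ⟨by linarith [hx.2], by linarith [hx.1]⟩ (by linarith)
  tails_left := by
    obtain ⟨v, w, ε, hv, hw, hT⟩ := h.tails_right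
    exact ⟨-w, -v, ε, by simpa using hw, by simpa using hv, hT.reverse⟩
  tails_right := by
    obtain ⟨v, w, ε, hv, hw, hT⟩ := h.tails_left
    exact ⟨-w, -v, ε, by simpa using hw, by simpa using hv, hT.reverse⟩
  isLocalMax := isLocalMax_comp_neg h.isLocalMax
  lowest := fun t ht => by
    rw [neg_neg]
    exact h.lowest _ (by simpa using isLocalMax_comp_neg ht)

end Hill

/-- Data for cutting off the top of a hill by horizontal chords from `l y` to `r y`, down to the
height `y₁`. The functional `p` is a horizontal coordinate. -/
structure Descent (π : ℝ → ℂ) (α ζ β y₁ : ℝ) (l r : ℝ → ℝ) (p : ℂ →L[ℝ] ℝ) : Prop extends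
    Hill π α ζ β where
  lt : y₁ < (π ζ).im
  continuous_l : Continuous l
  continuous_r : Continuous r
  l_mem : ∀ y ∈ Icc y₁ (π ζ).im, l y ∈ Icc α ζ
  r_mem : ∀ y ∈ Icc y₁ (π ζ).im, r y ∈ Icc ζ β
  im_l : ∀ y ∈ Icc y₁ (π ζ).im, (π (l y)).im = y
  im_r : ∀ y ∈ Icc y₁ (π ζ).im, (π (r y)).im = y
  base_lt : r y₁ < l y₁ + 1
  eq_zero : ∀ z, p z = 0 → z.im = 0 → z = 0
  p_lt : ∀ y ∈ Ico y₁ (π ζ).im, p (π (l y)) < p (π (r y))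

theorem Hill.exists_descent {π : ℝ → ℂ} {α ζ β y₁ : ℝ} (h : Hill π α ζ β) (hα : (π α).im ≤ y₁)
    (hβ : (π β).im ≤ y₁) (hy : y₁ < (π ζ).im) (hb : (π α).im < y₁ ∨ β < α + 1) :
    ∃ l r p, Descent π α ζ β y₁ l r p := by
  obtain ⟨l, hlc, hl⟩ := exists_continuous_inverse h.left_lt.le h.poly.continuous_im.continuousOn
    h.mono
  obtain ⟨r, hrc, hr⟩ := exists_continuous_inverse h.lt_right.le
    h.poly.continuous_im.neg.continuousOn (fun x hx y hy hxy => neg_lt_neg (h.anti hx hy hxy))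
  have hl' : ∀ y ∈ Icc y₁ (π ζ).im, l y ∈ Icc α ζ ∧ (π (l y)).im = y :=
    fun y hy => hl y ⟨hα.trans hy.1, hy.2⟩
  have hr' : ∀ y ∈ Icc y₁ (π ζ).im, r (-y) ∈ Icc ζ β ∧ (π (r (-y))).im = y := fun y hy => by
    have := hr (-y) ⟨neg_le_neg hy.2, neg_le_neg (hβ.trans hy.1)⟩
    exact ⟨this.1, neg_injective this.2⟩
  have hbase : r (-y₁) < l y₁ + 1 := by
    have h1 := hl' y₁ ⟨le_rfl, hy.le⟩
    have h2 := hr' y₁ ⟨le_rfl, hy.le⟩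
    rcases hb with hb | hb
    · have : α ≠ l y₁ := by
        intro he
        rw [he] at hb
        linarith [h1.2]
      linarith [lt_of_le_of_ne h1.1.1 this, h2.1.2, h.le_add_one]
    · linarith [h1.1.1, h2.1.2]
  have hrc' : Continuous fun y => r (-y) := hrc.comp continuous_neg
  set D := fun y => (π (r (-y))).re - (π (l y)).re with hD
  have hDc : Continuous D := by
    have := h.poly.continuous
    fun_prop
  have hmono : ∀ y ∈ Icc y₁ (π ζ).im, l y₁ ≤ l y ∧ r (-y) ≤ r (-y₁) := fun y hyy => by
    have h1 := hl' y₁ ⟨le_rfl, hy.le⟩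
    have h2 := hr' y₁ ⟨le_rfl, hy.le⟩
    constructor
    · refine (h.mono.le_iff_le h1.1 (hl' y hyy).1).1 ?_
      rw [h1.2, (hl' y hyy).2]
      exact hyy.1
    · refine (h.anti.le_iff_ge h2.1 (hr' y hyy).1).1 ?_
      rw [h2.2, (hr' y hyy).2]
      exact hyy.1
  have hD0 : ∀ y ∈ Ico y₁ (π ζ).im, D y ≠ 0 := by
    intro y hyy h0
    have hyy' := Ico_subset_Icc_self hyy
    have he : π (r (-y)) = π (l y) := Complex.ext (sub_eq_zero.1 h0)
      ((hr' y hyy').2.trans (hl' y hyy').2.symm)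
    have h1 := h.poly.inj.eq_of_abs_lt (by
      rw [abs_lt]
      constructor <;> linarith [(hmono y hyy').1, (hmono y hyy').2, (hl' y hyy').1.2,
        (hr' y hyy').1.1]) he
    have h2 : l y = ζ := le_antisymm (hl' y hyy').1.2 (h1 ▸ (hr' y hyy').1.1)
    have := (hl' y hyy').2
    rw [h2] at this
    linarith [hyy.2]
  have hDs : (∀ y ∈ Ico y₁ (π ζ).im, 0 < D y) ∨ ∀ y ∈ Ico y₁ (π ζ).im, D y < 0 := by
    have hpre := (isPreconnected_Ico (a := y₁) (b := (π ζ).im)).image D hDc.continuousOn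
    by_contra! hcon
    obtain ⟨⟨x, hx, hx'⟩, y, hy, hy'⟩ := hcon
    obtain ⟨z, hz, hz'⟩ := hpre.ordConnected.out ⟨x, hx, rfl⟩ ⟨y, hy, rfl⟩ ⟨hx', hy'⟩
    exact hD0 z hz hz'
  rcases hDs with hDs | hDs
  · refine ⟨l, fun y => r (-y), Complex.reCLM, h, hy, hlc, hrc', fun y hy => (hl' y hy).1,
      fun y hy => (hr' y hy).1, fun y hy => (hl' y hy).2, fun y hy => (hr' y hy).2, hbase,
      fun z h1 h2 => Complex.ext h1 h2, fun y hy => sub_pos.1 (hDs y hy)⟩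
  · refine ⟨l, fun y => r (-y), -Complex.reCLM, h, hy, hlc, hrc', fun y hy => (hl' y hy).1,
      fun y hy => (hr' y hy).1, fun y hy => (hl' y hy).2, fun y hy => (hr' y hy).2, hbase,
      fun z h1 h2 => Complex.ext (by simpa using h1) h2,
      fun y hy => by simpa using sub_neg.1 (hDs y hy)⟩

namespace Descent
variable {π : ℝ → ℂ} {α ζ β y₁ : ℝ} {l r : ℝ → ℝ} {p : ℂ →L[ℝ] ℝ}

theorem l_im (h : Descent π α ζ β y₁ l r p) {t : ℝ} (ht : t ∈ Icc α ζ) (hy : y₁ ≤ (π t).im) :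
    l (π t).im = t := by
  have hm : (π t).im ∈ Icc y₁ (π ζ).im :=
    ⟨hy, h.mono.monotoneOn ht ⟨h.left_lt.le, le_rfl⟩ ht.2⟩
  exact h.mono.injOn (h.l_mem _ hm) ht (h.im_l _ hm)

theorem r_im (h : Descent π α ζ β y₁ l r p) {t : ℝ} (ht : t ∈ Icc ζ β) (hy : y₁ ≤ (π t).im) :
    r (π t).im = t := by
  have hm : (π t).im ∈ Icc y₁ (π ζ).im :=
    ⟨hy, h.anti.antitoneOn ⟨le_rfl, h.lt_right.le⟩ ht ht.1⟩
  exact h.anti.injOn (h.r_mem _ hm) ht (h.im_r _ hm)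

theorem l_le (h : Descent π α ζ β y₁ l r p) {y : ℝ} (hy : y ∈ Icc y₁ (π ζ).im) : l y₁ ≤ l y := by
  have hm : y₁ ∈ Icc y₁ (π ζ).im := ⟨le_rfl, h.lt.le⟩
  refine (h.mono.le_iff_le (h.l_mem _ hm) (h.l_mem _ hy)).1 ?_
  simp only [h.im_l _ hm, h.im_l _ hy, hy.1]

theorem le_r (h : Descent π α ζ β y₁ l r p) {y : ℝ} (hy : y ∈ Icc y₁ (π ζ).im) : r y ≤ r y₁ := by
  have hm : y₁ ∈ Icc y₁ (π ζ).im := ⟨le_rfl, h.lt.le⟩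
  refine (h.anti.le_iff_ge (h.r_mem _ hm) (h.r_mem _ hy)).1 ?_
  simp only [h.im_r _ hm, h.im_r _ hy, hy.1]

theorem l_lt (h : Descent π α ζ β y₁ l r p) {y : ℝ} (hy : y ∈ Ico y₁ (π ζ).im) : l y < ζ := by
  refine (h.l_mem _ (Ico_subset_Icc_self hy)).2.lt_of_ne fun he => ?_
  have := h.im_l _ (Ico_subset_Icc_self hy)
  rw [he] at this
  linarith [hy.2]

theorem lt_r (h : Descent π α ζ β y₁ l r p) {y : ℝ} (hy : y ∈ Ico y₁ (π ζ).im) : ζ < r y := by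
  refine (h.r_mem _ (Ico_subset_Icc_self hy)).1.lt_of_ne fun he => ?_
  have := h.im_r _ (Ico_subset_Icc_self hy)
  rw [← he] at this
  linarith [hy.2]

theorem l_apex (h : Descent π α ζ β y₁ l r p) : l (π ζ).im = ζ :=
  h.l_im ⟨h.left_lt.le, le_rfl⟩ h.lt.le

theorem r_apex (h : Descent π α ζ β y₁ l r p) : r (π ζ).im = ζ :=
  h.r_im ⟨le_rfl, h.lt_right.le⟩ h.lt.le

theorem eq_of_p_eq (h : Descent π α ζ β y₁ l r p) {s t : ℝ} (hst : |s - t| < 1)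
    (hp : p (π s) = p (π t)) (him : (π s).im = (π t).im) : s = t := by
  refine h.poly.inj.eq_of_abs_lt hst (sub_eq_zero.1 (h.eq_zero _ ?_ ?_))
  · rw [map_sub, hp, sub_self]
  · rw [Complex.sub_im, him, sub_self]

/-- The rest of the path does not enter the region swept out by the horizontal chords, because
`ζ` is a lowest local maximum. -/
theorem not_between (h : Descent π α ζ β y₁ l r p) {t : ℝ} (ht : t ∈ Ioo (r y₁) (l y₁ + 1))
    (h1 : y₁ ≤ (π t).im) (h2 : (π t).im ≤ (π ζ).im) (h3 : p (π (l (π t).im)) ≤ p (π t))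
    (h4 : p (π t) ≤ p (π (r (π t).im))) : False := by
  have hcl := h.continuous_l
  have hcr := h.continuous_r
  have hc := h.poly.continuous
  have hci := h.poly.continuous_im
  have hcp := p.continuous
  have hm : y₁ ∈ Ico y₁ (π ζ).im := ⟨le_rfl, h.lt⟩
  have hm' := Ico_subset_Icc_self hm
  set X := {t ∈ Icc (r y₁) (l y₁ + 1) | (y₁ ≤ (π t).im ∧ (π t).im ≤ (π ζ).im) ∧
    p (π (l (π t).im)) ≤ p (π t) ∧ p (π t) ≤ p (π (r (π t).im))} with hX
  have hXc : IsCompact X := by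
    have c1 : Continuous fun t => p (π t) := by fun_prop
    have c2 : Continuous fun t => p (π (l (π t).im)) := by fun_prop
    have c3 : Continuous fun t => p (π (r (π t).im)) := by fun_prop
    exact isCompact_Icc.inter_right (((isClosed_le continuous_const hci).inter
      (isClosed_le hci continuous_const)).inter ((isClosed_le c2 c1).inter (isClosed_le c1 c3)))
  have htX : t ∈ X := ⟨Ioo_subset_Icc_self ht, ⟨h1, h2⟩, h3, h4⟩
  obtain ⟨s, hs, hsX, hsmax⟩ : ∃ s ∈ Ioo (r y₁) (l y₁ + 1), s ∈ X ∧
      ∀ x ∈ X, (π x).im ≤ (π s).im := by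
    obtain ⟨s, hsX, hs⟩ := hXc.exists_isMaxOn ⟨t, htX⟩ hci.continuousOn
    rcases hsX.2.1.1.eq_or_lt with he | hlt
    · refine ⟨t, ht, htX, fun x hx => (hs hx).trans (Eq.trans_le ?_ h1)⟩
      exact he.symm
    · refine ⟨s, ⟨hsX.1.1.lt_of_ne fun he => ?_, hsX.1.2.lt_of_ne fun he => ?_⟩, hsX, hs⟩
      · rw [← he, h.im_r _ hm'] at hlt
        exact lt_irrefl _ hlt
      · have := h.poly.periodic (l y₁)
        rw [he, this, h.im_l _ hm'] at hlt
        exact lt_irrefl _ hlt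
  obtain ⟨-, ⟨hs1, hs2⟩, hs3, hs4⟩ := hsX
  have hsm : (π s).im ∈ Icc y₁ (π ζ).im := ⟨hs1, hs2⟩
  have hl1 := h.l_mem _ hsm
  have hr1 := h.r_mem _ hsm
  have hl2 := h.l_le hsm
  have hr2 := h.le_r hsm
  have hl3 : p (π (l (π s).im)) < p (π s) := hs3.lt_of_ne fun he => by
    have := h.eq_of_p_eq (by rw [abs_lt]; constructor <;> linarith [hs.1, hs.2, hl1.2, hr1.1]) he
      (h.im_l _ hsm)
    linarith [hs.1, hl1.2, hr1.1]
  have hr3 : p (π s) < p (π (r (π s).im)) := hs4.lt_of_ne fun he => by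
    have := h.eq_of_p_eq (by rw [abs_lt]; constructor <;> linarith [hs.1, hs.2, hl1.2, hr1.1]) he
      (h.im_r _ hsm).symm
    linarith [hs.1, hl1.2, hr1.1]
  have hs5 : (π s).im < (π ζ).im := hs2.lt_of_ne fun he => by
    rw [he, h.l_apex] at hl3
    rw [he, h.r_apex] at hr3
    exact lt_asymm hl3 hr3
  refine absurd (h.lowest s ?_) (not_le.2 hs5)
  filter_upwards [Ioo_mem_nhds hs.1 hs.2, hci.continuousAt.eventually_lt continuousAt_const hs5,
    ContinuousAt.eventually_lt (f := fun x => p (π (l (π x).im))) (g := fun x => p (π x))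
      (Continuous.continuousAt (by fun_prop)) (Continuous.continuousAt (by fun_prop)) hl3,
    ContinuousAt.eventually_lt (f := fun x => p (π x)) (g := fun x => p (π (r (π x).im)))
      (Continuous.continuousAt (by fun_prop)) (Continuous.continuousAt (by fun_prop)) hr3]
    with x hx1 hx2 hx3 hx4
  rcases le_total y₁ (π x).im with hx | hx
  · exact hsmax x ⟨Ioo_subset_Icc_self hx1, ⟨hx, hx2.le⟩, hx3.le, hx4.le⟩
  · exact hx.trans hs1

theorem loopInj (h : Descent π α ζ β y₁ l r p) {a y : ℝ} (hy : y ∈ Icc y₁ (π ζ).im)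
    (h1 : a ≤ l y) (h3 : r y ≤ a + 1) : LoopInj (chord a π (l y) (r y)) := by
  have hl1 := h.l_mem _ hy
  have hr1 := h.r_mem _ hy
  have hl2 := h.l_le hy
  have hr2 := h.le_r hy
  refine chord.loopInj h.poly.periodic h.poly.inj h1 (hl1.2.trans hr1.1) h3
    (by linarith [h.base_lt]) fun hlr t ht θ hθ he => ?_
  have him : (π t).im = y := by
    rw [he, Complex.add_im, Complex.smul_im, Complex.sub_im, h.im_l _ hy, h.im_r _ hy]
    simp
  have hm : y₁ ∈ Icc y₁ (π ζ).im := ⟨le_rfl, h.lt.le⟩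
  rcases le_or_gt t (r y₁) with htr | htr
  · have := h.anti hr1 ⟨hr1.1.trans ht.1.le, htr.trans (h.r_mem _ hm).2⟩ ht.1
    simp only [him, h.im_r _ hy] at this
    exact lt_irrefl _ this
  rcases le_or_gt (l y₁ + 1) t with htl | htl
  · have := h.mono (a := t - 1) ⟨by linarith [(h.l_mem _ hm).1], by linarith [hl1.2, ht.2]⟩ hl1
      (by linarith [ht.2])
    simp only [h.poly.periodic.sub_eq, him, h.im_l _ hy] at this
    exact lt_irrefl _ this
  have hyy : y ∈ Ico y₁ (π ζ).im := ⟨hy.1, hy.2.lt_of_ne fun he => by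
    rw [he, h.l_apex, h.r_apex] at hlr
    exact lt_irrefl _ hlr⟩
  have hlt := h.p_lt _ hyy
  have hp : p (π t) = p (π (l y)) + θ * (p (π (r y)) - p (π (l y))) := by
    rw [he, map_add, map_smul, map_sub, smul_eq_mul]
  refine h.not_between ⟨htr, htl⟩ (him ▸ hy.1) (him ▸ hy.2) ?_ ?_
  · rw [him, hp]
    nlinarith [hθ.1]
  · rw [him, hp]
    nlinarith [hθ.2]

end Descent

theorem exists_shear {a b c d : ℝ} (hb : 0 < b) (hd : 0 < d ∨ d < 0 ∧ 0 < c * b - a * d) :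
    ∃ m : ℝ, 0 < a + m * b ∧ 0 < c + m * d := by
  rcases hd with hd | ⟨hd, h⟩
  · refine ⟨max (-a / b) (-c / d) + 1, ?_, ?_⟩
    · have := (div_le_iff₀ hb).1 (le_max_left (-a / b) (-c / d))
      linarith
    · have := (div_le_iff₀ hd).1 (le_max_right (-a / b) (-c / d))
      linarith
  · have : -a / b < c / -d := by
      rw [div_lt_div_iff₀ hb (by linarith)]
      linarith
    obtain ⟨m, h1, h2⟩ := exists_between this
    rw [div_lt_iff₀ hb] at h1
    rw [lt_div_iff₀ (by linarith)] at h2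
    exact ⟨m, by linarith, by linarith⟩

namespace Tails
variable {π : ℝ → ℂ} {t : ℝ} {v w : ℂ} {ε : ℝ}

theorem exists_win_shear (h : Tails π t v w ε) {p : ℂ →L[ℝ] ℝ} {m : ℝ}
    (hv : 0 < p v + m * v.im) (hw : 0 < p w + m * w.im) {z : ℂ} (hz : 0 < p z) (hz' : z.im = 0) :
    ∃ n, ∃ ε > 0, Win π n (t - ε) (t + ε) ∧ 0 < n z := by
  obtain ⟨κ, hκ, hwin⟩ := h.exists_win (n := p + m • Complex.imCLM) (by simpa using hv)
    (by simpa using hw)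
  refine ⟨_, ε, h.pos, hwin, ?_⟩
  have : 0 < κ⁻¹ * p z := mul_pos (inv_pos.2 hκ) hz
  simpa [hz'] using this

theorem right_im_pos (h : Tails π t v w ε) {b : ℝ} (hb : t < b)
    (H : ∀ s ∈ Ioo t b, (π t).im < (π s).im) : 0 < v.im := by
  obtain ⟨s, h1, h2⟩ := exists_between (lt_min (show t < t + ε by linarith [h.pos]) hb)
  rw [lt_min_iff] at h2
  have := H s ⟨h1, h2.2⟩
  rw [h.im_right h1.le h2.1.le] at this
  nlinarith

theorem right_im_neg (h : Tails π t v w ε) {b : ℝ} (hb : t < b)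
    (H : ∀ s ∈ Ioo t b, (π s).im < (π t).im) : v.im < 0 := by
  obtain ⟨s, h1, h2⟩ := exists_between (lt_min (show t < t + ε by linarith [h.pos]) hb)
  rw [lt_min_iff] at h2
  have := H s ⟨h1, h2.2⟩
  rw [h.im_right h1.le h2.1.le] at this
  nlinarith

theorem left_im_pos (h : Tails π t v w ε) {b : ℝ} (hb : b < t)
    (H : ∀ s ∈ Ioo b t, (π s).im < (π t).im) : 0 < w.im := by
  have := h.reverse.right_im_neg (b := -b) (by linarith) fun s hs => by
    simpa using H (-s) ⟨by linarith [hs.2], by linarith [hs.1]⟩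
  simpa using this

theorem left_im_neg (h : Tails π t v w ε) {b : ℝ} (hb : b < t)
    (H : ∀ s ∈ Ioo b t, (π t).im < (π s).im) : w.im < 0 := by
  have := h.reverse.right_im_pos (b := -b) (by linarith) fun s hs => by
    simpa using H (-s) ⟨by linarith [hs.2], by linarith [hs.1]⟩
  simpa using this

/-- At a local minimum, the two legs are ordered as their points at equal height are. -/
theorem leg_order (h : Tails π t v w ε) {p : ℂ →L[ℝ] ℝ} (hv : 0 < v.im)
    {s s' : ℝ} (hs : s ∈ Icc 0 ε) (hs' : s' ∈ Icc 0 ε) (hs0 : 0 < s)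
    (he : s * -w.im = s' * v.im) (hp : p (π (t - s)) < p (π (t + s'))) :
    0 < p w * v.im - p v * w.im := by
  rw [h.right s' hs', h.left s hs, map_sub, map_add, map_smul, map_smul, smul_eq_mul,
    smul_eq_mul] at hp
  have h1 : 0 < s * (p w * v.im - p v * w.im) := by
    have : 0 < (s' * p v + s * p w) * v.im := mul_pos (by linarith) hv
    linear_combination this - p v * he
  exact pos_of_mul_pos_right h1 hs0.le

end Tails

namespace Descent
variable {π : ℝ → ℂ} {α ζ β y₁ : ℝ} {l r : ℝ → ℝ} {p : ℂ →L[ℝ] ℝ}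

theorem exists_win_left (h : Descent π α ζ β y₁ l r p) {y : ℝ} (hy : y ∈ Ico y₁ (π ζ).im) :
    ∃ n, ∃ ε > 0, Win π n (l y - ε) (l y + ε) ∧ 0 < n (π (r y) - π (l y)) := by
  have hy' := Ico_subset_Icc_self hy
  have hz : 0 < p (π (r y) - π (l y)) := by
    rw [map_sub, sub_pos]
    exact h.p_lt y hy
  have hz' : (π (r y) - π (l y)).im = 0 := by
    rw [Complex.sub_im, h.im_l _ hy', h.im_r _ hy', sub_self]
  have hlm := h.l_mem _ hy'
  rcases hlm.1.eq_or_lt with he | hlt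
  · have hm : y₁ ∈ Icc y₁ (π ζ).im := ⟨le_rfl, h.lt.le⟩
    have hl1 : l y₁ = α := le_antisymm (he ▸ h.l_le hy') (h.l_mem _ hm).1
    have hα : (π α).im = y₁ := hl1 ▸ h.im_l _ hm
    obtain ⟨v, w, ε, hv, hw, hT⟩ := h.tails_left
    suffices H : 0 < p w * v.im - p v * w.im by
      obtain ⟨m, h1, h2⟩ := exists_shear hv (Or.inr ⟨hw, H⟩)
      rw [← he] at hz hz' ⊢
      exact hT.exists_win_shear h1 h2 hz hz'
    set c := v.im / -w.im with hc
    have hc0 : 0 < c := div_pos hv (by linarith)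
    have hcw : c * -w.im = v.im := div_mul_cancel₀ _ (by linarith)
    have hsc : Continuous fun s : ℝ => c * s := by fun_prop
    have hsc0 : Tendsto (fun s : ℝ => c * s) (𝓝[>] 0) (𝓝 0) := by
      simpa using (hsc.tendsto 0).mono_left nhdsWithin_le_nhds
    have hcl := h.continuous_l
    have hcr := h.continuous_r
    have hcπ := h.poly.continuous
    have hcp := p.continuous
    have hbase := h.base_lt
    rw [hl1] at hbase
    have hev : ∀ᶠ s in 𝓝[>] (0 : ℝ), p (π (α - c * s)) < p (π (r (π (α - c * s)).im)) := by
      refine Eventually.filter_mono nhdsWithin_le_nhds (ContinuousAt.eventually_lt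
        (f := fun s => p (π (α - c * s))) (g := fun s => p (π (r (π (α - c * s)).im)))
        (Continuous.continuousAt (by fun_prop)) (Continuous.continuousAt (by fun_prop)) ?_)
      have := h.p_lt y₁ ⟨le_rfl, h.lt⟩
      simpa [hl1, hα] using this
    have e4 : ∀ᶠ s in 𝓝[>] (0 : ℝ), s ∈ Ioo 0 ε := Ioo_mem_nhdsGT hT.pos
    have e5 : ∀ᶠ s in 𝓝[>] (0 : ℝ), s ∈ Ioo 0 (ζ - α) := Ioo_mem_nhdsGT (sub_pos.2 h.left_lt)
    obtain ⟨s, h1, h2, h3, h4, h5⟩ := (hev.and ((hsc0.eventually (gt_mem_nhds hT.pos)).and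
      ((hsc0.eventually (gt_mem_nhds (show 0 < α + 1 - r y₁ by linarith))).and
      (e4.and e5)))).exists
    have hcs : 0 < c * s := mul_pos hc0 h4.1
    refine hT.leg_order (s := c * s) (s' := s) hv ⟨hcs.le, h2.le⟩ ⟨h4.1.le, h4.2.le⟩ hcs
      (by rw [mul_right_comm, hcw, mul_comm]) (not_le.1 fun hcon => ?_)
    have him : (π (α - c * s)).im = (π (α + s)).im := by
      rw [hT.im_left (by linarith) (by linarith), hT.im_right (s := α + s) (by linarith [h4.1]) (by linarith [h4.2])]
      linear_combination s * hcw
    have hlm : (α + s) ∈ Icc α ζ := ⟨by linarith [h4.1], by linarith [h5.2]⟩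
    have hle : y₁ ≤ (π (α + s)).im := by
      rw [← hα]
      exact h.mono.monotoneOn ⟨le_rfl, h.left_lt.le⟩ hlm hlm.1
    refine h.not_between (t := α - c * s + 1) ⟨by linarith, by linarith⟩ ?_ ?_ ?_ ?_ <;>
      rw [h.poly.periodic]
    · rwa [him]
    · rw [him]
      exact h.mono.monotoneOn hlm ⟨h.left_lt.le, le_rfl⟩ hlm.2
    · rwa [him, h.l_im hlm hle]
    · exact h1.le
  · obtain ⟨v, w, ε, -, -, hT⟩ := h.poly.tails (l y)
    have hv := hT.right_im_pos (h.l_lt hy) fun s hs =>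
      h.mono hlm ⟨hlm.1.trans hs.1.le, hs.2.le⟩ hs.1
    have hw := hT.left_im_pos hlt fun s hs =>
      h.mono ⟨hs.1.le, hs.2.le.trans hlm.2⟩ hlm hs.2
    obtain ⟨m, h1, h2⟩ := exists_shear (a := p v) (c := p w) hv (Or.inl hw)
    exact hT.exists_win_shear h1 h2 hz hz'

theorem exists_win_right (h : Descent π α ζ β y₁ l r p) {y : ℝ} (hy : y ∈ Ico y₁ (π ζ).im) :
    ∃ n, ∃ ε > 0, Win π n (r y - ε) (r y + ε) ∧ 0 < n (π (r y) - π (l y)) := by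
  have hy' := Ico_subset_Icc_self hy
  have hz : 0 < p (π (r y) - π (l y)) := by
    rw [map_sub, sub_pos]
    exact h.p_lt y hy
  have hz' : (π (r y) - π (l y)).im = 0 := by
    rw [Complex.sub_im, h.im_l _ hy', h.im_r _ hy', sub_self]
  have hrm := h.r_mem _ hy'
  rcases hrm.2.eq_or_lt with he | hlt
  · have hm : y₁ ∈ Icc y₁ (π ζ).im := ⟨le_rfl, h.lt.le⟩
    have hr1 : r y₁ = β := le_antisymm (h.r_mem _ hm).2 (he ▸ h.le_r hy')
    have hβ : (π β).im = y₁ := hr1 ▸ h.im_r _ hm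
    obtain ⟨v, w, ε, hv, hw, hT⟩ := h.tails_right
    suffices H : 0 < p w * v.im - p v * w.im by
      obtain ⟨m, h1, h2⟩ := exists_shear (a := p w) (b := -w.im) (c := p v) (d := -v.im)
        (by linarith) (Or.inr ⟨by linarith, by linarith⟩)
      rw [he] at hz hz' ⊢
      exact hT.exists_win_shear (m := -m) (by linarith) (by linarith) hz hz'
    set c := v.im / -w.im with hc
    have hc0 : 0 < c := div_pos hv (by linarith)
    have hcw : c * -w.im = v.im := div_mul_cancel₀ _ (by linarith)
    have hsc : Continuous fun s : ℝ => c * s := by fun_prop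
    have hsc0 : Tendsto (fun s : ℝ => c * s) (𝓝[>] 0) (𝓝 0) := by
      simpa using (hsc.tendsto 0).mono_left nhdsWithin_le_nhds
    have hcl := h.continuous_l
    have hcr := h.continuous_r
    have hcπ := h.poly.continuous
    have hcp := p.continuous
    have hbase := h.base_lt
    rw [hr1] at hbase
    have hev : ∀ᶠ s in 𝓝[>] (0 : ℝ), p (π (l (π (β + s)).im)) < p (π (β + s)) := by
      refine Eventually.filter_mono nhdsWithin_le_nhds (ContinuousAt.eventually_lt
        (f := fun s => p (π (l (π (β + s)).im))) (g := fun s => p (π (β + s)))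
        (Continuous.continuousAt (by fun_prop)) (Continuous.continuousAt (by fun_prop)) ?_)
      have := h.p_lt y₁ ⟨le_rfl, h.lt⟩
      simpa [hr1, hβ] using this
    have e4 : ∀ᶠ s in 𝓝[>] (0 : ℝ), s ∈ Ioo 0 ε := Ioo_mem_nhdsGT hT.pos
    have e5 : ∀ᶠ s in 𝓝[>] (0 : ℝ), s ∈ Ioo 0 (l y₁ + 1 - β) := Ioo_mem_nhdsGT (by linarith)
    obtain ⟨s, h1, h2, h3, h4, h5⟩ := (hev.and ((hsc0.eventually (gt_mem_nhds hT.pos)).and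
      ((hsc0.eventually (gt_mem_nhds (sub_pos.2 h.lt_right))).and (e4.and e5)))).exists
    have hcs : 0 < c * s := mul_pos hc0 h4.1
    refine hT.leg_order (s := c * s) (s' := s) hv ⟨hcs.le, h2.le⟩ ⟨h4.1.le, h4.2.le⟩ hcs
      (by rw [mul_right_comm, hcw, mul_comm]) (not_le.1 fun hcon => ?_)
    have him : (π (β - c * s)).im = (π (β + s)).im := by
      rw [hT.im_left (by linarith) (by linarith), hT.im_right (s := β + s) (by linarith [h4.1]) (by linarith [h4.2])]
      linear_combination s * hcw
    have hrm : (β - c * s) ∈ Icc ζ β := ⟨by linarith, by linarith⟩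
    have hle : y₁ ≤ (π (β - c * s)).im := by
      rw [← hβ]
      exact h.anti.antitoneOn hrm ⟨h.lt_right.le, le_rfl⟩ hrm.2
    refine h.not_between (t := β + s) ⟨by linarith [h4.1], by linarith [h5.2]⟩ ?_ ?_ ?_ ?_
    · rwa [← him]
    · rw [← him]
      exact h.anti.antitoneOn ⟨le_rfl, h.lt_right.le⟩ hrm hrm.1
    · exact h1.le
    · rwa [← him, h.r_im hrm hle]
  · obtain ⟨v, w, ε, -, -, hT⟩ := h.poly.tails (r y)
    have hv := hT.right_im_neg hlt fun s hs =>
      h.anti hrm ⟨hrm.1.trans hs.1.le, hs.2.le⟩ hs.1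
    have hw := hT.left_im_neg (h.lt_r hy) fun s hs =>
      h.anti ⟨hs.1.le, hs.2.le.trans hrm.2⟩ hrm hs.2
    obtain ⟨m, h1, h2⟩ := exists_shear (a := p v) (b := -v.im) (c := p w) (d := -w.im)
      (by linarith) (Or.inl (by linarith))
    exact hT.exists_win_shear (m := -m) (by linarith) (by linarith) hz hz'

theorem good'_iff (h : Descent π α ζ β y₁ l r p) {a : ℝ} (h1 : a < l y₁) (h3 : r y₁ < a + 1) :
    Good' (chord a π (l y₁) (r y₁)) ↔ Good' π := by
  have hm : y₁ ∈ Icc y₁ (π ζ).im := ⟨le_rfl, h.lt.le⟩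
  have hm' : (π ζ).im ∈ Icc y₁ (π ζ).im := ⟨h.lt.le, le_rfl⟩
  have hbase : ∀ y ∈ Icc y₁ (π ζ).im, a < l y ∧ l y ≤ r y ∧ r y < a + 1 := fun y hy =>
    ⟨h1.trans_le (h.l_le hy), (h.l_mem _ hy).2.trans (h.r_mem _ hy).1, (h.le_r hy).trans_lt h3⟩
  have hlt : ∀ y ∈ Icc y₁ (π ζ).im, l y < r y → y ∈ Ico y₁ (π ζ).im := fun y hy hlr =>
    ⟨hy.1, hy.2.lt_of_ne fun he => by
      rw [he, h.l_apex, h.r_apex] at hlr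
      exact lt_irrefl _ hlr⟩
  have := good'_chord_iff_of_preconnected isPreconnected_Icc h.poly.continuous h.poly.periodic
    h.poly.hasWin h.continuous_l.continuousOn h.continuous_r.continuousOn hbase
    (fun y hy => h.loopInj hy (hbase y hy).1.le (hbase y hy).2.2.le)
    (fun y hy hlr => h.exists_win_left (hlt y hy hlr))
    (fun y hy hlr => h.exists_win_right (hlt y hy hlr)) hm hm'
  have hb := hbase _ hm'
  rwa [h.l_apex, h.r_apex, chord.self h.poly.periodic (by linarith [h.l_apex])
    (by linarith [h.r_apex])] at this

end Descent

theorem Hill.exists_peaks_ssubset {π : ℝ → ℂ} {α ζ β : ℝ} (h : Hill π α ζ β)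
    (hαβ : (π β).im ≤ (π α).im) (hβ : β < α + 1) :
    ∃ χ, IsPolyLoop χ ∧ (Good' χ ↔ Good' π) ∧ peaks χ ⊂ peaks π := by
  have hαζ : (π α).im < (π ζ).im := h.mono ⟨le_rfl, h.left_lt.le⟩ ⟨h.left_lt.le, le_rfl⟩ h.left_lt
  obtain ⟨l, r, p, hd⟩ := h.exists_descent le_rfl hαβ hαζ (Or.inr hβ)
  have hl : l (π α).im = α := hd.l_im ⟨le_rfl, h.left_lt.le⟩ le_rfl
  have hm : (π α).im ∈ Ico (π α).im (π ζ).im := ⟨le_rfl, hαζ⟩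
  have hm' := Ico_subset_Icc_self hm
  have hrm := hd.r_mem _ hm'
  have hζr := hd.lt_r hm
  have hir := hd.im_r _ hm'
  have hwl := hd.exists_win_left hm
  have hwr := hd.exists_win_right hm
  have hgood := fun a => hd.good'_iff (a := a)
  have hli := fun a => hd.loopInj (a := a) hm'
  set r₀ := r (π α).im with hr₀
  rw [hl] at hwl hwr hgood hli
  have hr1 : r₀ < α + 1 := hrm.2.trans_lt hβ
  obtain ⟨a, ha1, ha2⟩ := exists_between (show r₀ - 1 < α by linarith)
  have hr2 : r₀ < a + 1 := by linarith
  have hp := h.poly.periodic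
  have hαr : α ≤ r₀ := h.left_lt.le.trans hζr.le
  obtain ⟨va, wa, εa, -, hwa, hTa⟩ := h.tails_left
  have key := eventually_chord_good'_iff h.poly.continuous hp h.poly.hasWin ha2 hαr hr2
    (hli a ha2.le hr2.le) (fun _ => hwl) (fun _ => hwr)
  have htend : Tendsto (fun x => (α, x)) (𝓝[>] r₀) (𝓝 (α, r₀)) :=
    ((Continuous.prodMk_right α).tendsto r₀).mono_left nhdsWithin_le_nhds
  have hcase : ∀ᶠ x in 𝓝[>] r₀, (π x).im < (π α).im ∨
      ((π α).im < (π x).im ∧ ∃ δ > 0, ∀ s, x < s → s < x + δ → (π x).im < (π s).im) := by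
    rcases hrm.2.eq_or_lt with he | hlt
    · obtain ⟨v, w, ε, hv, -, hT⟩ := h.tails_right
      rw [← he] at hT
      filter_upwards [Ioo_mem_nhdsGT (show r₀ < r₀ + ε by linarith [hT.pos])] with x hx
      refine Or.inr ⟨?_, r₀ + ε - x, by linarith [hx.2], fun s hs hs' => ?_⟩
      · rw [hT.im_right hx.1.le hx.2.le, hir]
        nlinarith [hx.1]
      · rw [hT.im_right (s := x) hx.1.le hx.2.le,
          hT.im_right (s := s) (by linarith [hx.1]) (by linarith)]
        nlinarith
    · filter_upwards [Ioo_mem_nhdsGT hlt] with x hx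
      refine Or.inl ?_
      rw [← hir]
      exact h.anti hrm ⟨hrm.1.trans hx.1.le, hx.2.le⟩ hx.1
  have e4 : ∀ᶠ x in 𝓝[>] r₀, x ∈ Ioo r₀ (a + 1) := Ioo_mem_nhdsGT hr2
  obtain ⟨x, hx1, hx2, hx3⟩ := ((htend.eventually key).and (hcase.and e4)).exists
  have hαx : α < x := by linarith [hx3.1]
  obtain ⟨hχi, hχg⟩ := hx1 hαx.le
  have hne : (π α).im ≠ (π x).im := by
    rcases hx2 with hx2 | hx2
    exacts [hx2.ne', hx2.1.ne]
  refine ⟨_, h.poly.chord ha2.le hαx hx3.2.le (by linarith [hx3.2]) hne hχi,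
    hχg.trans (hgood a ha2 hr2), ?_⟩
  set χ := chord a π α x with hχ
  have hge : ∀ s, x ≤ s → s ≤ α + 1 → χ s = π s := fun s hs hs' =>
    chord.eq_of_ge hp ha2.le hαx.le hx3.2.le ⟨hs, hs'⟩
  have hle : ∀ s, x - 1 ≤ s → s ≤ α → χ s = π s := fun s hs hs' =>
    chord.eq_of_le hp ha2.le hαx.le hx3.2.le ⟨hs, hs'⟩
  have hmid : ∀ s, α ≤ s → s ≤ x →
      (χ s).im = (π α).im + (s - α) * (((π x).im - (π α).im) / (x - α)) := fun s hs hs' => by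
    rw [hχ, chord.eq_of_mem hp ha2.le hαx.le hx3.2.le ⟨hs, hs'⟩, Complex.add_im, Complex.smul_im,
      smul_eq_mul, Complex.sub_im]
    ring
  have hmax : ∀ t ∈ Ico α (α + 1), IsLocalMax (fun s => (χ s).im) t →
      t ∈ Ioo x (α + 1) ∧ IsLocalMax (fun s => (π s).im) t := by
    intro t ht hmax
    have hdn : (π x).im < (π α).im → α < t → x < t := fun hlt h1 => not_le.1 fun h2 => by
      refine not_isLocalMax_of_left (ε := t - α) (by linarith) (fun s hs hs' => ?_) hmax
      rw [hmid t h1.le h2, hmid s (by linarith) (by linarith)]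
      have : ((π x).im - (π α).im) / (x - α) < 0 := div_neg_of_neg_of_pos (by linarith) (by linarith)
      nlinarith
    have hup : (π α).im < (π x).im → α < t → x ≤ t := fun hlt h1 => not_lt.1 fun h2 => by
      refine not_isLocalMax_of_right (ε := x - t) (by linarith) (fun s hs hs' => ?_) hmax
      rw [hmid t h1.le h2.le, hmid s (by linarith) (by linarith)]
      have : 0 < ((π x).im - (π α).im) / (x - α) := div_pos (by linarith) (by linarith)
      nlinarith
    have hαt : α < t := ht.1.lt_of_ne fun he => by
      have hpos : 0 < min εa (α - (x - 1)) := lt_min hTa.pos (by linarith [hx3.2])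
      refine not_isLocalMax_of_left hpos (fun s hs hs' => ?_) hmax
      rw [← he] at hs hs' ⊢
      have h1 := min_le_left εa (α - (x - 1))
      have h2 := min_le_right εa (α - (x - 1))
      rw [hle s (by linarith) hs'.le, hle α (by linarith [hx3.2]) le_rfl,
        hTa.im_left hs'.le (by linarith)]
      nlinarith
    have hxt : x < t := by
      rcases hx2 with hx2 | ⟨hx2, δ, hδ, hs⟩
      · exact hdn hx2 hαt
      · refine (hup hx2 hαt).lt_of_ne fun he => ?_
        rw [← he] at hmax
        refine not_isLocalMax_of_right (ε := min δ (α + 1 - x))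
          (lt_min hδ (by linarith [hx3.2])) (fun s h1 h2 => ?_) hmax
        have h3 := min_le_left δ (α + 1 - x)
        have h4 := min_le_right δ (α + 1 - x)
        rw [hge x le_rfl (by linarith [hx3.2]), hge s h1.le (by linarith)]
        exact hs s h1 (by linarith)
    refine ⟨⟨hxt, ht.2⟩, (EventuallyEq.isLocalMax_iff ?_).1 hmax⟩
    filter_upwards [Ioo_mem_nhds hxt ht.2] with s hs
    rw [hge s hs.1.le hs.2.le]
  have hrep : ∀ z ∈ peaks χ, ∃ t ∈ Ioo x (α + 1), IsLocalMax (fun s => (π s).im) t ∧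
      (t : AddCircle (1 : ℝ)) = z := by
    rintro _ ⟨t, ht, rfl⟩
    have h1 := isLocalMax_add_int (h := fun s => (χ s).im)
      (fun s => by simp only [hχ, chord.periodic s]) ht (-⌊t - α⌋)
    rw [Int.cast_neg, ← sub_eq_add_neg] at h1
    obtain ⟨h2, h3⟩ := hmax _ ⟨by linarith [Int.floor_le (t - α)],
      by linarith [Int.lt_floor_add_one (t - α)]⟩ h1
    refine ⟨_, h2, h3, QuotientAddGroup.eq.2 ⟨⌊t - α⌋, ?_⟩⟩
    simp
  refine ⟨fun z hz => ?_, fun hsub => ?_⟩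
  · obtain ⟨t, -, ht, rfl⟩ := hrep z hz
    exact ⟨t, ht, rfl⟩
  · obtain ⟨t, ht, -, he⟩ := hrep _ (hsub ⟨ζ, h.isLocalMax, rfl⟩)
    have := (AddCircle.coe_eq_coe_iff_of_mem_Ico (a := α) ⟨by linarith [ht.1], ht.2⟩
      ⟨h.left_lt.le, by linarith⟩).1 he
    linarith [ht.1, hx3.1]

/-- A path with independent affine legs at `α`. -/
structure IsCone (π : ℝ → ℂ) (α : ℝ) (v w : ℂ) (ε : ℝ) : Prop where
  periodic : Periodic π 1
  tails : Tails π α v w ε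
  le : ε ≤ 1 / 4
  indep : ∀ x y : ℝ, x • v + y • w = 0 → x = 0 ∧ y = 0

theorem Tails.indep {π : ℝ → ℂ} {t : ℝ} {v w : ℂ} {ε : ℝ} (h : Tails π t v w ε) (hi : LoopInj π)
    (hv : 0 < v.im) (hw : w.im < 0) (x y : ℝ) (he : x • v + y • w = 0) : x = 0 ∧ y = 0 := by
  have him : x * v.im + y * w.im = 0 := by
    have := congrArg Complex.im he
    simpa using this
  have hx : x = 0 := by
    by_contra hx
    have hv' : v = -((y / x) • w) := by
      have h1 := eq_neg_of_add_eq_zero_left he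
      rw [← inv_smul_smul₀ hx v, h1, smul_neg, smul_smul, div_eq_inv_mul]
    refine h.ne_neg_smul hi (c := y / x) ?_ hv'
    have h2 : y / x = v.im / -w.im := by
      rw [div_eq_div_iff hx (neg_ne_zero.2 hw.ne)]
      linarith
    rw [h2]
    exact div_pos hv (neg_pos.2 hw)
  refine ⟨hx, ?_⟩
  rw [hx, zero_mul, zero_add] at him
  exact (mul_eq_zero.1 him).resolve_right hw.ne

namespace IsCone
variable {π : ℝ → ℂ} {α : ℝ} {v w : ℂ} {ε : ℝ}

theorem eq_left (h : IsCone π α v w ε) {s : ℝ} (h1 : α + 1 - ε ≤ s) (h2 : s ≤ α + 1) :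
    π s = π α - (α + 1 - s) • w := by
  rw [← h.periodic.sub_eq, h.tails.eq_left (by linarith) (by linarith)]
  module

theorem eq_right' (h : IsCone π α v w ε) {s : ℝ} (h1 : α + 1 ≤ s) (h2 : s ≤ α + 1 + ε) :
    π s = π α + (s - 1 - α) • v := by
  rw [← h.periodic.sub_eq, h.tails.eq_right (by linarith) (by linarith)]

theorem good'_iff (h : IsCone π α v w ε) (hc : Continuous π) (hi : LoopInj π) (hw : HasWin π)
    {l r l' r' : ℝ} (hl : l ∈ Ioo α (α + ε)) (hr : r ∈ Ioo (α + 1 - ε) (α + 1))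
    (hl' : l' ∈ Ioo α (α + ε)) (hr' : r' ∈ Ioo (α + 1 - ε) (α + 1)) :
    Good' (chord α π l r) ↔ Good' (chord α π l' r') := by
  have hε := h.le
  have hdiff : ∀ q ∈ Ioo α (α + ε) ×ˢ Ioo (α + 1 - ε) (α + 1),
      π q.2 - π q.1 = -((q.1 - α) • v + (α + 1 - q.2) • w) := fun q hq => by
    rw [h.eq_left hq.2.1.le hq.2.2.le, h.tails.eq_right hq.1.1.le hq.1.2.le]
    abel
  refine good'_chord_iff_of_preconnected (isPreconnected_Ioo.prod isPreconnected_Ioo) hc h.periodic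
    hw continuousOn_fst continuousOn_snd (fun q hq => ⟨hq.1.1, by linarith [hq.1.2, hq.2.1], hq.2.2⟩)
    (fun q hq => ?_) (fun q hq _ => ?_) (fun q hq _ => ?_) (x := (l, r)) (y := (l', r'))
    ⟨hl, hr⟩ ⟨hl', hr'⟩
  · refine chord.loopInj h.periodic hi hq.1.1.le (by linarith [hq.1.2, hq.2.1]) hq.2.2.le
      (by linarith [hq.1.1, hq.2.2]) fun _ t ht θ hθ he => ?_
    rw [hdiff q hq, h.tails.eq_right hq.1.1.le hq.1.2.le] at he
    rcases le_total t (α + 1) with ht1 | ht1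
    · rw [h.eq_left (by linarith [hq.2.1, ht.1]) ht1] at he
      have h0 : ((1 - θ) * (q.1 - α)) • v + ((α + 1 - t) - θ * (α + 1 - q.2)) • w = 0 := by
        linear_combination (norm := module) (-1 : ℝ) • he
      obtain ⟨h1, h2⟩ := h.indep _ _ h0
      have h3 : 1 - θ = 0 := (mul_eq_zero.1 h1).resolve_right (by linarith [hq.1.1])
      have h4 : θ = 1 := by linarith
      rw [h4] at h2
      linarith [ht.1]
    · rw [h.eq_right' ht1 (by linarith [hq.1.2, ht.2])] at he
      have h0 : ((1 - θ) * (q.1 - α) - (t - 1 - α)) • v + (-θ * (α + 1 - q.2)) • w = 0 := by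
        linear_combination (norm := module) (-1 : ℝ) • he
      obtain ⟨h1, h2⟩ := h.indep _ _ h0
      have h3 : -θ = 0 := (mul_eq_zero.1 h2).resolve_right (by linarith [hq.2.2])
      have h4 : θ = 0 := by linarith
      rw [h4] at h1
      linarith [ht.2]
  all_goals
    set x := q.1 - α with hx
    set y := α + 1 - q.2 with hy
    have hx0 : 0 < x := by linarith [hq.1.1]
    have hy0 : 0 < y := by linarith [hq.2.2]
    have hz0 : π q.2 - π q.1 ≠ 0 := fun h0 => by
      rw [hdiff q hq, neg_eq_zero] at h0
      exact hx0.ne' (h.indep _ _ h0).1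
  · have hv0 : v ≠ 0 := fun h0 => one_ne_zero (h.indep 1 0 (by simp [h0])).1
    obtain ⟨n, hn1, hn2⟩ := exists_functional_pos hv0 hz0 fun c hc he => by
      rw [hdiff q hq] at he
      have h0 : (1 - c * x) • v + (-(c * y)) • w = 0 := by
        linear_combination (norm := module) (1 : ℝ) • he
      have := (h.indep _ _ h0).2
      have := mul_pos hc hy0
      linarith
    have hT : Tails π q.1 v v (min x (α + ε - q.1)) :=
      Tails.of_eq (lt_min hx0 (by linarith [hq.1.2]))
        (fun s hs hs' => by
          rw [h.tails.eq_right (s := s) (by linarith [hq.1.1])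
            (by linarith [min_le_right x (α + ε - q.1)]), h.tails.eq_right hq.1.1.le hq.1.2.le]
          module)
        (fun s hs hs' => by
          rw [h.tails.eq_right (s := s) (by linarith [min_le_left x (α + ε - q.1)])
            (by linarith [hq.1.2]), h.tails.eq_right hq.1.1.le hq.1.2.le]
          module)
    obtain ⟨κ, hκ, hwin⟩ := hT.exists_win hn1 hn1
    exact ⟨_, _, hT.pos, hwin, mul_pos (inv_pos.2 hκ) hn2⟩
  · have hw0 : w ≠ 0 := fun h0 => one_ne_zero (h.indep 0 1 (by simp [h0])).2
    obtain ⟨n, hn1, hn2⟩ := exists_functional_pos hw0 hz0 fun c hc he => by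
      rw [hdiff q hq] at he
      have h0 : (-(c * x)) • v + (1 - c * y) • w = 0 := by
        linear_combination (norm := module) (1 : ℝ) • he
      have := (h.indep _ _ h0).1
      have := mul_pos hc hx0
      linarith
    have hT : Tails π q.2 w w (min y (q.2 - (α + 1 - ε))) :=
      Tails.of_eq (lt_min hy0 (by linarith [hq.2.1]))
        (fun s hs hs' => by
          rw [h.eq_left (s := s) (by linarith [hq.2.1])
            (by linarith [min_le_left y (q.2 - (α + 1 - ε))]), h.eq_left hq.2.1.le hq.2.2.le]
          module)
        (fun s hs hs' => by
          rw [h.eq_left (s := s) (by linarith [min_le_right y (q.2 - (α + 1 - ε))])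
            (by linarith [hq.2.2]), h.eq_left hq.2.1.le hq.2.2.le]
          module)
    obtain ⟨κ, hκ, hwin⟩ := hT.exists_win hn1 hn1
    exact ⟨_, _, hT.pos, hwin, mul_pos (inv_pos.2 hκ) hn2⟩

end IsCone

theorem Hill.exists_cone {π : ℝ → ℂ} {α ζ β : ℝ} (h : Hill π α ζ β) (hβ : β = α + 1) :
    ∃ v w ε, IsCone π α v w ε ∧
      ∀ s ∈ Ioo 0 ε, (Good' π ↔ Good' (chord α π (α + s) (α + 1 - s))) := by
  obtain ⟨v, w, ε₀, hv, hw, hT⟩ := h.tails_left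
  have hcone : IsCone π α v w (min ε₀ (1 / 4)) :=
    ⟨h.poly.periodic, hT.mono (lt_min hT.pos (by norm_num)) (min_le_left _ _), min_le_right _ _,
      hT.indep h.poly.inj hv hw⟩
  set ε := min ε₀ (1 / 4)
  have hε := hcone.tails.pos
  have hε' := hcone.le
  have h1 := h.left_lt
  have h2 := h.lt_right
  have hperiod : (π β).im = (π α).im := by rw [hβ, h.poly.periodic]
  obtain ⟨e, he0, he⟩ := exists_between (show 0 < min ε (min (ζ - α) (β - ζ)) from
    lt_min hε (lt_min (by linarith) (by linarith)))
  obtain ⟨he1, he⟩ := lt_min_iff.1 he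
  obtain ⟨he2, he3⟩ := lt_min_iff.1 he
  have mα : α ∈ Icc α ζ := ⟨le_rfl, h1.le⟩
  have mβ : β ∈ Icc ζ β := ⟨h2.le, le_rfl⟩
  have ml : α + e ∈ Icc α ζ := ⟨by linarith, by linarith⟩
  have mr : β - e ∈ Icc ζ β := ⟨by linarith, by linarith⟩
  have i1 : (π α).im < (π (α + e)).im := h.mono mα ml (by linarith)
  have i2 : (π β).im < (π (β - e)).im := h.anti mr mβ (by linarith)
  have i3 : (π (α + e)).im < (π ζ).im := h.mono ml ⟨h1.le, le_rfl⟩ (by linarith)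
  set y := min (π (α + e)).im (π (β - e)).im with hy
  have hy1 : (π α).im < y := lt_min i1 (hperiod ▸ i2)
  have hy2 : y < (π ζ).im := (min_le_left _ _).trans_lt i3
  obtain ⟨l, r, p, hd⟩ := h.exists_descent hy1.le (hperiod.trans_le hy1.le) hy2 (Or.inl hy1)
  have hm : y ∈ Icc y (π ζ).im := ⟨le_rfl, hy2.le⟩
  have hl := hd.l_mem _ hm
  have hr := hd.r_mem _ hm
  have hl1 : α < l y := hl.1.lt_of_ne fun h0 => by
    have := hd.im_l _ hm
    rw [← h0] at this
    exact hy1.ne this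
  have hr1 : r y < β := hr.2.lt_of_ne fun h0 => by
    have := hd.im_r _ hm
    rw [h0, hperiod] at this
    exact hy1.ne this
  have hl2 : l y ≤ α + e := (h.mono.le_iff_le hl ml).1 (by
    simp only [hd.im_l _ hm]
    exact min_le_left _ _)
  have hr2 : β - e ≤ r y := (h.anti.le_iff_ge hr mr).1 (by
    simp only [hd.im_r _ hm]
    exact min_le_right _ _)
  refine ⟨v, w, ε, hcone, fun s hs => ?_⟩
  rw [← hd.good'_iff hl1 (hr1.trans_eq hβ)]
  exact hcone.good'_iff h.poly.continuous h.poly.inj h.poly.hasWin ⟨hl1, by linarith⟩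
    ⟨by linarith, by linarith⟩ ⟨by linarith [hs.1], by linarith [hs.2]⟩
    ⟨by linarith [hs.2], by linarith [hs.1]⟩

theorem peaks_comp_neg (π : ℝ → ℂ) : peaks (fun t => π (-t)) = Neg.neg '' peaks π := by
  ext z
  constructor
  · rintro ⟨t, ht, rfl⟩
    refine ⟨((-t : ℝ) : AddCircle (1 : ℝ)), ⟨-t, ?_, rfl⟩, by simp⟩
    have := isLocalMax_comp_neg (h := fun s => (π (-s)).im) (t := t) ht
    simpa using this
  · rintro ⟨_, ⟨t, ht, rfl⟩, rfl⟩
    exact ⟨-t, isLocalMax_comp_neg (h := fun s => (π s).im) ht, by simp⟩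

theorem IsPolyLoop.exists_cone {π : ℝ → ℂ} (h : IsPolyLoop π) :
    ∃ π₀ α v w ε, Continuous π₀ ∧ IsCone π₀ α v w ε ∧
      ∀ s ∈ Ioo 0 ε, (Good' π ↔ Good' (_root_.chord α π₀ (α + s) (α + 1 - s))) := by
  induction hn : (peaks π).ncard using Nat.strong_induction_on generalizing π with
  | _ n ih =>
    have reduce : ∀ {ξ : ℝ → ℂ} {α ζ β : ℝ}, Hill ξ α ζ β → (ξ β).im ≤ (ξ α).im → β < α + 1 →
        (peaks ξ).ncard = n → (Good' ξ ↔ Good' π) →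
        ∃ π₀ α v w ε, Continuous π₀ ∧ IsCone π₀ α v w ε ∧
          ∀ s ∈ Ioo 0 ε, (Good' π ↔ Good' (_root_.chord α π₀ (α + s) (α + 1 - s))) := by
      intro ξ α ζ β hξ h1 h2 h3 h4
      obtain ⟨χ, hχ, hg, hs⟩ := hξ.exists_peaks_ssubset h1 h2
      obtain ⟨π₀, α', v, w, ε, k1, k2, k3⟩ :=
        ih _ (h3 ▸ ncard_lt_ncard hs hξ.poly.finite_peaks) hχ rfl
      exact ⟨π₀, α', v, w, ε, k1, k2, fun s hs => (hg.trans h4).symm.trans (k3 s hs)⟩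
    obtain ⟨α, ζ, β, hh⟩ := h.exists_hill
    rcases hh.le_add_one.eq_or_lt with hβ | hβ
    · obtain ⟨v, w, ε, h1, h2⟩ := hh.exists_cone hβ
      exact ⟨π, α, v, w, ε, h.continuous, h1, h2⟩
    rcases le_total (π β).im (π α).im with hle | hle
    · exact reduce hh hle hβ hn Iff.rfl
    · refine reduce hh.reverse (by simpa using hle) (by linarith) ?_ good'_reverse
      rw [peaks_comp_neg, ncard_image_of_injective _ neg_injective, hn]

theorem exists_linearEquiv_pair {v w v' w' : ℂ}
    (h : ∀ x y : ℝ, x • v + y • w = 0 → x = 0 ∧ y = 0)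
    (h' : ∀ x y : ℝ, x • v' + y • w' = 0 → x = 0 ∧ y = 0) :
    ∃ A : ℂ ≃L[ℝ] ℂ, A v = v' ∧ A w = w' := by
  have hcard : Fintype.card (Fin 2) = Module.finrank ℝ ℂ := by simp
  set b := basisOfLinearIndependentOfCardEqFinrank (LinearIndependent.pair_iff.2 h) hcard with hb
  set b' := basisOfLinearIndependentOfCardEqFinrank (LinearIndependent.pair_iff.2 h') hcard with hb'
  have hA : ∀ i, b.equiv b' (Equiv.refl _) (b i) = b' i := fun i => by simp
  refine ⟨(b.equiv b' (Equiv.refl _)).toContinuousLinearEquiv, ?_, ?_⟩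
  · simpa [hb, hb'] using hA 0
  · simpa [hb, hb'] using hA 1

theorem IsCone.chord_eq {π π' : ℝ → ℂ} {α α' ε ε' s : ℝ} {v w v' w' : ℂ} (h : IsCone π α v w ε)
    (h' : IsCone π' α' v' w' ε') (h0 : 0 < s) (h1 : s < ε) (h2 : s < ε') {A : ℂ ≃L[ℝ] ℂ}
    (hv : A v = v') (hw : A w = w') (t : ℝ) :
    chord α' π' (α' + s) (α' + 1 - s) (t + α') =
      A (chord α π (α + s) (α + 1 - s) (t + α)) + (π' α' - A (π α)) := by
  have hε := h.le
  have hε' := h'.le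
  have main : ∀ t ∈ Ico s (s + 1), chord α' π' (α' + s) (α' + 1 - s) (t + α') =
      A (chord α π (α + s) (α + 1 - s) (t + α)) + (π' α' - A (π α)) := by
    intro t ht
    rcases le_total t (1 - s) with h3 | h3
    · rw [chord.eq_of_mem h.periodic (by linarith) (by linarith) (by linarith)
        ⟨by linarith [ht.1], by linarith⟩, chord.eq_of_mem h'.periodic (by linarith) (by linarith)
        (by linarith) ⟨by linarith [ht.1], by linarith⟩, h.eq_left (s := α + 1 - s) (by linarith) (by linarith),
        h'.eq_left (s := α' + 1 - s) (by linarith) (by linarith), h.tails.right s ⟨h0.le, h1.le⟩,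
        h'.tails.right s ⟨h0.le, h2.le⟩]
      simp only [map_add, map_sub, map_smul, hv, hw]
      rw [show (t + α - (α + s)) / (α + 1 - s - (α + s)) = (t - s) / (1 - s - s) by ring_nf,
        show (t + α' - (α' + s)) / (α' + 1 - s - (α' + s)) = (t - s) / (1 - s - s) by ring_nf]
      module
    rw [chord.eq_of_ge h.periodic (by linarith) (by linarith) (by linarith)
        ⟨by linarith, by linarith [ht.2]⟩, chord.eq_of_ge h'.periodic (by linarith) (by linarith)
        (by linarith) ⟨by linarith, by linarith [ht.2]⟩]
    rcases le_total t 1 with h4 | h4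
    · rw [h.eq_left (by linarith) (by linarith), h'.eq_left (by linarith) (by linarith)]
      simp only [map_sub, map_smul, hw]
      module
    · rw [h.eq_right' (by linarith) (by linarith [ht.2]),
        h'.eq_right' (by linarith) (by linarith [ht.2])]
      simp only [map_add, map_smul, hv]
      module
  have key := main (t - ⌊t - s⌋) ⟨by linarith [Int.floor_le (t - s)],
    by linarith [Int.lt_floor_add_one (t - s)]⟩
  have e : ∀ c : ℝ, t + c = t - ⌊t - s⌋ + c + ⌊t - s⌋ := fun c => by ring
  rw [e α, e α', chord.periodic.add_int, chord.periodic.add_int, key]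

theorem IsPolyLoop.good'_iff {π π' : ℝ → ℂ} (h : IsPolyLoop π) (h' : IsPolyLoop π') :
    Good' π ↔ Good' π' := by
  obtain ⟨π₁, α₁, v₁, w₁, ε₁, hc₁, h₁, hg₁⟩ := h.exists_cone
  obtain ⟨π₂, α₂, v₂, w₂, ε₂, hc₂, h₂, hg₂⟩ := h'.exists_cone
  obtain ⟨A, hv, hw⟩ := exists_linearEquiv_pair h₁.indep h₂.indep
  obtain ⟨s, hs0, hs⟩ := exists_between (lt_min h₁.tails.pos h₂.tails.pos)
  obtain ⟨hs1, hs2⟩ := lt_min_iff.1 hs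
  have hε := h₁.le
  have hcont := chord.continuous (a := α₁) (l := α₁ + s) (r := α₁ + 1 - s) hc₁ h₁.periodic
    (by linarith) (by linarith) (by linarith)
  have key := good'_affine (hcont.comp (continuous_add_const α₁)) A (π₂ α₂ - A (π₁ α₁))
  simp only [comp_apply, ← h₁.chord_eq h₂ hs0 hs1 hs2 hv hw, good'_shift, comp_def] at key
  rw [hg₁ s ⟨hs0, hs1⟩, hg₂ s ⟨hs0, hs2⟩, key]

theorem IsLoop.hasWin {γ : ℝ → ℂ} (h : IsLoop γ) : HasWin γ := by
  intro t
  set n : ℂ →L[ℝ] ℝ := (2 / ‖deriv γ t‖ ^ 2) • innerSL ℝ (deriv γ t) with hn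
  have hpos : 0 < ‖deriv γ t‖ := norm_pos_iff.2 (h.deriv_ne t)
  have hnt : n (deriv γ t) = 2 := by
    rw [hn, _root_.smul_apply, innerSL_apply_apply, real_inner_self_eq_norm_sq, smul_eq_mul]
    field_simp
  have hcd : Continuous (deriv γ) := h.smooth.continuous_deriv (by simp)
  have hev : ∀ᶠ s in 𝓝 t, 1 < n (deriv γ s) :=
    (n.continuous.comp hcd).continuousAt.eventually (lt_mem_nhds (by simp [hnt]))
  obtain ⟨ε, hε, hb⟩ := Metric.eventually_nhds_iff.1 hev
  refine ⟨n, ε / 2, by linarith, fun s s' h1 h2 h3 => ?_⟩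
  have hd : ∀ x, HasDerivAt (fun x => n (γ x)) (n (deriv γ x)) x := fun x =>
    n.hasFDerivAt.comp_hasDerivAt x (h.differentiableAt x).hasDerivAt
  have hdiff : Differentiable ℝ fun x => n (γ x) := fun x => (hd x).differentiableAt
  have := (convex_Icc s s').mul_sub_le_image_sub_of_le_deriv (C := 1) hdiff.continuous.continuousOn
    hdiff.differentiableOn (fun x hx => ?_) s ⟨le_rfl, h2⟩ s' ⟨h2, le_rfl⟩ h2
  · rwa [one_mul, ← map_sub] at this
  · rw [interior_Icc] at hx
    rw [(hd x).deriv]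
    refine (hb ?_).le
    rw [Real.dist_eq, abs_lt]
    constructor <;> linarith [hx.1, hx.2]

theorem isLoop_circ : IsLoop circ where
  smooth := by
    unfold circ
    exact ((contDiff_const.mul Complex.ofRealCLM.contDiff).mul contDiff_const).cexp
  periodic := fun t => by
    rw [circ_add, show circ 1 = 1 by simp [circ, Complex.exp_two_pi_mul_I], one_mul]
  deriv_ne := fun t => by
    have h1 : HasDerivAt (fun t : ℝ => 2 * (Real.pi : ℂ) * t * Complex.I)
        (2 * (Real.pi : ℂ) * 1 * Complex.I) t :=
      ((Complex.ofRealCLM.hasDerivAt (x := t)).const_mul _).mul_const _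
    have h2 : HasDerivAt circ (Complex.exp (2 * Real.pi * t * Complex.I) *
      (2 * (Real.pi : ℂ) * 1 * Complex.I)) t := h1.cexp
    rw [h2.deriv]
    simp [Real.pi_ne_zero]
  inj := fun s t h => by
    obtain ⟨k, hk⟩ := Complex.exp_eq_exp_iff_exists_int.1 h.symm
    refine ⟨k, ?_⟩
    have h0 : (2 * Real.pi * Complex.I : ℂ) ≠ 0 := by simp [Real.pi_ne_zero]
    have : (t : ℂ) = s + k := mul_right_cancel₀ h0 (by linear_combination hk)
    exact_mod_cast this

/-- The slope of the `k`-th edge of the polygon inscribed in `γ`. -/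
noncomputable def edge (γ : ℝ → ℂ) (N : ℕ) (k : ℤ) : ℂ :=
  (N : ℝ) • (γ ((k + 1) / N) - γ (k / N))

/-- The closed polygon with vertices `γ (k / N)`. -/
noncomputable def polygon (γ : ℝ → ℂ) (N : ℕ) (s : ℝ) : ℂ :=
  γ (⌊N * s⌋ / N) + (s - ⌊N * s⌋ / N) • edge γ N ⌊N * s⌋

section polygon
variable {γ : ℝ → ℂ} {N : ℕ}

theorem polygon_eq (hN : 0 < N) {k : ℤ} {s : ℝ} (h1 : k / N ≤ s) (h2 : s ≤ (k + 1) / N) :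
    polygon γ N s = γ (k / N) + (s - k / N) • edge γ N k := by
  have hN' : (0 : ℝ) < N := by exact_mod_cast hN
  rcases h2.eq_or_lt with rfl | h2
  · have : (N : ℝ) * ((k + 1) / N) = ((k + 1 : ℤ) : ℝ) := by
      push_cast
      field_simp
    rw [polygon, this, Int.floor_intCast]
    push_cast
    rw [sub_self, zero_smul, add_zero, edge, smul_smul,
      show ((k + 1 : ℝ) / N - k / N) * N = 1 by field_simp; ring, one_smul, add_sub_cancel]
  · rw [div_le_iff₀ hN'] at h1
    rw [lt_div_iff₀ hN'] at h2
    have : ⌊(N : ℝ) * s⌋ = k := Int.floor_eq_iff.2 ⟨by linarith, by linarith⟩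
    rw [polygon, this]

theorem edge_add (hp : Periodic γ 1) (hN : 0 < N) (k : ℤ) : edge γ N (k + N) = edge γ N k := by
  have hN' : (N : ℝ) ≠ 0 := by exact_mod_cast hN.ne'
  rw [edge, edge]
  push_cast
  rw [show ((k : ℝ) + N + 1) / N = (k + 1) / N + 1 by field_simp; ring,
    show ((k : ℝ) + N) / N = k / N + 1 by field_simp, hp, hp]

theorem polygon_periodic (hp : Periodic γ 1) (hN : 0 < N) : Periodic (polygon γ N) 1 := fun s => by
  have hN' : (N : ℝ) ≠ 0 := by exact_mod_cast hN.ne'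
  have hf : ⌊(N : ℝ) * (s + 1)⌋ = ⌊(N : ℝ) * s⌋ + N := by
    rw [mul_add, mul_one, Int.floor_add_natCast]
  rw [polygon, polygon, hf, edge_add hp hN]
  push_cast
  rw [show ((⌊(N : ℝ) * s⌋ : ℝ) + N) / N = ⌊(N : ℝ) * s⌋ / N + 1 by field_simp, hp,
    add_sub_add_right_eq_sub]

theorem polygon_tails (hN : 0 < N) (t : ℝ) :
    ∃ k l : ℤ, ∃ ε, Tails (polygon γ N) t (edge γ N k) (edge γ N l) ε := by
  have hN' : (0 : ℝ) < N := by exact_mod_cast hN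
  set k := ⌊(N : ℝ) * t⌋ with hk
  set l := ⌈(N : ℝ) * t⌉ - 1 with hl
  have k1 : (k : ℝ) / N ≤ t := by
    rw [div_le_iff₀ hN', mul_comm]
    exact Int.floor_le _
  have k2 : t < (k + 1) / N := by
    rw [lt_div_iff₀ hN', mul_comm]
    exact Int.lt_floor_add_one _
  have l1 : (l : ℝ) / N < t := by
    rw [div_lt_iff₀ hN', mul_comm, hl]
    push_cast
    linarith [Int.ceil_lt_add_one ((N : ℝ) * t)]
  have l2 : t ≤ (l + 1) / N := by
    rw [le_div_iff₀ hN', mul_comm, hl]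
    push_cast
    linarith [Int.le_ceil ((N : ℝ) * t)]
  have e1 := min_le_left (((k : ℝ) + 1) / N - t) (t - l / N)
  have e2 := min_le_right (((k : ℝ) + 1) / N - t) (t - l / N)
  refine ⟨k, l, min (((k : ℝ) + 1) / N - t) (t - l / N), Tails.of_eq
    (lt_min (by linarith) (by linarith)) (fun s h1 h2 => ?_) (fun s h1 h2 => ?_)⟩
  · rw [polygon_eq hN (k1.trans h1) (by linarith), polygon_eq hN k1 k2.le]
    module
  · rw [polygon_eq (k := l) hN (by linarith) (h1.trans l2), polygon_eq (k := l) hN l1.le l2]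
    module

theorem Tails.continuousAt {π : ℝ → ℂ} {t ε : ℝ} {v w : ℂ} (h : Tails π t v w ε) :
    ContinuousAt π t := by
  rw [continuousAt_iff_continuous_left_right]
  constructor
  · have c : Continuous fun s : ℝ => π t + (s - t) • w := by fun_prop
    refine c.continuousWithinAt.congr_of_eventuallyEq ?_ (by simp)
    filter_upwards [self_mem_nhdsWithin,
      mem_nhdsWithin_of_mem_nhds (Ioi_mem_nhds (sub_lt_self t h.pos))] with s h1 h2
    exact h.eq_left h1 (le_of_lt h2)
  · have c : Continuous fun s : ℝ => π t + (s - t) • v := by fun_prop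
    refine c.continuousWithinAt.congr_of_eventuallyEq ?_ (by simp)
    filter_upwards [self_mem_nhdsWithin,
      mem_nhdsWithin_of_mem_nhds (Iio_mem_nhds (lt_add_of_pos_right t h.pos))] with s h1 h2
    exact h.eq_right h1 (le_of_lt h2)

theorem polygon_continuous (hN : 0 < N) : Continuous (polygon γ N) :=
  continuous_iff_continuousAt.2 fun t => by
    obtain ⟨_, _, _, h⟩ := polygon_tails (γ := γ) hN t
    exact h.continuousAt

theorem exists_grid (hN : 0 < N) (s : ℝ) : ∃ k : ℤ, (k : ℝ) / N ≤ s ∧ s ≤ (k + 1) / N := by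
  have hN' : (0 : ℝ) < N := by exact_mod_cast hN
  refine ⟨⌊(N : ℝ) * s⌋, ?_, ?_⟩
  · rw [div_le_iff₀ hN', mul_comm]
    exact Int.floor_le _
  · rw [le_div_iff₀ hN', mul_comm]
    exact (Int.lt_floor_add_one _).le

theorem Win.polygon {n : ℂ →L[ℝ] ℝ} {a b : ℝ} (hN : 0 < N) (h : Win γ n a b) :
    Win (polygon γ N) n (a + 1 / N) (b - 1 / N) := by
  have hN' : (0 : ℝ) < N := by exact_mod_cast hN
  have hsucc : ∀ k : ℤ, ((k : ℝ) + 1) / N = k / N + 1 / N := fun k => add_div _ _ _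
  have hpos : (0 : ℝ) < 1 / N := by positivity
  have hedge : ∀ k : ℤ, a ≤ k / N → ((k : ℝ) + 1) / N ≤ b → 1 ≤ n (edge γ N k) := by
    intro k h1 h2
    have := h h1 (by rw [hsucc]; linarith) h2
    rw [edge, map_smul, smul_eq_mul]
    calc (1 : ℝ) = N * ((k + 1) / N - k / N) := by field_simp; ring
      _ ≤ _ := by gcongr
  intro s s' h1 h2 h3
  obtain ⟨k, k1, k2⟩ := exists_grid hN s
  obtain ⟨m, m1, m2⟩ := exists_grid hN s'
  have ek := hedge k (by linarith [hsucc k]) (by linarith [hsucc k])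
  have em := hedge m (by linarith [hsucc m]) (by linarith [hsucc m])
  rcases le_or_gt s' ((k + 1) / N) with h4 | h4
  · rw [polygon_eq hN k1 k2, polygon_eq hN (k1.trans h2) h4, add_sub_add_left_eq_sub, ← sub_smul,
      map_smul, smul_eq_mul]
    nlinarith
  · have hkm : (k : ℝ) + 1 ≤ m := by
      have : (k : ℝ) + 1 < m + 1 := by
        have := h4.trans_le m2
        rwa [div_lt_div_iff_of_pos_right hN'] at this
      have : k + 1 < m + 1 := by exact_mod_cast this
      exact_mod_cast Int.lt_add_one_iff.1 this
    have hkm' : ((k : ℝ) + 1) / N ≤ m / N := by gcongr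
    have hmid := h (by linarith) hkm' (by linarith)
    have e : n (γ ((k + 1) / N)) = n (γ (k / N)) + ((k + 1) / N - k / N) * n (edge γ N k) := by
      rw [edge, map_smul, map_sub, smul_eq_mul]
      field_simp
      ring
    rw [polygon_eq hN k1 k2, polygon_eq hN m1 m2]
    simp only [map_sub, map_add, map_smul, smul_eq_mul] at hmid ⊢
    rw [e] at hmid
    nlinarith

theorem polygon_tendsto (hc : Continuous γ) (t : ℝ) :
    Tendsto (fun q : ℕ × ℝ => polygon γ q.1 q.2) (atTop ×ˢ 𝓝 t) (𝓝 (γ t)) := by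
  rw [Metric.tendsto_nhds]
  intro ε hε
  obtain ⟨δ, hδ, h⟩ := Metric.continuousAt_iff.1 (hc.continuousAt (x := t)) ε hε
  have h1 : ∀ᶠ N : ℕ in atTop, 1 / (N : ℝ) < δ / 2 ∧ 0 < N :=
    (tendsto_one_div_atTop_nhds_zero_nat.eventually (gt_mem_nhds (by linarith))).and
      (eventually_gt_atTop 0)
  have h2 : ∀ᶠ s in 𝓝 t, dist s t < δ / 2 := Metric.ball_mem_nhds t (by linarith)
  filter_upwards [h1.prod_mk h2] with q ⟨⟨hq1, hq0⟩, hq2⟩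
  obtain ⟨k, k1, k2⟩ := exists_grid hq0 q.2
  have hN' : (0 : ℝ) < q.1 := by exact_mod_cast hq0
  have hs : ((k : ℝ) + 1) / q.1 = k / q.1 + 1 / q.1 := add_div _ _ _
  rw [Real.dist_eq, abs_lt] at hq2
  have b1 : γ (k / q.1) ∈ Metric.ball (γ t) ε := h (by
    rw [Real.dist_eq, abs_lt]
    constructor <;> linarith [hq2.1, hq2.2])
  have b2 : γ ((k + 1) / q.1) ∈ Metric.ball (γ t) ε := h (by
    rw [Real.dist_eq, abs_lt]
    constructor <;> linarith [hq2.1, hq2.2])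
  rw [polygon_eq hq0 k1 k2, edge, smul_smul]
  refine (convex_ball (γ t) ε).add_smul_sub_mem b1 b2 ⟨?_, ?_⟩
  · exact mul_nonneg (by linarith) hN'.le
  · calc (q.2 - k / q.1) * (q.1 : ℝ) ≤ ((k + 1) / q.1 - k / q.1) * q.1 := by gcongr
      _ = 1 := by field_simp; ring

theorem IsLoop.exists_polygon {γ : ℝ → ℂ} (h : IsLoop γ) :
    ∃ N, 2 ≤ N ∧ LoopInj (polygon γ N) ∧ (Good' (polygon γ N) ↔ Good γ) := by
  have key := eventually_good'_iff h.smooth.continuous h.periodic h.inj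
    ((eventually_gt_atTop 0).mono fun N hN => polygon_continuous (γ := γ) hN)
    ((eventually_gt_atTop 0).mono fun N hN => polygon_periodic h.periodic hN)
    (polygon_tendsto h.smooth.continuous) (fun t => ?_)
  · obtain ⟨N, ⟨h1, h2, -⟩, h3⟩ := (key.and (eventually_ge_atTop 2)).exists
    exact ⟨N, h3, h1, h2.trans (good_iff_good' h h.hasWin).symm⟩
  · obtain ⟨n, ε, hε, hw⟩ := h.hasWin t
    refine ⟨n, ε / 2, by linarith, hw.mono (by linarith) (by linarith), ?_⟩
    filter_upwards [eventually_gt_atTop 0,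
      tendsto_one_div_atTop_nhds_zero_nat.eventually (gt_mem_nhds (show 0 < ε / 2 by linarith))]
      with N h1 h2
    exact (hw.polygon h1).mono (by linarith) (by linarith)

end polygon

theorem IsLoop.edge_ne_zero {γ : ℝ → ℂ} (h : IsLoop γ) {N : ℕ} (hN : 2 ≤ N) (k : ℤ) :
    edge γ N k ≠ 0 := by
  have hN' : (2 : ℝ) ≤ N := by exact_mod_cast hN
  refine smul_ne_zero (by linarith) (sub_ne_zero.2 fun he => ?_)
  have := LoopInj.eq_of_abs_lt h.inj ?_ he
  · field_simp at this
    linarith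
  · rw [← sub_div, add_sub_cancel_left, abs_of_pos (by positivity), div_lt_one (by linarith)]
    linarith

theorem exists_mul_im_ne_zero {S : Set ℂ} (hS : S.Countable) (h0 : ∀ z ∈ S, z ≠ 0) :
    ∃ c : ℂ, c ≠ 0 ∧ ∀ z ∈ S, (c * z).im ≠ 0 := by
  obtain ⟨x, hx⟩ := ((hS.image fun z => -z.re / z.im).dense_compl ℝ).nonempty
  refine ⟨⟨x, 1⟩, fun h => one_ne_zero (congrArg Complex.im h), fun z hz he => hx ⟨z, hz, ?_⟩⟩
  rw [Complex.mul_im, one_mul] at he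
  have him : z.im ≠ 0 := fun h1 => h0 z hz (Complex.ext (by simpa [h1] using he) h1)
  simp only
  rw [div_eq_iff him]
  linarith

theorem IsLoop.exists_isPolyLoop {γ : ℝ → ℂ} (h : IsLoop γ) :
    ∃ π, IsPolyLoop π ∧ (Good' π ↔ Good γ) := by
  obtain ⟨N, hN, hi, hg⟩ := h.exists_polygon
  have hN0 : 0 < N := by omega
  obtain ⟨c, hc, hS⟩ := exists_mul_im_ne_zero (countable_range (edge γ N)) (by
    rintro _ ⟨k, rfl⟩
    exact h.edge_ne_zero hN k)
  have hcont := polygon_continuous (γ := γ) hN0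
  have key := good'_affine hcont (mulEquiv c hc) 0
  simp only [mulEquiv_apply, add_zero] at key
  refine ⟨fun t => c * polygon γ N t, ⟨continuous_const.mul hcont, fun t => ?_, fun s t hst => ?_,
    fun t => ?_⟩, key.trans hg⟩
  · simp only [polygon_periodic h.periodic hN0 t]
  · exact hi s t (mul_left_cancel₀ hc hst)
  · obtain ⟨k, l, ε, hT⟩ := polygon_tails (γ := γ) hN0 t
    refine ⟨c * edge γ N k, c * edge γ N l, ε, hS _ ⟨k, rfl⟩, hS _ ⟨l, rfl⟩, hT.pos,
      fun s hs => ?_, fun s hs => ?_⟩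
    · simp only [hT.right s hs, mul_add, mul_smul_comm]
    · simp only [hT.left s hs, mul_sub, mul_smul_comm]

/-- The smooth Schoenflies theorem: every smooth embedded loop is the image of the unit circle
under a diffeomorphism of the plane. -/
theorem IsLoop.good {γ : ℝ → ℂ} (h : IsLoop γ) : Good γ := by
  obtain ⟨π, hπ, hg⟩ := h.exists_isPolyLoop
  obtain ⟨π₀, hπ₀, hg₀⟩ := isLoop_circ.exists_isPolyLoop
  exact hg.1 ((hπ.good'_iff hπ₀).2 (hg₀.2 good_circ))

theorem exists_global_solution {E : Type*} [NormedAddCommGroup E] [NormedSpace ℝ E]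
    [CompleteSpace E] {V : E → E} {K M : NNReal} (hV : LipschitzWith K V) (hM : ∀ x, ‖V x‖ ≤ M)
    (x : E) : ∃ α : ℝ → E, α 0 = x ∧ ∀ t, HasDerivAt α (V (α t)) t := by
  have hloc : ∀ n : ℕ, ∃ α : ℝ → E, α 0 = x ∧
      ∀ t ∈ Ioo (-(n : ℝ)) n, HasDerivAt α (V (α t)) t := by
    intro n
    have hpl : IsPicardLindelof (fun _ => V) (tmin := -(n : ℝ)) (tmax := n)
        ⟨0, by simp, by simp⟩ x (M * n) 0 M K :=
      { lipschitzOnWith := fun _ _ => hV.lipschitzOnWith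
        continuousOn := fun _ _ => continuousOn_const
        norm_le := fun _ _ y _ => hM y
        mul_max_le := by simp }
    obtain ⟨α, h1, h2⟩ := hpl.exists_eq_forall_mem_Icc_hasDerivWithinAt₀
    exact ⟨α, h1, fun t ht => (h2 t (Ioo_subset_Icc_self ht)).hasDerivAt (Icc_mem_nhds ht.1 ht.2)⟩
  choose α h0 hα using hloc
  have hle : ∀ m n : ℕ, m ≤ n → EqOn (α m) (α n) (Ioo (-(m : ℝ)) m) := by
    intro m n hmn t ht
    have hmn' : (m : ℝ) ≤ n := by exact_mod_cast hmn
    refine ODE_solution_unique_of_mem_Ioo (v := fun _ => V) (s := fun _ => univ) (K := K)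
      (t₀ := 0) (fun _ _ => hV.lipschitzOnWith) ⟨by linarith [ht.1, ht.2], by linarith [ht.1, ht.2]⟩
      (fun s hs => ⟨hα m s hs, trivial⟩)
      (fun s hs => ⟨hα n s ⟨by linarith [hs.1], by linarith [hs.2]⟩, trivial⟩)
      ((h0 m).trans (h0 n).symm) ht
  have heq : ∀ (m n : ℕ) (t : ℝ), |t| < m → |t| < n → α m t = α n t := fun m n t hm hn => by
    rcases le_total m n with h | h
    · exact hle m n h (abs_lt.1 hm)
    · exact (hle n m h (abs_lt.1 hn)).symm
  have hidx : ∀ t : ℝ, |t| < (⌈|t|⌉₊ + 1 : ℕ) := fun t => by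
    push_cast
    linarith [Nat.le_ceil |t|]
  refine ⟨fun t => α (⌈|t|⌉₊ + 1) t, h0 _, fun t => ?_⟩
  refine (hα (⌈|t|⌉₊ + 1) t (abs_lt.1 (hidx t))).congr_of_eventuallyEq ?_
  filter_upwards [continuous_abs.continuousAt.eventually (gt_mem_nhds (hidx t))] with s hs
  exact heq _ _ s (hidx s) hs

theorem contDiff_of_hasDerivAt {E : Type*} [NormedAddCommGroup E] [NormedSpace ℝ E] {V : E → E}
    (hV : ContDiff ℝ ∞ V) {α : ℝ → E} (hα : ∀ t, HasDerivAt α (V (α t)) t) : ContDiff ℝ ∞ α := by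
  have hd : deriv α = V ∘ α := funext fun t => (hα t).deriv
  refine contDiff_infty.2 fun n => ?_
  induction n with
  | zero => exact contDiff_zero.2 (continuous_iff_continuousAt.2 fun t => (hα t).continuousAt)
  | succ n ih =>
    rw [Nat.cast_succ]
    refine contDiff_succ_iff_deriv.2 ⟨fun t => (hα t).differentiableAt, ?_, ?_⟩
    · exact fun h => absurd h (by simp)
    · rw [hd]
      exact (hV.of_le (by exact_mod_cast le_top)).comp ih

/-- The tangential direction of the level curves of `g`, obtained from the differential of `g`. -/
noncomputable def rotGrad (L : ℂ →L[ℝ] ℝ) : ℂ := ⟨-L Complex.I, L 1⟩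

theorem clm_apply_eq (L : ℂ →L[ℝ] ℝ) (z : ℂ) : L z = z.re * L 1 + z.im * L Complex.I := by
  conv_lhs => rw [show z = z.re • (1 : ℂ) + z.im • Complex.I by simp [Complex.re_add_im]]
  rw [map_add, map_smul, map_smul, smul_eq_mul, smul_eq_mul]

theorem apply_rotGrad (L : ℂ →L[ℝ] ℝ) : L (rotGrad L) = 0 := by
  rw [clm_apply_eq, rotGrad]
  ring

theorem rotGrad_ne_zero {L : ℂ →L[ℝ] ℝ} (h : L ≠ 0) : rotGrad L ≠ 0 := fun h0 => h (by
  have h1 := congrArg Complex.re h0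
  have h2 := congrArg Complex.im h0
  simp only [rotGrad, Complex.zero_re, Complex.zero_im, neg_eq_zero] at h1 h2
  ext z
  rw [clm_apply_eq, h1, h2]
  simp)

theorem contDiff_rotGrad {g : ℂ → ℝ} (hg : ContDiff ℝ ∞ g) :
    ContDiff ℝ ∞ fun z => rotGrad (fderiv ℝ g z) := by
  have h : (fun z => rotGrad (fderiv ℝ g z)) = fun z =>
      (-fderiv ℝ g z Complex.I) • (1 : ℂ) + (fderiv ℝ g z 1) • Complex.I := by
    ext z
    apply Complex.ext <;> simp [rotGrad]
  rw [h]
  have h' : ContDiff ℝ ∞ (fderiv ℝ g) := hg.fderiv_right (by simp)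
  exact ((h'.clm_apply contDiff_const).neg.smul contDiff_const).add
    ((h'.clm_apply contDiff_const).smul contDiff_const)

/-- A flow whose orbits in `Z` are regular curves, open in `Z`. -/
structure LevelFlow (Z : Set ℂ) (Φ : ℂ → ℝ → ℂ) : Prop where
  zero : ∀ x, Φ x 0 = x
  add : ∀ x s t, Φ (Φ x s) t = Φ x (s + t)
  smooth : ∀ x, ContDiff ℝ ∞ (Φ x)
  mem : ∀ x ∈ Z, ∀ t, Φ x t ∈ Z
  deriv_ne : ∀ x ∈ Z, ∀ t, deriv (Φ x) t ≠ 0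
  nhds : ∀ x ∈ Z, ∀ δ > 0, Φ x '' Ioo (-δ) δ ∈ 𝓝[Z] x

theorem exists_levelFlow {g : ℂ → ℝ} (hg : ContDiff ℝ ∞ g) {c : ℝ} (hZ : IsCompact (g ⁻¹' {c}))
    (hreg : ∀ x, g x = c → fderiv ℝ g x ≠ 0) : ∃ Φ, LevelFlow (g ⁻¹' {c}) Φ := by
  obtain ⟨χ, hχ, hχ1, hχ0, -⟩ := exists_cutoff hZ.isClosed (Metric.isOpen_thickening (δ := 1)
    (E := g ⁻¹' {c})) (Metric.self_subset_thickening one_pos _)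
  have hχc : HasCompactSupport χ := by
    refine HasCompactSupport.intro (hZ.isBounded.cthickening (δ := 1)).isCompact_closure
      fun x hx => (hχ0 x fun h => hx ?_).self_of_nhds
    exact subset_closure (Metric.thickening_subset_cthickening _ _ h)
  have hχZ : ∀ x, g x = c → χ x = 1 := fun x hx => hχ1.self_of_nhdsSet x hx
  set V : ℂ → ℂ := fun z => χ z • rotGrad (fderiv ℝ g z) with hV
  have hVs : ContDiff ℝ ∞ V := hχ.smul (contDiff_rotGrad hg)
  have hVc : HasCompactSupport V := hχc.smul_right
  obtain ⟨K, hK⟩ := hVs.lipschitzWith_of_hasCompactSupport hVc (by simp)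
  obtain ⟨M, hM⟩ := hVc.exists_bound_of_continuous hVs.continuous
  choose Φ h0 hΦ using exists_global_solution (M := M.toNNReal) hK
    fun x => (hM x).trans (Real.le_coe_toNNReal M)
  have hadd : ∀ x s t, Φ (Φ x s) t = Φ x (s + t) := fun x s => congrFun <|
    ODE_solution_unique_univ (v := fun _ => V) (s := fun _ => univ) (K := K) (t₀ := 0)
      (fun _ => hK.lipschitzOnWith) (fun t => ⟨hΦ _ t, trivial⟩)
      (fun t => ⟨(hΦ x (s + t)).comp_const_add s t, trivial⟩) (by rw [h0, add_zero])
  have hmem : ∀ x t, g (Φ x t) = g x := by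
    intro x t
    have hd : ∀ t, HasDerivAt (fun t => g (Φ x t)) 0 t := fun t => by
      have := (hg.differentiable (by simp) (Φ x t)).hasFDerivAt.comp_hasDerivAt t (hΦ x t)
      rwa [hV, map_smul, apply_rotGrad, smul_zero] at this
    have := is_const_of_deriv_eq_zero (fun t => (hd t).differentiableAt) (fun t => (hd t).deriv) t 0
    rwa [h0] at this
  have hZV : ∀ x, g x = c → V x = rotGrad (fderiv ℝ g x) := fun x hx => by
    rw [hV]
    simp only [hχZ x hx, one_smul]
  have hsm : ∀ x, ContDiff ℝ ∞ (Φ x) := fun x => contDiff_of_hasDerivAt hVs (hΦ x)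
  refine ⟨Φ, h0, hadd, hsm, fun x hx t => (hmem x t).trans hx, fun x hx t => ?_, fun x hx δ hδ => ?_⟩
  · have hc : g (Φ x t) = c := (hmem x t).trans hx
    rw [(hΦ x t).deriv, hZV _ hc]
    exact rotGrad_ne_zero (hreg _ hc)
  have hx : g x = c := hx
  set u := rotGrad (fderiv ℝ g x) with hu
  have hu0 : u ≠ 0 := rotGrad_ne_zero (hreg x hx)
  have hP : ContDiff ℝ ∞ fun z => (innerSL ℝ u z, g z) := (innerSL ℝ u).contDiff.prodMk hg
  have hP' : Injective (fderiv ℝ (fun z => (innerSL ℝ u z, g z)) x) := by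
    have hd := (innerSL ℝ u).hasFDerivAt.prodMk (hg.differentiable (by simp) x).hasFDerivAt
    rw [hd.fderiv, injective_iff_map_eq_zero]
    intro z hz
    have h1 : innerSL ℝ u z = 0 := congrArg Prod.fst hz
    have h2 : fderiv ℝ g x z = 0 := congrArg Prod.snd hz
    have hsq : fderiv ℝ g x 1 ^ 2 + fderiv ℝ g x Complex.I ^ 2 ≠ 0 := fun h => hu0 (by
      have h3 : fderiv ℝ g x 1 = 0 := by nlinarith
      have h4 : fderiv ℝ g x Complex.I = 0 := by nlinarith
      rw [hu, rotGrad, h3, h4]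
      simp [Complex.ext_iff])
    have h1' : -fderiv ℝ g x Complex.I * z.re + fderiv ℝ g x 1 * z.im = 0 := by
      rw [innerSL_apply_apply, Complex.inner, hu, rotGrad] at h1
      simpa [mul_comm] using h1
    have h2' : z.re * fderiv ℝ g x 1 + z.im * fderiv ℝ g x Complex.I = 0 := by
      rw [← clm_apply_eq]
      exact h2
    have h3 : z.re * (fderiv ℝ g x 1 ^ 2 + fderiv ℝ g x Complex.I ^ 2) = 0 := by
      linear_combination fderiv ℝ g x 1 * h2' - fderiv ℝ g x Complex.I * h1'
    have h4 : z.im * (fderiv ℝ g x 1 ^ 2 + fderiv ℝ g x Complex.I ^ 2) = 0 := by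
      linear_combination fderiv ℝ g x Complex.I * h2' + fderiv ℝ g x 1 * h1'
    exact Complex.ext ((mul_eq_zero.1 h3).resolve_right hsq) ((mul_eq_zero.1 h4).resolve_right hsq)
  obtain ⟨θ, -, hθ⟩ := exists_contDiff_leftInverse hP hP'
  have hq : HasStrictDerivAt (fun t => innerSL ℝ u (Φ x t)) (innerSL ℝ u u) 0 := by
    have h1 : HasStrictDerivAt (Φ x) u 0 := by
      have := (hsm x).contDiffAt.hasStrictDerivAt (x := 0) (by simp)
      rwa [(hΦ x 0).deriv, h0, hZV x hx] at this
    exact (innerSL ℝ u).hasStrictFDerivAt.comp_hasStrictDerivAt 0 h1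
  have hmap := hq.map_nhds_eq (by
    rw [innerSL_apply_apply, real_inner_self_eq_norm_sq]
    exact pow_ne_zero 2 (norm_ne_zero_iff.2 hu0))
  have hT : Ioo (-δ) δ ∩ {t | θ (innerSL ℝ u (Φ x t), g (Φ x t)) = Φ x t} ∈ 𝓝 (0 : ℝ) := by
    refine inter_mem (Ioo_mem_nhds (by linarith) hδ) ?_
    have hc : Tendsto (Φ x) (𝓝 0) (𝓝 x) := by
      simpa [h0] using (hsm x).continuous.tendsto 0
    exact hc.eventually hθ
  have himg := image_mem_map (m := fun t => innerSL ℝ u (Φ x t)) hT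
  rw [hmap, h0] at himg
  have hcq : Tendsto (innerSL ℝ u) (𝓝 x) (𝓝 (innerSL ℝ u x)) := (innerSL ℝ u).continuous.tendsto x
  filter_upwards [self_mem_nhdsWithin, mem_nhdsWithin_of_mem_nhds hθ,
    mem_nhdsWithin_of_mem_nhds (hcq himg)] with z hz1 hz2 hz3
  obtain ⟨t, ⟨ht1, ht2⟩, ht3⟩ := hz3
  have hz1 : g z = c := hz1
  refine ⟨t, ht1, ?_⟩
  rw [← ht2, ← hz2, hmem x t, hx, hz1, ← ht3]

namespace LevelFlow

variable {Z : Set ℂ} {Φ : ℂ → ℝ → ℂ}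

theorem mem_range_self (h : LevelFlow Z Φ) (x : ℂ) : x ∈ range (Φ x) := ⟨0, h.zero x⟩

theorem range_subset (h : LevelFlow Z Φ) {x : ℂ} (hx : x ∈ Z) : range (Φ x) ⊆ Z :=
  range_subset_iff.2 (h.mem x hx)

theorem range_eq (h : LevelFlow Z Φ) {x y : ℂ} (hy : y ∈ range (Φ x)) :
    range (Φ y) = range (Φ x) := by
  obtain ⟨s, rfl⟩ := hy
  ext z
  constructor
  · rintro ⟨t, rfl⟩
    exact ⟨s + t, (h.add x s t).symm⟩
  · rintro ⟨t, rfl⟩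
    exact ⟨t - s, by rw [h.add, add_sub_cancel]⟩

theorem range_eq_or_disjoint (h : LevelFlow Z Φ) (x y : ℂ) :
    range (Φ x) = range (Φ y) ∨ Disjoint (range (Φ x)) (range (Φ y)) := by
  by_cases hd : Disjoint (range (Φ x)) (range (Φ y))
  · exact Or.inr hd
  · obtain ⟨z, hzx, hzy⟩ := not_disjoint_iff.1 hd
    exact Or.inl ((h.range_eq hzx).symm.trans (h.range_eq hzy))

theorem range_mem_nhdsWithin (h : LevelFlow Z Φ) {x : ℂ} (hx : x ∈ Z) : range (Φ x) ∈ 𝓝[Z] x :=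
  mem_of_superset (h.nhds x hx 1 one_pos) (image_subset_range _ _)

theorem isCompact_range (h : LevelFlow Z Φ) (hZ : IsCompact Z) {x : ℂ} (hx : x ∈ Z) :
    IsCompact (range (Φ x)) := by
  refine hZ.of_isClosed_subset (isClosed_of_closure_subset fun y hy => ?_) (h.range_subset hx)
  have hyZ : y ∈ Z := closure_minimal (h.range_subset hx) hZ.isClosed hy
  obtain ⟨u, hu, hyu, hus⟩ := mem_nhdsWithin.1 (h.range_mem_nhdsWithin hyZ)
  obtain ⟨z, hzu, hzx⟩ := mem_closure_iff.1 hy u hu hyu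
  have hzy := hus ⟨hzu, h.range_subset hx hzx⟩
  rw [← h.range_eq hzx, h.range_eq hzy]
  exact h.mem_range_self y

theorem image_Ioo_mem_nhdsWithin (h : LevelFlow Z Φ) {x : ℂ} (hx : x ∈ Z) {a b t : ℝ}
    (ht : t ∈ Ioo a b) : Φ x '' Ioo a b ∈ 𝓝[Z] (Φ x t) := by
  have hδ : 0 < min (t - a) (b - t) := lt_min (by linarith [ht.1]) (by linarith [ht.2])
  refine mem_of_superset (h.nhds _ (h.mem x hx t) _ hδ) ?_
  rintro _ ⟨s, hs, rfl⟩
  refine ⟨t + s, ⟨?_, ?_⟩, (h.add x t s).symm⟩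
  · linarith [hs.1, min_le_left (t - a) (b - t)]
  · linarith [hs.2, min_le_right (t - a) (b - t)]

theorem exists_period (h : LevelFlow Z Φ) (hZ : IsCompact Z) {x : ℂ} (hx : x ∈ Z) :
    ∃ T ≠ 0, Φ x T = x := by
  have hc := h.isCompact_range hZ hx
  have hn : ∀ y ∈ range (Φ x), ∃ n : ℕ, Φ x '' Ioo (-(n : ℝ)) n ∈ 𝓝[range (Φ x)] y := by
    rintro _ ⟨t, rfl⟩
    obtain ⟨n, hn⟩ := exists_nat_gt |t|
    exact ⟨n, nhdsWithin_mono _ (h.range_subset hx) (h.image_Ioo_mem_nhdsWithin hx (abs_lt.1 hn))⟩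
  choose! n hn using hn
  obtain ⟨S, -, hS⟩ := hc.elim_nhdsWithin_subcover _ hn
  obtain ⟨N, hN⟩ : ∃ N, ∀ y ∈ S, n y ≤ N := ⟨S.sup n, fun y hy => Finset.le_sup hy⟩
  obtain ⟨y, hyS, hy⟩ := mem_iUnion₂.1 (hS ⟨(N : ℝ), rfl⟩)
  obtain ⟨s, hs, hsN⟩ := hy
  have hyN : ((n y : ℕ) : ℝ) ≤ N := by exact_mod_cast hN y hyS
  refine ⟨N - s, by linarith [hs.2] |> fun h : (0 : ℝ) < N - s => h.ne', ?_⟩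
  rw [sub_eq_add_neg, ← h.add, ← hsN, h.add, add_neg_cancel, h.zero]

/-- The periods of an orbit. -/
def periods (h : LevelFlow Z Φ) (x : ℂ) : AddSubgroup ℝ where
  carrier := {T | Φ x T = x}
  zero_mem' := h.zero x
  add_mem' {s t} hs ht := by
    rw [mem_ofPred_eq] at hs ht ⊢
    rw [← h.add, hs, ht]
  neg_mem' {s} hs := by
    rw [mem_ofPred_eq] at hs ⊢
    conv_lhs => rw [← hs]
    rw [h.add, add_neg_cancel, h.zero]

theorem mem_periods (h : LevelFlow Z Φ) {x : ℂ} {T : ℝ} : T ∈ h.periods x ↔ Φ x T = x := Iff.rfl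

theorem eq_iff (h : LevelFlow Z Φ) {x : ℂ} {s t : ℝ} :
    Φ x s = Φ x t ↔ t - s ∈ h.periods x := by
  rw [mem_periods, sub_eq_add_neg, ← h.add]
  constructor
  · intro e
    rw [← e, h.add, add_neg_cancel, h.zero]
  · intro e
    conv_lhs => rw [← e]
    rw [h.add, h.add]
    simp

theorem exists_isLoop (h : LevelFlow Z Φ) (hZ : IsCompact Z) {x : ℂ} (hx : x ∈ Z) :
    ∃ γ, IsLoop γ ∧ range γ = range (Φ x) := by
  obtain ⟨T, hT⟩ : ∃ T, h.periods x = AddSubgroup.closure {T} := by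
    refine (AddSubgroup.dense_or_cyclic (h.periods x)).resolve_left fun hd => ?_
    have hcl : IsClosed (h.periods x : Set ℝ) :=
      isClosed_eq (h.smooth x).continuous continuous_const
    have huniv := hd.closure_eq
    rw [hcl.closure_eq] at huniv
    have hconst : Φ x = fun _ => x := funext fun t => by
      have : t ∈ (h.periods x : Set ℝ) := huniv ▸ mem_univ t
      exact this
    refine h.deriv_ne x hx 0 ?_
    rw [hconst, deriv_const]
  have hmem : ∀ t, t ∈ h.periods x ↔ ∃ k : ℤ, k * T = t := fun t => by
    rw [hT, AddSubgroup.mem_closure_singleton]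
    simp
  have hT0 : T ≠ 0 := by
    rintro rfl
    obtain ⟨T, hT, hT'⟩ := h.exists_period hZ hx
    obtain ⟨k, hk⟩ := (hmem T).1 hT'
    exact hT (by rw [← hk, mul_zero])
  refine ⟨fun s => Φ x (T * s), ⟨?_, ?_, ?_, ?_⟩, ?_⟩
  · exact (h.smooth x).comp (contDiff_const.mul contDiff_id)
  · intro s
    exact (h.eq_iff.2 ((hmem _).2 ⟨1, by push_cast; ring⟩)).symm
  · intro s hs
    have hd : HasDerivAt (fun s => Φ x (T * s)) (T • deriv (Φ x) (T * s)) s := by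
      have h1 : HasDerivAt (fun s : ℝ => T * s) T s := by
        simpa using (hasDerivAt_id s).const_mul T
      exact ((h.smooth x).differentiable (by simp) (T * s)).hasDerivAt.scomp s h1
    rw [hd.deriv] at hs
    exact (smul_ne_zero hT0 (h.deriv_ne x hx _)) hs
  · intro s t hst
    obtain ⟨k, hk⟩ := (hmem _).1 (h.eq_iff.1 hst)
    refine ⟨k, mul_left_cancel₀ hT0 ?_⟩
    linarith
  · ext y
    constructor
    · rintro ⟨s, rfl⟩
      exact ⟨_, rfl⟩
    · rintro ⟨t, rfl⟩
      exact ⟨t / T, by simp only [mul_div_cancel₀ t hT0]⟩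

theorem exists_loops (h : LevelFlow Z Φ) (hZ : IsCompact Z) :
    ∃ (ι : Type) (_ : Finite ι) (γ : ι → ℝ → ℂ), (∀ i, IsLoop (γ i)) ∧
      (⋃ i, range (γ i)) = Z ∧ Pairwise (Disjoint on fun i => range (γ i)) := by
  obtain ⟨S, hSZ, hS⟩ := hZ.elim_nhdsWithin_subcover (fun x => range (Φ x))
    fun x hx => h.range_mem_nhdsWithin hx
  set O : Set (Set ℂ) := (fun x => range (Φ x)) '' (S : Set ℂ) with hO
  have hfin : O.Finite := S.finite_toSet.image _
  have hloop : ∀ o : O, ∃ γ, IsLoop γ ∧ range γ = o := by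
    rintro ⟨_, x, hx, rfl⟩
    exact h.exists_isLoop hZ (hSZ x hx)
  choose γ hγ hr using hloop
  refine ⟨O, hfin.to_subtype, γ, hγ, ?_, ?_⟩
  · simp only [hr]
    refine Subset.antisymm (iUnion_subset ?_) fun z hz => ?_
    · rintro ⟨_, x, hx, rfl⟩
      exact h.range_subset (hSZ x hx)
    · obtain ⟨x, hx, hzx⟩ := mem_iUnion₂.1 (hS hz)
      exact mem_iUnion.2 ⟨⟨_, x, hx, rfl⟩, hzx⟩
  · rintro ⟨_, x, hx, rfl⟩ ⟨_, y, hy, rfl⟩ hne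
    simp only [onFun, hr]
    exact (h.range_eq_or_disjoint x y).resolve_left fun he => hne (Subtype.ext he)

end LevelFlow

/-- A compact regular level set in the plane is a finite disjoint union of smooth loops. -/
theorem exists_loops_of_regular_level {g : ℂ → ℝ} (hg : ContDiff ℝ ∞ g) {c : ℝ}
    (hZ : IsCompact (g ⁻¹' {c})) (hreg : ∀ x, g x = c → fderiv ℝ g x ≠ 0) :
    ∃ (ι : Type) (_ : Finite ι) (γ : ι → ℝ → ℂ), (∀ i, IsLoop (γ i)) ∧
      (⋃ i, range (γ i)) = g ⁻¹' {c} ∧ Pairwise (Disjoint on fun i => range (γ i)) := by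
  obtain ⟨Φ, hΦ⟩ := exists_levelFlow hg hZ hreg
  exact hΦ.exists_loops hZ

section

open MeasureTheory Convolution

theorem contDiff_integral_Icc {P F : Type*} [NormedAddCommGroup P] [NormedSpace ℝ P]
    [NormedAddCommGroup F] [NormedSpace ℝ F] [CompleteSpace F] {G : P × ℝ → F}
    (hG : ContDiff ℝ ∞ G) : ContDiff ℝ ∞ fun p => ∫ t in (0 : ℝ)..1, G (p, t) := by
  obtain ⟨χ, hχ, hχ1, hχ0, -⟩ := exists_cutoff (isClosed_Icc (a := (0 : ℝ)) (b := 1))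
    (isOpen_Ioo (a := (-1 : ℝ)) (b := 2)) (Icc_subset_Ioo (by norm_num) (by norm_num))
  set φ : ℝ → ℝ := indicator (Icc (-1) 0) fun _ => 1 with hφ
  have hφi : LocallyIntegrable φ volume :=
    ((integrable_indicator_iff measurableSet_Icc).2
      (integrableOn_const (by simp) (by simp))).locallyIntegrable
  have h := contDiffOn_convolution_right_with_param_comp (n := (⊤ : ℕ∞))
    (ContinuousLinearMap.lsmul ℝ ℝ : ℝ →L[ℝ] F →L[ℝ] F) (s := (univ : Set P))
    (v := fun _ => (0 : ℝ)) (μ := volume) contDiffOn_const (f := φ)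
    (g := fun p t => χ t • G (p, t)) (k := Icc (-1) 2) isOpen_univ isCompact_Icc
    (fun p t _ ht => by
      rw [(hχ0 t fun h => ht (Ioo_subset_Icc_self h)).self_of_nhds, zero_smul])
    hφi ((hχ.comp contDiff_snd).smul hG).contDiffOn
  convert contDiffOn_univ.1 h using 2 with p
  rw [convolution_def]
  have e : (fun t => (ContinuousLinearMap.lsmul ℝ ℝ : ℝ →L[ℝ] F →L[ℝ] F) (φ t)
      (χ (0 - t) • G (p, 0 - t))) = indicator (Icc (-1) 0) fun t => G (p, -t) := by
    ext t
    by_cases ht : t ∈ Icc (-1 : ℝ) 0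
    · have h1 : χ (-t) = 1 := hχ1.self_of_nhdsSet _ ⟨by linarith [ht.2], by linarith [ht.1]⟩
      simp [hφ, ht, h1]
    · simp [hφ, ht]
  rw [e, integral_indicator measurableSet_Icc, integral_Icc_eq_integral_Ioc,
    ← intervalIntegral.integral_of_le (by norm_num), intervalIntegral.integral_comp_neg
      fun t => G (p, t)]
  simp

/-- Hadamard's lemma. -/
theorem exists_contDiff_smul {P F : Type*} [NormedAddCommGroup P] [NormedSpace ℝ P]
    [NormedAddCommGroup F] [NormedSpace ℝ F] [CompleteSpace F] {u : P × ℝ → F}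
    (hu : ContDiff ℝ ∞ u) (h0 : ∀ p, u (p, 0) = 0) :
    ∃ v : P × ℝ → F, ContDiff ℝ ∞ v ∧ ∀ p τ, u (p, τ) = τ • v (p, τ) := by
  have hd : ContDiff ℝ ∞ fun q : P × ℝ => fderiv ℝ u q (0, 1) :=
    (hu.fderiv_right (by simp)).clm_apply contDiff_const
  refine ⟨fun q => ∫ t in (0 : ℝ)..1, fderiv ℝ u (q.1, t * q.2) (0, 1),
    contDiff_integral_Icc (G := fun x : (P × ℝ) × ℝ => fderiv ℝ u (x.1.1, x.2 * x.1.2) (0, 1))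
      (hd.comp (g := fun q : P × ℝ => fderiv ℝ u q (0, 1)) (by fun_prop)), fun p τ => ?_⟩
  have hder : ∀ t : ℝ, HasDerivAt (fun t : ℝ => u (p, t * τ))
      (τ • fderiv ℝ u (p, t * τ) (0, 1)) t := fun t => by
    have h1 : HasDerivAt (fun t : ℝ => (p, t * τ)) ((0 : P), τ) t :=
      (hasDerivAt_const t p).prodMk (by simpa using (hasDerivAt_id t).mul_const τ)
    have h2 := (hu.differentiable (by simp) (p, t * τ)).hasFDerivAt.comp_hasDerivAt t h1
    rw [← map_smul]
    simpa [comp_def] using h2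
  have hc : Continuous fun t : ℝ => τ • fderiv ℝ u (p, t * τ) (0, 1) :=
    (hd.continuous.comp (by fun_prop : Continuous fun t : ℝ => (p, t * τ))).const_smul τ
  have := intervalIntegral.integral_eq_sub_of_hasDerivAt (fun t _ => hder t)
    (hc.intervalIntegrable 0 1)
  simp only [one_mul, zero_mul, h0, sub_zero] at this
  rw [← this, intervalIntegral.integral_smul]

end

section

variable {E : Type*} [NormedAddCommGroup E] [InnerProductSpace ℝ E] [CompleteSpace E]

/-- A smooth map vanishing on the unit circle is divisible by `‖x‖ ^ 2 - 1` near it. -/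
theorem exists_contDiff_quotient {m : ℂ → E} (hm : ContDiff ℝ ∞ m) (h0 : ∀ x, ‖x‖ = 1 → m x = 0) :
    ∃ n : ℂ → E, ContDiff ℝ ∞ n ∧
      ∀ᶠ x in 𝓝ˢ (Metric.sphere (0 : ℂ) 1), m x = (‖x‖ ^ 2 - 1) • n x := by
  have hU : IsOpen ({0}ᶜ : Set ℂ) := isOpen_compl_singleton
  have hnorm : ContDiffOn ℝ ∞ (fun x : ℂ => ‖x‖) {0}ᶜ := fun x hx =>
    (contDiffAt_norm ℝ hx).contDiffWithinAt
  obtain ⟨χ, hχ, hχ1, hχ0, -⟩ := exists_cutoff (Metric.isClosed_sphere (x := (0 : ℂ)) (ε := 1)) hU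
    fun x hx h => by
      rw [mem_singleton_iff] at h
      simp [h] at hx
  have hπ : ContDiff ℝ ∞ fun x : ℂ => χ x • (‖x‖⁻¹ • x) :=
    ContDiffOn.cutoff_smul hU hχ hχ0
      ((hnorm.inv fun x hx => norm_ne_zero_iff.2 hx).smul contDiffOn_id)
  set π : ℂ → ℂ := fun x => χ x • (‖x‖⁻¹ • x) with hπdef
  obtain ⟨v, hv, huv⟩ := exists_contDiff_smul
    (u := fun q : ℂ × ℝ => m ((1 + q.2) • π q.1) - m (π q.1))
    ((hm.comp ((contDiff_const.add contDiff_snd).smul (hπ.comp contDiff_fst))).sub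
      (hm.comp (hπ.comp contDiff_fst))) (by simp)
  have hn : ContDiff ℝ ∞ fun x : ℂ => χ x • ((‖x‖ + 1)⁻¹ • v (x, ‖x‖ - 1)) := by
    refine ContDiffOn.cutoff_smul hU hχ hχ0 (((hnorm.add contDiffOn_const).inv fun x _ => ?_).smul
      (hv.comp_contDiffOn (contDiffOn_id.prodMk (hnorm.sub contDiffOn_const))))
    positivity
  refine ⟨_, hn, ?_⟩
  have hne : ∀ᶠ x : ℂ in 𝓝ˢ (Metric.sphere (0 : ℂ) 1), x ≠ 0 :=
    hU.mem_nhdsSet.2 fun x hx h => by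
      rw [mem_singleton_iff] at h
      simp [h] at hx
  filter_upwards [hχ1, hne] with x hx1 hx0
  have hx0' : ‖x‖ ≠ 0 := norm_ne_zero_iff.2 hx0
  have hπx : π x = ‖x‖⁻¹ • x := by rw [hπdef]; simp only [hx1, one_smul]
  have h1 : m (π x) = 0 := h0 _ (by rw [hπx, norm_smul, norm_inv, norm_norm, inv_mul_cancel₀ hx0'])
  have h2 : (1 + (‖x‖ - 1)) • π x = x := by
    rw [hπx, smul_smul, add_sub_cancel, mul_inv_cancel₀ hx0', one_smul]
  have h3 := huv x (‖x‖ - 1)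
  simp only [h1, h2, sub_zero] at h3
  have h4 : ‖x‖ + 1 ≠ 0 := by positivity
  rw [h3, hx1, one_smul, smul_smul]
  congr 1
  field_simp
  ring

theorem exists_transverse_field {ψ f N : ℂ → E} (hψ : ContDiff ℝ ∞ ψ) (hf : ContDiff ℝ ∞ f)
    (hN : ContDiff ℝ ∞ N) (hN0 : ∀ x, N x ≠ 0)
    (hNf : ∀ x y, inner ℝ (N x) y = 0 ↔ y ∈ range (fderiv ℝ f x))
    (hon : ∀ x, ‖x‖ = 1 → ψ x = f x)
    (htr : ∀ x, ‖x‖ = 1 → ∃ v, fderiv ℝ ψ x v ∉ range (fderiv ℝ f x)) :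
    ∃ n : ℂ → E, ContDiff ℝ ∞ n ∧ (∀ x, inner ℝ (N x) (n x) ≠ 0) ∧
      ∀ᶠ x in 𝓝ˢ (Metric.sphere (0 : ℂ) 1), ψ x = f x + (‖x‖ ^ 2 - 1) • n x := by
  obtain ⟨n, hn, hnψ⟩ := exists_contDiff_quotient (hψ.sub hf) fun x hx => sub_eq_zero.2 (hon x hx)
  have hnψ' : ∀ᶠ x in 𝓝ˢ (Metric.sphere (0 : ℂ) 1), ψ x = f x + (‖x‖ ^ 2 - 1) • n x :=
    hnψ.mono fun x hx => by rw [← hx, add_sub_cancel]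
  have hin : Continuous fun x => inner ℝ (N x) (n x) := hN.continuous.inner hn.continuous
  have hne : ∀ x ∈ Metric.sphere (0 : ℂ) 1, inner ℝ (N x) (n x) ≠ 0 := by
    intro x hx h0
    have hx1 : ‖x‖ = 1 := by simpa using hx
    obtain ⟨v, hv⟩ := htr x hx1
    refine hv ((hNf x _).1 ?_)
    have hd : HasFDerivAt (fun x : ℂ => f x + (‖x‖ ^ 2 - 1) • n x)
        (fderiv ℝ f x + ((‖x‖ ^ 2 - 1) • fderiv ℝ n x +
          (fderiv ℝ (fun x : ℂ => ‖x‖ ^ 2 - 1) x).smulRight (n x))) x :=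
      (hf.differentiable (by simp) x).hasFDerivAt.add
        (((contDiff_norm_sq ℝ).sub contDiff_const).differentiable
          (n := ∞) (by simp) x |>.hasFDerivAt.smul (hn.differentiable (by simp) x).hasFDerivAt)
    have he : ψ =ᶠ[𝓝 x] fun x : ℂ => f x + (‖x‖ ^ 2 - 1) • n x :=
      hnψ'.filter_mono (nhds_le_nhdsSet hx)
    rw [he.fderiv_eq, hd.fderiv]
    simp only [hx1, one_pow, sub_self, zero_smul, zero_add, _root_.add_apply,
      ContinuousLinearMap.smulRight_apply, inner_add_right, inner_smul_right, h0, mul_zero,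
      add_zero]
    exact (hNf x _).2 ⟨v, rfl⟩
  obtain ⟨σ, hσ⟩ : ∃ σ : ℝ, σ ≠ 0 ∧
      ∀ x ∈ Metric.sphere (0 : ℂ) 1, 0 < σ * inner ℝ (N x) (n x) := by
    have hpre : IsPreconnected (Metric.sphere (0 : ℂ) 1) :=
      isPreconnected_sphere (by rw [Complex.rank_real_complex]; norm_num) 0 1
    by_cases hex : ∃ x ∈ Metric.sphere (0 : ℂ) 1, 0 < inner ℝ (N x) (n x)
    · obtain ⟨x₀, hx₀, hpos⟩ := hex
      refine ⟨1, one_ne_zero, fun x hx => ?_⟩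
      rw [one_mul]
      by_contra hle
      obtain ⟨y, hy, hy0⟩ := hpre.intermediate_value hx hx₀ hin.continuousOn
        ⟨not_lt.1 hle, hpos.le⟩
      exact hne y hy hy0
    · push Not at hex
      refine ⟨-1, by norm_num, fun x hx => ?_⟩
      have := lt_of_le_of_ne (hex x hx) (hne x hx)
      linarith
  obtain ⟨hσ0, hσ⟩ := hσ
  have hUo : IsOpen {x | 0 < σ * inner ℝ (N x) (n x)} :=
    isOpen_lt continuous_const (hin.const_mul σ)
  obtain ⟨χ, hχ, hχ1, hχ0, hχI⟩ := exists_cutoff Metric.isClosed_sphere hUo hσ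
  refine ⟨fun x => χ x • n x + (1 - χ x) • σ • N x, (hχ.smul hn).add
    ((contDiff_const.sub hχ).smul (contDiff_const.smul hN)), fun x h0 => ?_, ?_⟩
  · have hNN : 0 < inner ℝ (N x) (N x) := real_inner_self_pos.2 (hN0 x)
    have hpos : 0 < σ ^ 2 * inner ℝ (N x) (N x) := by positivity
    simp only [inner_add_right, inner_smul_right] at h0
    by_cases hx : 0 < σ * inner ℝ (N x) (n x)
    · have h1 : χ x * (σ * inner ℝ (N x) (n x)) + (1 - χ x) * (σ ^ 2 * inner ℝ (N x) (N x)) = 0 := by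
        linear_combination σ * h0
      rcases (hχI x).1.eq_or_lt with h2 | h2
      · rw [← h2] at h1
        linarith
      · nlinarith [mul_pos h2 hx, mul_nonneg (sub_nonneg.2 (hχI x).2) hpos.le]
    · have h2 : χ x = 0 := (hχ0 x hx).self_of_nhds
      rw [h2] at h0
      have : σ * inner ℝ (N x) (N x) = 0 := by linarith
      exact (mul_ne_zero hσ0 hNN.ne') this
  · filter_upwards [hnψ', hχ1] with x h1 h2
    simp only [h1, h2, one_smul, sub_self, zero_smul, add_zero]

end

theorem fderiv_injective_of_leftInverse {X F : Type*} [NormedAddCommGroup X] [NormedSpace ℝ X]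
    [NormedAddCommGroup F] [NormedSpace ℝ F] {T : X → F} {θ : F → X} {x : X}
    (hθ : DifferentiableAt ℝ θ (T x)) (hT : DifferentiableAt ℝ T x)
    (h : ∀ᶠ y in 𝓝 x, θ (T y) = y) : Injective (fderiv ℝ T x) := by
  have h1 := hθ.hasFDerivAt.comp x hT.hasFDerivAt
  have h2 := h1.unique ((hasFDerivAt_id x).congr_of_eventuallyEq h)
  intro v w hvw
  have h3 := congrArg (fun L => L v) h2
  have h4 := congrArg (fun L => L w) h2
  simp only [ContinuousLinearMap.comp_apply, ContinuousLinearMap.id_apply] at h3 h4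
  rw [← h3, ← h4, hvw]

/-- A smooth map that is injective and immersive on a compact set is so on a neighbourhood. -/
theorem exists_open_injOn {X F : Type*} [NormedAddCommGroup X] [NormedSpace ℝ X]
    [FiniteDimensional ℝ X] [NormedAddCommGroup F] [NormedSpace ℝ F] [FiniteDimensional ℝ F]
    {T : X → F} (hT : ContDiff ℝ ∞ T) {C : Set X} (hC : IsCompact C) (hinj : InjOn T C)
    (himm : ∀ x ∈ C, Injective (fderiv ℝ T x)) :
    ∃ U, IsOpen U ∧ C ⊆ U ∧ InjOn T U ∧ ∀ x ∈ U, Injective (fderiv ℝ T x) := by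
  have hloc : ∀ x ∈ C, ∃ θ : F → X, ContDiff ℝ ∞ θ ∧ ∀ᶠ y in 𝓝 x, θ (T y) = y :=
    fun x hx => exists_contDiff_leftInverse hT (himm x hx)
  obtain ⟨t, ht, hti⟩ := hinj.exists_mem_nhdsSet hC (fun x _ => hT.continuous.continuousAt)
    fun x hx => by
      obtain ⟨θ, -, h⟩ := hloc x hx
      exact ⟨_, h, fun y hy z hz hyz => by rw [← show θ (T y) = y from hy, hyz, show θ (T z) = z from hz]⟩
  have h' : ∀ᶠ x in 𝓝ˢ C, Injective (fderiv ℝ T x) := by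
    rw [eventually_nhdsSet_iff_forall]
    intro x hx
    obtain ⟨θ, hθ, h⟩ := hloc x hx
    filter_upwards [h.eventually_nhds] with y hy
    exact fderiv_injective_of_leftInverse (hθ.differentiable (by simp) _)
      (hT.differentiable (by simp) _) hy
  obtain ⟨U, hU, hCU, hUt⟩ := mem_nhdsSet_iff_exists.1 (inter_mem ht h')
  exact ⟨U, hU, hCU, hti.mono fun x hx => (hUt hx).1, fun x hx => (hUt hx).2⟩

theorem exists_collar {U : Set (ℂ × ℝ)} (hU : IsOpen U)
    (h : ∀ x : ℂ, ‖x‖ ≤ 1 → (x, (0 : ℝ)) ∈ U) :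
    ∃ δ > 0, ∀ (x : ℂ) (t : ℝ), ‖x‖ ^ 2 - 1 < δ → |t| < δ → (x, t) ∈ U := by
  obtain ⟨u, v, hu, hv, hCu, h0v, huv⟩ := generalized_tube_lemma
    (isCompact_closedBall (0 : ℂ) 1) (isCompact_singleton (x := (0 : ℝ))) hU (by
      rintro ⟨x, t⟩ ⟨hx, ht⟩
      obtain rfl : t = 0 := ht
      exact h x (by simpa using hx))
  obtain ⟨δ₁, hδ₁, h1⟩ := (isCompact_closedBall (0 : ℂ) 1).exists_thickening_subset_open hu hCu
  rw [thickening_closedBall hδ₁ zero_le_one] at h1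
  obtain ⟨δ₂, hδ₂, h2⟩ := Metric.isOpen_iff.1 hv 0 (h0v rfl)
  refine ⟨min δ₁ δ₂, lt_min hδ₁ hδ₂, fun x t hx ht => huv ⟨h1 ?_, h2 ?_⟩⟩
  · rw [mem_ball_zero_iff]
    have := min_le_left δ₁ δ₂
    nlinarith [norm_nonneg x]
  · rw [mem_ball_zero_iff, Real.norm_eq_abs]
    exact ht.trans_le (min_le_right _ _)

/-- A positive smooth function equal to the identity beyond `ε` and small before. -/
theorem exists_contDiff_pos {ε : ℝ} (hε : 0 < ε) : ∃ g : ℝ → ℝ, ContDiff ℝ ∞ g ∧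
    (∀ s, ε ≤ s → g s = s) ∧ (∀ s ≤ ε, 0 < g s ∧ g s ≤ ε) := by
  refine ⟨fun s => ε / 2 + Real.smoothTransition (2 * s / ε - 1) * (s - ε / 2),
    contDiff_const.add ((Real.smoothTransition.contDiff.comp (by fun_prop)).mul (by fun_prop)),
    fun s hs => ?_, fun s hs => ?_⟩
  · have : 1 ≤ 2 * s / ε - 1 := by
      rw [le_sub_iff_add_le, le_div_iff₀ hε]
      linarith
    simp only [Real.smoothTransition.one_of_one_le this]
    ring
  · rcases le_total s (ε / 2) with h | h
    · have : 2 * s / ε - 1 ≤ 0 := by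
        rw [sub_nonpos, div_le_one hε]
        linarith
      simp only [Real.smoothTransition.zero_of_nonpos this]
      constructor <;> linarith
    · have h0 := Real.smoothTransition.nonneg (2 * s / ε - 1)
      have h1 := Real.smoothTransition.le_one (2 * s / ε - 1)
      constructor
      · nlinarith
      · nlinarith

section

variable {E : Type*} [NormedAddCommGroup E] [InnerProductSpace ℝ E] [FiniteDimensional ℝ E]

theorem exists_surgery {ψ f N : ℂ → E} (hψ : ContDiff ℝ ∞ ψ) (hf : ContDiff ℝ ∞ f)
    (hfc : IsClosedEmbedding f) (hfi : ∀ x, Injective (fderiv ℝ f x))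
    (hN : ContDiff ℝ ∞ N) (hN0 : ∀ x, N x ≠ 0)
    (hNf : ∀ x y, inner ℝ (N x) y = 0 ↔ y ∈ range (fderiv ℝ f x))
    (hon : ∀ x, ‖x‖ = 1 → ψ x = f x)
    (htr : ∀ x, ‖x‖ = 1 → ∃ v, fderiv ℝ ψ x v ∉ range (fderiv ℝ f x))
    {P : Set ℂ} (hP : IsCompact P) (hinj : InjOn ψ P) (himm : ∀ x ∈ P, Injective (fderiv ℝ ψ x))
    (hcut : ∀ x ∈ P, ∀ y, ‖y‖ ≤ 1 → ψ x = f y → ‖x‖ = 1)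
    {W : Set E} (hW : IsClosed W) (hfW : ∀ y, ‖y‖ ≤ 1 → f y ∉ W) {ρ : ℝ} (hρ : 1 < ρ) :
    ∃ ψ' : ℂ → E, ContDiff ℝ ∞ ψ' ∧ (∀ x, ρ ≤ ‖x‖ → ∀ᶠ y in 𝓝 x, ψ' y = ψ y) ∧ InjOn ψ' P ∧
      (∀ x ∈ P, Injective (fderiv ℝ ψ' x)) ∧
      ∀ x ∈ P, (ψ' x = ψ x ∧ 1 < ‖x‖) ∨ (ψ' x ∉ W ∧ ψ' x ∉ range f) := by
  obtain ⟨n, hn, hnN, hnψ⟩ := exists_transverse_field hψ hf hN hN0 hNf hon htr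
  set T : ℂ × ℝ → E := fun q => f q.1 + q.2 • n q.1 with hTdef
  have hT : ContDiff ℝ ∞ T :=
    (hf.comp contDiff_fst).add (contDiff_snd.smul (hn.comp contDiff_fst))
  have hT0 : ∀ x, T (x, 0) = f x := fun x => by simp [hTdef]
  obtain ⟨U, hU, hCU, hUinj, hUimm⟩ := exists_open_injOn hT
    (C := Metric.closedBall (0 : ℂ) 1 ×ˢ {(0 : ℝ)})
    ((isCompact_closedBall _ _).prod isCompact_singleton)
    (by
      rintro ⟨x, t⟩ ⟨-, ht⟩ ⟨y, s⟩ ⟨-, hs⟩ hxy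
      obtain rfl : t = 0 := ht
      obtain rfl : s = 0 := hs
      rw [hT0, hT0] at hxy
      rw [hfc.injective hxy])
    (by
      rintro ⟨x, t⟩ ⟨-, ht⟩
      obtain rfl : t = 0 := ht
      have hd : HasFDerivAt T ((fderiv ℝ f x).comp (ContinuousLinearMap.fst ℝ ℂ ℝ) +
          ((0 : ℝ) • (fderiv ℝ n x).comp (ContinuousLinearMap.fst ℝ ℂ ℝ) +
            (ContinuousLinearMap.snd ℝ ℂ ℝ).smulRight (n x))) (x, 0) :=
        ((hf.differentiable (by simp) x).hasFDerivAt.comp (x, (0 : ℝ)) hasFDerivAt_fst).add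
          (hasFDerivAt_snd.smul
            ((hn.differentiable (by simp) x).hasFDerivAt.comp (x, (0 : ℝ)) hasFDerivAt_fst))
      rw [hd.fderiv, injective_iff_map_eq_zero]
      rintro ⟨v, τ⟩ hv
      simp only [zero_smul, zero_add, _root_.add_apply, ContinuousLinearMap.comp_apply,
        ContinuousLinearMap.smulRight_apply, ContinuousLinearMap.coe_fst',
        ContinuousLinearMap.coe_snd'] at hv
      have h1 := congrArg (inner ℝ (N x)) hv
      rw [inner_add_right, (hNf x _).2 ⟨v, rfl⟩, inner_smul_right, inner_zero_right, zero_add] at h1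
      have hτ : τ = 0 := (mul_eq_zero.1 h1).resolve_right (hnN x)
      rw [hτ, zero_smul, add_zero] at hv
      rw [hτ, (injective_iff_map_eq_zero _).1 (hfi x) v hv]
      rfl)
  obtain ⟨V, hV, hCV, hVn⟩ := mem_nhdsSet_iff_exists.1 hnψ
  obtain ⟨δ₀, hδ₀, hδ₀U⟩ := exists_collar
    (U := U ∩ Prod.fst ⁻¹' (V ∪ Metric.ball 0 1))
    (hU.inter ((hV.union Metric.isOpen_ball).preimage continuous_fst)) fun x hx => by
      refine ⟨hCU ⟨by simpa using hx, rfl⟩, ?_⟩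
      rcases hx.eq_or_lt with h | h
      · exact Or.inl (hCV (by simpa using h))
      · exact Or.inr (by simpa using h)
  set δ := min δ₀ (ρ - 1) with hδdef
  have hδ : 0 < δ := lt_min hδ₀ (by linarith)
  have hδU : ∀ (x : ℂ) (t : ℝ), ‖x‖ ^ 2 - 1 < δ → |t| < δ → (x, t) ∈ U := fun x t hx ht =>
    (hδ₀U x t (hx.trans_le (min_le_left _ _)) (ht.trans_le (min_le_left _ _))).1
  have hδψ : ∀ x : ℂ, 0 < ‖x‖ ^ 2 - 1 → ‖x‖ ^ 2 - 1 < δ → ψ x = T (x, ‖x‖ ^ 2 - 1) := by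
    intro x h0 hx
    refine hVn ((hδ₀U x 0 (hx.trans_le (min_le_left _ _)) (by simpa using hδ₀)).2.resolve_right
      fun h => ?_)
    rw [mem_ball_zero_iff] at h
    nlinarith [norm_nonneg x]
  have hsc : Continuous fun x : ℂ => ‖x‖ ^ 2 - 1 := by fun_prop
  set W' : Set E := W ∪ ψ '' (P ∩ {x | δ ≤ ‖x‖ ^ 2 - 1}) ∪ f '' {x | δ ≤ ‖x‖ ^ 2 - 1} with hW'def
  have hcl : IsClosed {x : ℂ | δ ≤ ‖x‖ ^ 2 - 1} := isClosed_le continuous_const hsc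
  have hW' : IsClosed W' := (hW.union
    ((hP.inter_right hcl).image hψ.continuous).isClosed).union (hfc.isClosedMap _ hcl)
  obtain ⟨ε₀, hε₀, hεW⟩ := exists_collar (U := T ⁻¹' W'ᶜ)
    (hW'.isOpen_compl.preimage hT.continuous) fun x hx => by
      rw [mem_preimage, hT0]
      rintro ((h | ⟨y, ⟨hyP, hy⟩, hxy⟩) | ⟨y, hy, hxy⟩)
      · exact hfW x hx h
      · rw [mem_ofPred_eq, hcut y hyP x hx hxy] at hy
        linarith
      · rw [hfc.injective hxy, mem_ofPred_eq] at hy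
        nlinarith [norm_nonneg x]
  obtain ⟨ε, hε, hεδ, hεε₀⟩ : ∃ ε > 0, ε < δ ∧ ε < ε₀ :=
    ⟨min δ ε₀ / 2, by positivity, by linarith [min_le_left δ ε₀, lt_min hδ hε₀],
      by linarith [min_le_right δ ε₀, lt_min hδ hε₀]⟩
  obtain ⟨g, hg, hg1, hg2⟩ := exists_contDiff_pos hε
  have hg3 : ∀ s < δ, 0 < g s ∧ g s < δ := fun s hs => by
    rcases le_total s ε with h | h
    · exact ⟨(hg2 s h).1, (hg2 s h).2.trans_lt hεδ⟩
    · rw [hg1 s h]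
      exact ⟨by linarith, hs⟩
  have hg4 : ∀ s < δ, |g s| < δ := fun s hs => by
    rw [abs_of_pos (hg3 s hs).1]
    exact (hg3 s hs).2
  set G : ℂ → ℂ × ℝ := fun x => (x, g (‖x‖ ^ 2 - 1)) with hGdef
  have hG : ContDiff ℝ ∞ G :=
    contDiff_id.prodMk (hg.comp ((contDiff_norm_sq ℝ).sub contDiff_const))
  set ψ' : ℂ → E := fun x => if ε ≤ ‖x‖ ^ 2 - 1 then ψ x else T (G x) with hψ'def
  have hψ1 : ∀ x : ℂ, ε ≤ ‖x‖ ^ 2 - 1 → ψ' x = ψ x := fun x hx => if_pos hx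
  have hψ2 : ∀ x : ℂ, ‖x‖ ^ 2 - 1 < δ → ψ' x = T (G x) := fun x hx => by
    by_cases h : ε ≤ ‖x‖ ^ 2 - 1
    · rw [hψ1 x h, hδψ x (by linarith) hx, hGdef]
      simp only [hg1 _ h]
    · exact if_neg h
  have hnear1 : ∀ x : ℂ, ε < ‖x‖ ^ 2 - 1 → ψ' =ᶠ[𝓝 x] ψ := fun x hx =>
    ((hsc.tendsto x).eventually (lt_mem_nhds hx)).mono fun y hy => hψ1 y (le_of_lt hy)
  have hnear2 : ∀ x : ℂ, ‖x‖ ^ 2 - 1 < δ → ψ' =ᶠ[𝓝 x] T ∘ G := fun x hx =>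
    ((hsc.tendsto x).eventually (gt_mem_nhds hx)).mono fun y hy => hψ2 y hy
  have hGU : ∀ x : ℂ, ‖x‖ ^ 2 - 1 < δ → G x ∈ U := fun x hx => hδU x _ hx (hg4 _ hx)
  have hmix : ∀ x y : ℂ, y ∈ P → ‖x‖ ^ 2 - 1 < ε → ε ≤ ‖y‖ ^ 2 - 1 → ψ' x = ψ' y → x = y := by
    intro x y hy hx hys hxy
    by_cases hyδ : ‖y‖ ^ 2 - 1 < δ
    · rw [hψ2 x (hx.trans hεδ), hψ2 y hyδ] at hxy
      exact congrArg Prod.fst (hUinj (hGU x (hx.trans hεδ)) (hGU y hyδ) hxy)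
    · rw [hψ2 x (hx.trans hεδ), hψ1 y hys] at hxy
      refine absurd (Or.inl (Or.inr ⟨y, ⟨hy, not_lt.1 hyδ⟩, hxy.symm⟩)) (hεW x
        (g (‖x‖ ^ 2 - 1)) (hx.trans hεε₀) ?_)
      rw [abs_of_pos (hg2 _ hx.le).1]
      exact (hg2 _ hx.le).2.trans_lt hεε₀
  refine ⟨ψ', ?_, fun x hx => hnear1 x ?_, ?_, ?_, ?_⟩
  · rw [contDiff_iff_contDiffAt]
    intro x
    rcases lt_or_ge (‖x‖ ^ 2 - 1) δ with h | h
    · exact (hT.comp hG).contDiffAt.congr_of_eventuallyEq (hnear2 x h)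
    · exact hψ.contDiffAt.congr_of_eventuallyEq (hnear1 x (hεδ.trans_le h))
  · have : δ ≤ ρ - 1 := min_le_right _ _
    nlinarith
  · intro x hx y hy hxy
    rcases lt_or_ge (‖x‖ ^ 2 - 1) ε with h | h <;> rcases lt_or_ge (‖y‖ ^ 2 - 1) ε with h' | h'
    · rw [hψ2 x (h.trans hεδ), hψ2 y (h'.trans hεδ)] at hxy
      exact congrArg Prod.fst (hUinj (hGU x (h.trans hεδ)) (hGU y (h'.trans hεδ)) hxy)
    · exact hmix x y hy h h' hxy
    · exact (hmix y x hx h' h hxy.symm).symm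
    · rw [hψ1 x h, hψ1 y h'] at hxy
      exact hinj hx hy hxy
  · intro x hx
    rcases lt_or_ge (‖x‖ ^ 2 - 1) δ with h | h
    · rw [(hnear2 x h).fderiv_eq, fderiv_comp x (hT.differentiable (by simp) _)
        (hG.differentiable (by simp) x)]
      exact (hUimm _ (hGU x h)).comp (fderiv_injective_of_leftInverse (θ := Prod.fst)
        differentiableAt_fst (hG.differentiable (by simp) x) (Eventually.of_forall fun _ => rfl))
    · rw [(hnear1 x (hεδ.trans_le h)).fderiv_eq]
      exact himm x hx
  · intro x hx
    rcases lt_or_ge (‖x‖ ^ 2 - 1) ε with h | h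
    · right
      have hb : |g (‖x‖ ^ 2 - 1)| < ε₀ := by
        rw [abs_of_pos (hg2 _ h.le).1]
        exact (hg2 _ h.le).2.trans_lt hεε₀
      have hnot := hεW x _ (h.trans hεε₀) hb
      rw [hψ2 x (h.trans hεδ)]
      refine ⟨fun hw => hnot (Or.inl (Or.inl hw)), ?_⟩
      rintro ⟨y, hy⟩
      by_cases hyδ : δ ≤ ‖y‖ ^ 2 - 1
      · exact hnot (Or.inr ⟨y, hyδ, hy⟩)
      · rw [← hT0] at hy
        have := hUinj (hδU y 0 (not_le.1 hyδ) (by simpa using hδ)) (hGU x (h.trans hεδ)) hy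
        exact (hg2 _ h.le).1.ne (congrArg Prod.snd this)
    · left
      refine ⟨hψ1 x h, ?_⟩
      nlinarith [norm_nonneg x]

end

theorem norm_circ (t : ℝ) : ‖circ t‖ = 1 := by
  rw [circ, show (2 * Real.pi * t * Complex.I : ℂ) = ((2 * Real.pi * t : ℝ) : ℂ) * Complex.I by
    push_cast; ring, Complex.norm_exp_ofReal_mul_I]

theorem exists_circ_eq {z : ℂ} (hz : ‖z‖ = 1) : ∃ t, circ t = z := by
  refine ⟨Complex.arg z / (2 * Real.pi), ?_⟩
  have h : (2 * Real.pi * (Complex.arg z / (2 * Real.pi) : ℝ) * Complex.I : ℂ)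
      = Complex.arg z * Complex.I := by
    push_cast
    field_simp
  rw [circ, h]
  simpa [hz] using Complex.norm_mul_exp_arg_mul_I z

theorem continuous_circ : Continuous circ := isLoop_circ.smooth.continuous

theorem isPreconnected_annulus {I : Set ℝ} (hI : IsPreconnected I) (h0 : ∀ r ∈ I, 0 < r) :
    IsPreconnected {z : ℂ | ‖z‖ ∈ I} := by
  have h : {z : ℂ | ‖z‖ ∈ I} = (fun q : ℝ × ℝ => q.1 • circ q.2) '' (I ×ˢ univ) := by
    ext z
    constructor
    · intro hz
      have hz0 : ‖z‖ ≠ 0 := (h0 _ hz).ne'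
      obtain ⟨t, ht⟩ := exists_circ_eq (z := ‖z‖⁻¹ • z) (by
        rw [norm_smul, norm_inv, norm_norm, inv_mul_cancel₀ hz0])
      exact ⟨(‖z‖, t), ⟨hz, trivial⟩, by simp only [ht, smul_smul, mul_inv_cancel₀ hz0, one_smul]⟩
    · rintro ⟨⟨r, t⟩, ⟨hr, -⟩, rfl⟩
      simpa [norm_smul, norm_circ, abs_of_pos (h0 r hr)] using hr
  rw [h]
  refine (hI.prod isPreconnected_univ).image _ (Continuous.continuousOn ?_)
  exact continuous_fst.smul (continuous_circ.comp continuous_snd)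

namespace PlaneDiffeo

theorem continuous_norm_symm (A : PlaneDiffeo) : Continuous fun z => ‖A.symm z‖ :=
  A.symm.continuous.norm

theorem range_comp_circ (A : PlaneDiffeo) : range (fun t => A (circ t)) = {z | ‖A.symm z‖ = 1} := by
  ext z
  constructor
  · rintro ⟨t, rfl⟩
    simp [norm_circ]
  · intro hz
    obtain ⟨t, ht⟩ := exists_circ_eq hz
    exact ⟨t, by simp [ht]⟩

theorem inside_or_outside (A : PlaneDiffeo) {S : Set ℂ} (hS : IsPreconnected S)
    (h : ∀ z ∈ S, ‖A.symm z‖ ≠ 1) : (∀ z ∈ S, ‖A.symm z‖ < 1) ∨ ∀ z ∈ S, 1 < ‖A.symm z‖ := by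
  by_contra hcon
  push Not at hcon
  obtain ⟨⟨z, hz, h1⟩, w, hw, h2⟩ := hcon
  obtain ⟨y, hy, hy1⟩ := hS.intermediate_value hw hz A.continuous_norm_symm.continuousOn ⟨h2, h1⟩
  exact h y hy hy1

theorem isBounded_disc (A : PlaneDiffeo) : Bornology.IsBounded {z | ‖A.symm z‖ ≤ 1} := by
  refine ((isCompact_closedBall (0 : ℂ) 1).image A.continuous).isBounded.subset fun z hz => ?_
  exact ⟨A.symm z, by simpa using hz, by simp⟩

/-- If the boundary of a disc lies inside another disc, so does the whole disc. -/
theorem inside_of_boundary_inside {A B : PlaneDiffeo}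
    (h : ∀ z, ‖A.symm z‖ = 1 → ‖B.symm z‖ < 1) {z : ℂ} (hz : ‖A.symm z‖ ≤ 1) :
    ‖B.symm z‖ < 1 := by
  have hS : IsPreconnected (B '' {w : ℂ | ‖w‖ ∈ Ici (1 : ℝ)}) :=
    (isPreconnected_annulus isPreconnected_Ici fun r hr => one_pos.trans_le hr).image _
      B.continuous.continuousOn
  rcases A.inside_or_outside hS (by
    rintro _ ⟨w, hw, rfl⟩ h1
    have := h _ h1
    rw [symm_apply_apply] at this
    exact absurd hw (not_le.2 this)) with hin | hout
  · exfalso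
    obtain ⟨R, hR⟩ := (((A.isBounded_disc.isCompact_closure).image
      B.symm.continuous).isBounded).exists_norm_le
    have hw : ‖((|R| + 1 : ℝ) : ℂ)‖ = |R| + 1 := by
      rw [Complex.norm_real, Real.norm_of_nonneg (by positivity)]
    have h1 := hin _ ⟨((|R| + 1 : ℝ) : ℂ), by
      rw [mem_ofPred_eq, hw]
      exact (le_add_iff_nonneg_left _).2 (abs_nonneg R), rfl⟩
    have h2 := hR _ ⟨_, subset_closure h1.le, rfl⟩
    rw [symm_apply_apply, hw] at h2
    linarith [le_abs_self R]
  · by_contra hz1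
    refine absurd hz (not_le.2 (hout z ⟨B.symm z, not_lt.1 hz1, by simp⟩))

/-- A collar of the boundary of a disc avoiding a closed set which misses the boundary. -/
theorem exists_collar (A : PlaneDiffeo) {C : Set ℂ} (hC : IsClosed C)
    (h : ∀ z ∈ C, ‖A.symm z‖ ≠ 1) :
    ∃ ε, 0 < ε ∧ ε < 1 ∧ ∀ z, |‖A.symm z‖ - 1| < ε → z ∉ C := by
  have hsub : Metric.sphere (0 : ℂ) 1 ⊆ A ⁻¹' Cᶜ := fun w hw hwC =>
    h _ hwC (by simpa using hw)
  obtain ⟨δ, hδ, hδC⟩ := (isCompact_sphere (0 : ℂ) 1).exists_thickening_subset_open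
    (hC.isOpen_compl.preimage A.continuous) hsub
  refine ⟨min δ (1 / 2), by positivity, (min_le_right _ _).trans_lt (by norm_num), fun z hz => ?_⟩
  have hz1 : |‖A.symm z‖ - 1| < 1 / 2 := hz.trans_le (min_le_right _ _)
  have h0 : 0 < ‖A.symm z‖ := by linarith [(abs_lt.1 hz1).1]
  have hmem : A.symm z ∈ Metric.thickening δ (Metric.sphere (0 : ℂ) 1) := by
    refine Metric.mem_thickening_iff.2 ⟨‖A.symm z‖⁻¹ • A.symm z, ?_, ?_⟩
    · simp [h0.ne']
    · have e : A.symm z - ‖A.symm z‖⁻¹ • A.symm z = (1 - ‖A.symm z‖⁻¹) • A.symm z := by module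
      rw [dist_eq_norm, e, norm_smul, ← abs_of_pos h0, Real.norm_eq_abs, ← abs_mul, sub_mul,
        abs_of_pos h0, one_mul, inv_mul_cancel₀ h0.ne']
      exact hz.trans_le (min_le_left _ _)
  simpa using hδC hmem

end PlaneDiffeo

theorem IsPreconnected.exists_sign_eq {g : ℂ → ℝ} (hg : Continuous g) {S : Set ℂ}
    (hS : IsPreconnected S) (h0 : ∀ z ∈ S, g z ≠ 0) :
    ∃ s : SignType, s * s = 1 ∧ ∀ z ∈ S, SignType.sign (g z) = s := by
  by_cases hex : ∃ z ∈ S, 0 < g z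
  · obtain ⟨w, hw, hpos⟩ := hex
    refine ⟨1, rfl, fun z hz => sign_pos ?_⟩
    by_contra hle
    obtain ⟨y, hy, hy0⟩ := hS.intermediate_value hz hw hg.continuousOn ⟨not_lt.1 hle, hpos.le⟩
    exact h0 y hy hy0
  · push Not at hex
    exact ⟨-1, rfl, fun z hz => sign_neg (lt_of_le_of_ne (hex z hz) (h0 z hz))⟩

/-- If finitely many disjoint closed curves cut out the zero set of `g`, a point which `g`
separates from a point outside all the curves is inside one of them. -/
theorem exists_inside {ι : Type*} [Finite ι] {A : ι → PlaneDiffeo} {g : ℂ → ℝ} (hg : Continuous g)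
    (hA : ∀ z, g z = 0 ↔ ∃ i, ‖(A i).symm z‖ = 1)
    (hd : ∀ i j z, ‖(A i).symm z‖ = 1 → ‖(A j).symm z‖ = 1 → i = j)
    {z₀ z₁ : ℂ} (h₀ : g z₀ < 0) (h₁ : 0 < g z₁) (hout : ∀ i, 1 < ‖(A i).symm z₁‖) :
    ∃ i, ‖(A i).symm z₀‖ < 1 := by
  classical
  cases nonempty_fintype ι
  have hcol : ∀ i, ∃ ε, 0 < ε ∧ ε < 1 ∧
      ∀ z, |‖(A i).symm z‖ - 1| < ε → ∀ k, k ≠ i → ‖(A k).symm z‖ ≠ 1 := by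
    intro i
    obtain ⟨ε, h0, h1, h⟩ := (A i).exists_collar
      (C := ⋃ k ∈ {k | k ≠ i}, {z | ‖(A k).symm z‖ = 1})
      ((toFinite _).isClosed_biUnion fun k _ =>
        isClosed_eq (A k).continuous_norm_symm continuous_const) (by
        intro z hz h
        obtain ⟨k, hk, hkz⟩ := mem_iUnion₂.1 hz
        exact hk (hd k i z hkz h))
    exact ⟨ε, h0, h1, fun z hz k hk hkz => h z hz (mem_iUnion₂.2 ⟨k, hk, hkz⟩)⟩
  choose ε hε0 hε1 hε using hcol
  have hg0 : ∀ i z, |‖(A i).symm z‖ - 1| < ε i → ‖(A i).symm z‖ ≠ 1 → g z ≠ 0 := by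
    intro i z hz h1 h0
    obtain ⟨k, hk⟩ := (hA z).1 h0
    by_cases hki : k = i
    · exact h1 (hki ▸ hk)
    · exact hε i z hz k hki hk
  have hann : ∀ i (I : Set ℝ), IsPreconnected I → (∀ r ∈ I, |r - 1| < ε i ∧ r ≠ 1) →
      ∃ s : SignType, s * s = 1 ∧ ∀ z, ‖(A i).symm z‖ ∈ I → SignType.sign (g z) = s := by
    intro i I hI h
    have hpre := (isPreconnected_annulus hI fun r hr => by
      linarith [(abs_lt.1 (h r hr).1).1, hε1 i]).image (A i) (A i).continuous.continuousOn
    obtain ⟨s, hs, hs'⟩ := hpre.exists_sign_eq hg (by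
      rintro _ ⟨w, hw, rfl⟩
      exact hg0 i _ (by simpa using (h _ hw).1) (by simpa using (h _ hw).2))
    exact ⟨s, hs, fun z hz => hs' z ⟨_, hz, by simp⟩⟩
  choose so hso1 hso using fun i => hann i (Ioo 1 (1 + ε i)) isPreconnected_Ioo fun r hr =>
    ⟨abs_lt.2 ⟨by linarith [hr.1, hε0 i], by linarith [hr.2]⟩, hr.1.ne'⟩
  choose si hsi1 hsi using fun i => hann i (Ioo (1 - ε i) 1) isPreconnected_Ioo fun r hr =>
    ⟨abs_lt.2 ⟨by linarith [hr.1], by linarith [hr.2, hε0 i]⟩, hr.2.ne⟩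
  set κ : ι → ℂ → SignType := fun i z => if ‖(A i).symm z‖ < 1 then so i * si i else 1 with hκ
  set σ : ℂ → SignType := fun z =>
    if h : ∃ i, ‖(A i).symm z‖ = 1 then so h.choose else SignType.sign (g z) with hσ
  have hσ1 : ∀ i z, ‖(A i).symm z‖ = 1 → σ z = so i := fun i z hz => by
    have h : ∃ i, ‖(A i).symm z‖ = 1 := ⟨i, hz⟩
    rw [hσ]
    simp only [dif_pos h]
    rw [hd _ i z h.choose_spec hz]
  have hσ2 : ∀ z, g z ≠ 0 → σ z = SignType.sign (g z) := fun z hz =>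
    dif_neg fun h => hz ((hA z).2 h)
  have hκc : ∀ k z, ‖(A k).symm z‖ ≠ 1 → ∀ᶠ y in 𝓝 z, κ k y = κ k z := by
    intro k z hz
    rcases hz.lt_or_gt with h | h
    · filter_upwards [((A k).continuous_norm_symm.tendsto z).eventually (gt_mem_nhds h)] with y hy
      simp only [hκ, if_pos h, if_pos hy]
    · filter_upwards [((A k).continuous_norm_symm.tendsto z).eventually (lt_mem_nhds h)] with y hy
      simp only [hκ, if_neg (not_lt.2 h.le), if_neg (not_lt.2 (le_of_lt hy))]
  have hloc : IsLocallyConstant fun z => σ z * ∏ k, κ k z := by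
    rw [IsLocallyConstant.iff_eventually_eq]
    intro z
    by_cases hz : g z = 0
    · obtain ⟨i, hi⟩ := (hA z).1 hz
      have hcol : ∀ᶠ y in 𝓝 z, |‖(A i).symm y‖ - 1| < ε i := by
        refine (((A i).continuous_norm_symm.sub continuous_const).abs.tendsto z).eventually
          (gt_mem_nhds ?_)
        simpa [hi] using hε0 i
      have hev : ∀ᶠ y in 𝓝 z, ∀ k ∈ Finset.univ.erase i, κ k y = κ k z := by
        rw [Finset.eventually_all]
        intro k hk
        exact hκc k z (hε i z (by simpa [hi] using hε0 i) k (Finset.ne_of_mem_erase hk))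
      have hloc1 : ∀ y, |‖(A i).symm y‖ - 1| < ε i → σ y * κ i y = so i := by
        intro y hy
        rcases lt_trichotomy ‖(A i).symm y‖ 1 with h | h | h
        · rw [hσ2 y (hg0 i y hy h.ne), hsi i y ⟨by linarith [(abs_lt.1 hy).1], h⟩]
          simp only [hκ, if_pos h]
          rw [mul_left_comm, hsi1, mul_one]
        · rw [hσ1 i y h]
          simp only [hκ, h, lt_irrefl, if_false, mul_one]
        · rw [hσ2 y (hg0 i y hy h.ne'), hso i y ⟨h, by linarith [(abs_lt.1 hy).2]⟩]
          simp only [hκ, if_neg (not_lt.2 h.le), mul_one]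
      filter_upwards [hcol, hev] with y hy1 hy2
      rw [← Finset.mul_prod_erase _ _ (Finset.mem_univ i),
        ← Finset.mul_prod_erase _ (fun k => κ k z) (Finset.mem_univ i), ← mul_assoc, ← mul_assoc,
        hloc1 y hy1, hloc1 z (by simpa [hi] using hε0 i), Finset.prod_congr rfl hy2]
    · have hev : ∀ᶠ y in 𝓝 z, ∀ k ∈ Finset.univ, κ k y = κ k z := by
        rw [Finset.eventually_all]
        exact fun k _ => hκc k z fun h => hz ((hA z).2 ⟨k, h⟩)
      have hs : ∀ᶠ y in 𝓝 z, g y ≠ 0 ∧ SignType.sign (g y) = SignType.sign (g z) := by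
        rcases lt_or_gt_of_ne hz with h | h
        · filter_upwards [(hg.tendsto z).eventually (gt_mem_nhds h)] with y hy
          exact ⟨ne_of_lt hy, by rw [sign_neg hy, sign_neg h]⟩
        · filter_upwards [(hg.tendsto z).eventually (lt_mem_nhds h)] with y hy
          exact ⟨ne_of_gt hy, by rw [sign_pos hy, sign_pos h]⟩
      filter_upwards [hs, hev] with y hy1 hy2
      rw [hσ2 y hy1.1, hσ2 z hz, hy1.2, Finset.prod_congr rfl hy2]
  by_contra hcon
  push Not at hcon
  have heq := hloc.apply_eq_of_preconnectedSpace z₀ z₁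
  rw [hσ2 _ h₀.ne, hσ2 _ h₁.ne', sign_neg h₀, sign_pos h₁,
    Finset.prod_eq_one fun k _ => if_neg (not_lt.2 (hcon k)),
    Finset.prod_eq_one fun k _ => if_neg (not_lt.2 (hout k).le)] at heq
  exact absurd heq (by decide)

theorem PlaneDiffeo.fderiv_surjective (A : PlaneDiffeo) (z : ℂ) : Surjective (fderiv ℝ A z) :=
  (LinearMap.injective_iff_surjective (f := (fderiv ℝ A z : ℂ →ₗ[ℝ] ℂ))).1 (A.fderiv_injective z)

section

variable {E : Type*} [NormedAddCommGroup E] [NormedSpace ℝ E]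

theorem fderiv_comp_planeDiffeo {f : ℂ → E} (hf : ContDiff ℝ ∞ f) (A : PlaneDiffeo) (x : ℂ) :
    fderiv ℝ (fun z => f (A z)) x = (fderiv ℝ f (A x)).comp (fderiv ℝ A x) :=
  fderiv_comp x (hf.differentiable (by simp) _) (A.differentiableAt x)

theorem range_fderiv_comp_planeDiffeo {f : ℂ → E} (hf : ContDiff ℝ ∞ f) (A : PlaneDiffeo) (x : ℂ) :
    range (fderiv ℝ (fun z => f (A z)) x) = range (fderiv ℝ f (A x)) := by
  rw [fderiv_comp_planeDiffeo hf, ContinuousLinearMap.coe_comp,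
    (A.fderiv_surjective x).range_comp]

/-- A surface, embedded over `D` and missing `K`, cut transversely by the surface `f` along finitely
many curves whose preimages under `f` bound discs and miss `Q`. -/
structure CutSurface (f : ℂ → E) (K : Set E) (Q : Set ℂ) {ι : Type} (φ : ℂ → E) (a : ι → ℝ → ℂ)
    (B : ι → PlaneDiffeo) (D : Set ℂ) : Prop where
  smooth : ContDiff ℝ ∞ φ
  injOn : InjOn φ D
  imm : ∀ x ∈ D, Injective (fderiv ℝ φ x)
  avoid : ∀ x ∈ D, φ x ∉ K
  loop : ∀ i, IsLoop (a i)
  mem : ∀ i t, a i t ∈ D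
  eq : ∀ i t, φ (a i t) = f (B i (circ t))
  inter : ∀ x ∈ D, φ x ∈ range f → ∃ i t, x = a i t
  trans : ∀ i t, ∃ v, fderiv ℝ φ (a i t) v ∉ range (fderiv ℝ f (B i (circ t)))
  disj : ∀ i j z, ‖(B i).symm z‖ = 1 → ‖(B j).symm z‖ = 1 → i = j
  core : ∀ i, ∀ z ∈ Q, ‖(B i).symm z‖ ≠ 1

namespace CutSurface

variable {f : ℂ → E} {K : Set E} {Q : Set ℂ} {ι : Type} {φ : ℂ → E} {a : ι → ℝ → ℂ}
  {B : ι → PlaneDiffeo} {D : Set ℂ}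

theorem index_eq (h : CutSurface f K Q φ a B D) (hf : Injective f) {i j : ι} {s t : ℝ}
    (hst : a i s = a j t) : i = j := by
  have h1 := congrArg φ hst
  rw [h.eq, h.eq] at h1
  refine h.disj i j (B i (circ s)) (by simp [norm_circ]) ?_
  rw [hf h1]
  simp [norm_circ]

theorem inside_or_outside (h : CutSurface f K Q φ a B D) (hf : Injective f) {k : ι}
    {A : PlaneDiffeo} (hA : ∀ t, a k t = A (circ t)) {j : ι} (hjk : j ≠ k) :
    (∀ t, ‖A.symm (a j t)‖ < 1) ∨ ∀ t, 1 < ‖A.symm (a j t)‖ := by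
  have := A.inside_or_outside (isPreconnected_range (h.loop j).smooth.continuous) (by
    rintro _ ⟨t, rfl⟩ h1
    obtain ⟨s, hs⟩ := exists_circ_eq h1
    refine hjk (h.index_eq hf (s := t) (t := s) ?_)
    rw [hA, hs, PlaneDiffeo.apply_symm_apply])
  simpa using this

/-- Restriction of a cut surface to the disc bounded by one of the curves. -/
theorem restrict (h : CutSurface f K Q φ a B D) (hf : Injective f) {k : ι}
    {A : PlaneDiffeo} (hA : ∀ t, a k t = A (circ t)) (hD : ∀ x, ‖A.symm x‖ ≤ 1 → x ∈ D) :
    CutSurface f K Q (fun x => φ (A x))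
      (fun (j : {j // ∀ t, ‖A.symm (a j t)‖ ≤ 1}) t => A.symm (a j t)) (fun j => B j)
      (Metric.closedBall 0 1) := by
  have hAD : ∀ x ∈ Metric.closedBall (0 : ℂ) 1, A x ∈ D := fun x hx =>
    hD _ (by simpa using hx)
  refine ⟨h.smooth.comp A.smooth, fun x hx y hy hxy => A.injective (h.injOn (hAD x hx) (hAD y hy)
    hxy), fun x hx => ?_, fun x hx => h.avoid _ (hAD x hx), fun j => (h.loop j).comp A.symm,
    fun j t => by simpa using j.2 t, fun j t => by simpa using h.eq j t, fun x hx hxf => ?_,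
    fun j t => ?_, fun i j z hi hj => Subtype.ext (h.disj i j z hi hj), fun i => h.core i⟩
  · rw [fderiv_comp_planeDiffeo h.smooth]
    exact (h.imm _ (hAD x hx)).comp (A.fderiv_injective x)
  · obtain ⟨j, t, hjt⟩ := h.inter _ (hAD x hx) hxf
    have hxj : x = A.symm (a j t) := by rw [← hjt, PlaneDiffeo.symm_apply_apply]
    refine ⟨⟨j, ?_⟩, t, hxj⟩
    by_cases hjk : j = k
    · intro s
      simp [hjk, hA, norm_circ]
    · rcases h.inside_or_outside hf hA hjk with hin | hout
      · exact fun s => (hin s).le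
      · have := hout t
        rw [← hxj] at this
        exact absurd (mem_closedBall_zero_iff.1 hx) (not_le.2 this)
  · obtain ⟨v, hv⟩ := h.trans j t
    obtain ⟨w, rfl⟩ := A.fderiv_surjective (A.symm (a j t)) v
    refine ⟨w, ?_⟩
    rw [fderiv_comp_planeDiffeo h.smooth]
    simpa using hv

/-- The disc bounded by an inner curve is contained in the open unit disc. -/
theorem disc_subset (h : CutSurface f K Q φ a B (Metric.closedBall 0 1)) (hf : Injective f)
    {i₀ k : ι} (hi₀ : a i₀ = circ) (hk : k ≠ i₀) {A : PlaneDiffeo}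
    (hA : ∀ t, a k t = A (circ t)) {x : ℂ} (hx : ‖A.symm x‖ ≤ 1) : ‖x‖ < 1 := by
  refine PlaneDiffeo.inside_of_boundary_inside (B := PlaneDiffeo.refl) (fun z hz => ?_) hx
  obtain ⟨t, ht⟩ := exists_circ_eq hz
  have hz' : a k t = z := by rw [hA, ht, PlaneDiffeo.apply_symm_apply]
  have hz1 : ‖z‖ ≤ 1 := by
    have := h.mem k t
    rwa [hz', mem_closedBall_zero_iff] at this
  refine lt_of_le_of_ne hz1 fun h1 => ?_
  obtain ⟨s, hs⟩ := exists_circ_eq h1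
  change circ s = z at hs
  exact hk (h.index_eq hf (s := t) (t := s) (by rw [hz', hi₀, hs]))

end CutSurface

end

namespace CutSurface

variable {E : Type*} [NormedAddCommGroup E] [InnerProductSpace ℝ E] [FiniteDimensional ℝ E]
  {f N : ℂ → E} {K : Set E} {Q : Set ℂ} {ι : Type} {φ : ℂ → E} {a : ι → ℝ → ℂ}
  {B : ι → PlaneDiffeo}

/-- An innermost curve whose disc misses `Q` can be removed by surgery, together with the curves it
encloses. -/
theorem exists_remove [Finite ι] (h : CutSurface f K Q φ a B (Metric.closedBall 0 1))
    (hf : ContDiff ℝ ∞ f) (hfc : IsClosedEmbedding f) (hfi : ∀ x, Injective (fderiv ℝ f x))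
    (hN : ContDiff ℝ ∞ N) (hN0 : ∀ x, N x ≠ 0)
    (hNf : ∀ x y, inner ℝ (N x) y = 0 ↔ y ∈ range (fderiv ℝ f x)) (hK : IsClosed K)
    (hKQ : ∀ z, f z ∈ K → z ∈ Q) {k : ι} {A : PlaneDiffeo} (hA : ∀ t, a k t = A (circ t))
    (hin : ∀ j t, ‖(B k).symm (B j (circ t))‖ ≤ 1 → j = k)
    (hQ : ∀ z ∈ Q, 1 < ‖(B k).symm z‖) :
    ∃ φ', CutSurface f K Q φ' (fun (j : {j // ∀ t, 1 < ‖A.symm (a j t)‖}) => a j) (fun j => B j)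
      (Metric.closedBall 0 1) := by
  have hinj := hfc.injective
  obtain ⟨ε, hε, -, hεC⟩ := A.exists_collar (C := ⋃ j : {j // j ≠ k}, range (a j))
    (isClosed_iUnion_of_finite fun j => (h.loop j).isCompact_range.isClosed) (by
      intro z hz
      obtain ⟨⟨j, hj⟩, t, rfl⟩ := mem_iUnion.1 hz
      rcases h.inside_or_outside hinj hA hj with h1 | h1
      · exact (h1 t).ne
      · exact (h1 t).ne')
  set P : Set ℂ := A ⁻¹' Metric.closedBall 0 1 with hPdef
  have hP : IsCompact P := A.toHomeo.isCompact_preimage.2 (isCompact_closedBall 0 1)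
  have hψ : ContDiff ℝ ∞ fun x => φ (A x) := h.smooth.comp A.smooth
  have hfB : ContDiff ℝ ∞ fun x => f (B k x) := hf.comp (B k).smooth
  have hrange : range (fun x => f (B k x)) = range f := (B k).toHomeo.surjective.range_comp f
  obtain ⟨ψ', hψ', hout, hψinj, hψimm, hψK⟩ := exists_surgery (ψ := fun x => φ (A x))
    (f := fun x => f (B k x)) (N := fun x => N (B k x)) hψ hfB
    (hfc.comp (B k).toHomeo.isClosedEmbedding) (fun x => by
      rw [fderiv_comp_planeDiffeo hf]
      exact (hfi _).comp ((B k).fderiv_injective x))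
    (hN.comp (B k).smooth) (fun x => hN0 _)
    (fun x y => by rw [range_fderiv_comp_planeDiffeo hf, hNf])
    (fun x hx => by
      obtain ⟨t, rfl⟩ := exists_circ_eq hx
      rw [← hA, h.eq])
    (fun x hx => by
      obtain ⟨t, rfl⟩ := exists_circ_eq hx
      obtain ⟨v, hv⟩ := h.trans k t
      obtain ⟨w, rfl⟩ := A.fderiv_surjective (circ t) v
      refine ⟨w, ?_⟩
      rw [range_fderiv_comp_planeDiffeo hf, fderiv_comp_planeDiffeo h.smooth]
      simpa [hA] using hv)
    hP (fun x hx y hy hxy => A.injective (h.injOn hx hy hxy))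
    (fun x hx => by
      rw [fderiv_comp_planeDiffeo h.smooth]
      exact (h.imm _ hx).comp (A.fderiv_injective x))
    (fun x hx y hy hxy => by
      obtain ⟨j, t, hjt⟩ := h.inter _ hx ⟨_, hxy.symm⟩
      have h1 : B j (circ t) = B k y := by
        apply hinj
        rw [← h.eq, ← hjt, hxy]
      obtain rfl := hin j t (by rw [h1]; simpa using hy)
      rw [hA] at hjt
      rw [A.injective hjt, norm_circ])
    hK (fun y hy hyK => by
      have := hQ _ (hKQ _ hyK)
      rw [PlaneDiffeo.symm_apply_apply] at this
      linarith)
    (show 1 < 1 + ε by linarith)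
  have hAP : ∀ x ∈ Metric.closedBall (0 : ℂ) 1, A.symm x ∈ P := fun x hx => by
    simpa [hPdef] using hx
  have hloc : ∀ (j : {j // ∀ t, 1 < ‖A.symm (a j t)‖}) t,
      ∀ᶠ x in 𝓝 (a j t), ψ' (A.symm x) = φ x := by
    intro j t
    have hjk : (j : ι) ≠ k := by
      intro hjk
      have := j.2 0
      simp [hjk, hA, norm_circ] at this
    have h1 : 1 + ε ≤ ‖A.symm (a j t)‖ := by
      by_contra! hlt
      refine hεC (a j t) ?_ (mem_iUnion.2 ⟨⟨j, hjk⟩, mem_range_self t⟩)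
      rw [abs_lt]
      constructor <;> linarith [j.2 t]
    filter_upwards [A.symm.continuous.continuousAt.eventually (hout _ h1)] with x hx
    rw [hx, PlaneDiffeo.apply_symm_apply]
  refine ⟨fun x => ψ' (A.symm x), hψ'.comp A.symm.smooth, fun x hx y hy hxy => A.symm.injective
    (hψinj (hAP x hx) (hAP y hy) hxy), fun x hx => ?_, fun x hx => ?_, fun j => h.loop j,
    fun j => h.mem j, fun j t => (hloc j t).self_of_nhds.trans (h.eq j t), fun x hx hxf => ?_,
    fun j t => ?_, fun i j z hi hj => Subtype.ext (h.disj i j z hi hj), fun i => h.core i⟩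
  · rw [fderiv_comp_planeDiffeo hψ']
    exact (hψimm _ (hAP x hx)).comp (A.symm.fderiv_injective x)
  · rcases hψK _ (hAP x hx) with ⟨h1, -⟩ | ⟨h1, -⟩
    · rw [h1, PlaneDiffeo.apply_symm_apply]
      exact h.avoid x hx
    · exact h1
  · rcases hψK _ (hAP x hx) with ⟨h1, h2⟩ | ⟨-, h1⟩
    · rw [h1, PlaneDiffeo.apply_symm_apply] at hxf
      obtain ⟨j, t, rfl⟩ := h.inter x hx hxf
      have hjk : j ≠ k := by
        rintro rfl
        simp [hA, norm_circ] at h2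
      rcases h.inside_or_outside hinj hA hjk with h3 | h3
      · exact absurd (h3 t) h2.not_gt
      · exact ⟨⟨j, h3⟩, t, rfl⟩
    · rw [hrange] at h1
      exact absurd hxf h1
  · obtain ⟨v, hv⟩ := h.trans j t
    refine ⟨v, ?_⟩
    rwa [Filter.EventuallyEq.fderiv_eq (f := φ) (hloc j t)]

/-- Removing all superfluous curves leaves a disc meeting `f` exactly in one curve around `0`. -/
theorem exists_disc [Finite ι] (h : CutSurface f K Q φ a B (Metric.closedBall 0 1))
    (hf : ContDiff ℝ ∞ f) (hfc : IsClosedEmbedding f) (hfi : ∀ x, Injective (fderiv ℝ f x))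
    (hN : ContDiff ℝ ∞ N) (hN0 : ∀ x, N x ≠ 0)
    (hNf : ∀ x y, inner ℝ (N x) y = 0 ↔ y ∈ range (fderiv ℝ f x)) (hK : IsClosed K)
    (hKQ : ∀ z, f z ∈ K → z ∈ Q) (hQ : IsPreconnected Q) (h0 : 0 ∈ Q)
    {i₀ : ι} (hi₀ : a i₀ = circ) (hB : ‖(B i₀).symm 0‖ < 1) :
    ∃ (φ' : ℂ → E) (B' : PlaneDiffeo), ContDiff ℝ ∞ φ' ∧ InjOn φ' (Metric.closedBall 0 1) ∧
      (∀ x ∈ Metric.closedBall 0 1, Injective (fderiv ℝ φ' x)) ∧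
      (∀ x ∈ Metric.closedBall 0 1, φ' x ∉ K) ∧ (∀ t, φ' (circ t) = f (B' (circ t))) ∧
      (∀ x ∈ Metric.closedBall 0 1, φ' x ∈ range f → ‖x‖ = 1) ∧ ‖B'.symm 0‖ < 1 := by
  have hinj := hfc.injective
  induction hn : Nat.card ι using Nat.strong_induction_on generalizing ι φ a B with
  | _ n ih =>
  by_cases hone : ∀ j, j = i₀
  · refine ⟨φ, B i₀, h.smooth, h.injOn, h.imm, h.avoid, fun t => ?_, fun x hx hxf => ?_, hB⟩
    · rw [← h.eq, hi₀]
    · obtain ⟨j, t, rfl⟩ := h.inter x hx hxf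
      rw [hone j, hi₀, norm_circ]
  push Not at hone
  by_cases hess : ∃ k, k ≠ i₀ ∧ ‖(B k).symm 0‖ < 1
  · obtain ⟨k, hk, hkB⟩ := hess
    obtain ⟨A, hA⟩ := (h.loop k).good
    have hsub := fun x => h.disc_subset (x := x) hinj hi₀ hk hA
    have hres := h.restrict hinj hA fun x hx => mem_closedBall_zero_iff.2 (hsub x hx).le
    have hcard : Nat.card {j // ∀ t, ‖A.symm (a j t)‖ ≤ 1} < n := by
      rw [← hn]
      refine Finite.card_subtype_lt (x := i₀) fun hle => ?_
      have := hsub _ (hle 0)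
      rw [hi₀, norm_circ] at this
      exact lt_irrefl _ this
    exact ih _ hcard hres (i₀ := ⟨k, fun t => by simp [hA, norm_circ]⟩)
      (by ext t; simp [hA]) hkB rfl
  · push Not at hess
    obtain ⟨k, hk, hmin⟩ := (Set.toFinite {k | k ≠ i₀}).exists_minimalFor
      (fun k => {z | ‖(B k).symm z‖ < 1}) _ hone
    obtain ⟨A, hA⟩ := (h.loop k).good
    have hdisj : ∀ j, j ≠ k → ∀ z, ‖(B j).symm z‖ = 1 → ‖(B k).symm z‖ ≠ 1 :=
      fun j hj z h1 h2 => hj (h.disj j k z h1 h2)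
    have hin : ∀ j t, ‖(B k).symm (B j (circ t))‖ ≤ 1 → j = k := by
      intro j t hle
      by_contra hjk
      have hpre : IsPreconnected (range fun t => B j (circ t)) :=
        isPreconnected_range ((B j).continuous.comp continuous_circ)
      rw [PlaneDiffeo.range_comp_circ] at hpre
      have hmem : B j (circ t) ∈ {z | ‖(B j).symm z‖ = 1} := by simp [norm_circ]
      rcases (B k).inside_or_outside hpre (hdisj j hjk) with h1 | h1
      · have hnest : ∀ z, ‖(B j).symm z‖ ≤ 1 → ‖(B k).symm z‖ < 1 := fun z =>
          PlaneDiffeo.inside_of_boundary_inside h1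
        by_cases hji : j = i₀
        · exact (hess k hk).not_gt (hnest 0 (hji ▸ hB.le))
        · have := hmin (j := j) hji (fun z hz => hnest z (le_of_lt hz)) (h1 _ hmem)
          simp [norm_circ] at this
      · exact absurd (h1 _ hmem) hle.not_gt
    have hQk : ∀ z ∈ Q, 1 < ‖(B k).symm z‖ := by
      rcases (B k).inside_or_outside hQ (h.core k) with h1 | h1
      · exact absurd (h1 0 h0) (hess k hk).not_gt
      · exact h1
    obtain ⟨φ', hφ'⟩ := h.exists_remove hf hfc hfi hN hN0 hNf hK hKQ hA hin hQk
    have hcard : Nat.card {j // ∀ t, 1 < ‖A.symm (a j t)‖} < n := by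
      rw [← hn]
      refine Finite.card_subtype_lt (x := k) fun hlt => ?_
      simpa [hA, norm_circ] using hlt 0
    have hi₀' : ∀ t, 1 < ‖A.symm (a i₀ t)‖ := by
      intro t
      by_contra! hle
      have := h.disc_subset hinj hi₀ hk hA hle
      rw [hi₀, norm_circ] at this
      exact lt_irrefl _ this
    exact ih _ hcard hφ' (i₀ := ⟨i₀, hi₀'⟩) hi₀ hB rfl

end CutSurface

open scoped Matrix in
theorem exists_normal_field {f : ℂ → EuclideanSpace ℝ (Fin 3)} (hf : ContDiff ℝ ∞ f)
    (hfi : ∀ x, Injective (fderiv ℝ f x)) :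
    ∃ N : ℂ → EuclideanSpace ℝ (Fin 3), ContDiff ℝ ∞ N ∧ (∀ x, N x ≠ 0) ∧
      ∀ x y, inner ℝ (N x) y = 0 ↔ y ∈ range (fderiv ℝ f x) := by
  have hd : ContDiff ℝ ∞ (fderiv ℝ f) := hf.fderiv_right (by simp)
  have hdv : ∀ v, ContDiff ℝ ∞ fun x => fderiv ℝ f x v := fun v => hd.clm_apply contDiff_const
  have hco : ∀ v (i : Fin 3), ContDiff ℝ ∞ fun x => (fderiv ℝ f x v) i :=
    fun v i => contDiff_euclidean.1 (hdv v) i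
  have hN0 : ∀ x, (fderiv ℝ f x 1).ofLp ⨯₃ (fderiv ℝ f x Complex.I).ofLp ≠ 0 := by
    intro x
    rw [crossProduct_ne_zero_iff_linearIndependent]
    have h1 : LinearIndependent ℝ ![(1 : ℂ), Complex.I] := by
      have := Complex.basisOneI.linearIndependent
      rwa [Complex.coe_basisOneI] at this
    have h2 := h1.map' (fderiv ℝ f x : ℂ →ₗ[ℝ] EuclideanSpace ℝ (Fin 3))
      (LinearMap.ker_eq_bot_of_injective (hfi x))
    have h3 := h2.map' (WithLp.linearEquiv 2 ℝ (Fin 3 → ℝ)).toLinearMap (LinearEquiv.ker _)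
    have heq : ![(fderiv ℝ f x 1).ofLp, (fderiv ℝ f x Complex.I).ofLp] =
        WithLp.linearEquiv 2 ℝ (Fin 3 → ℝ) ∘ fderiv ℝ f x ∘ ![(1 : ℂ), Complex.I] := by
      ext i
      fin_cases i <;> rfl
    rw [heq]
    exact h3
  refine ⟨fun x => WithLp.toLp 2 ((fderiv ℝ f x 1).ofLp ⨯₃ (fderiv ℝ f x Complex.I).ofLp),
    contDiff_euclidean.2 fun i => ?_, fun x hx => hN0 x (by simpa using hx), fun x => ?_⟩
  · simp only [cross_apply]
    fin_cases i
    · exact ((hco _ _).mul (hco _ _)).sub ((hco _ _).mul (hco _ _))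
    · exact ((hco _ _).mul (hco _ _)).sub ((hco _ _).mul (hco _ _))
    · exact ((hco _ _).mul (hco _ _)).sub ((hco _ _).mul (hco _ _))
  · set n : EuclideanSpace ℝ (Fin 3) := WithLp.toLp 2 ((fderiv ℝ f x 1).ofLp ⨯₃ (fderiv ℝ f x Complex.I).ofLp) with hn
    have hn0 : n ≠ 0 := fun h => hN0 x (by simpa [hn] using h)
    have hle : LinearMap.range (fderiv ℝ f x : ℂ →ₗ[ℝ] EuclideanSpace ℝ (Fin 3)) ≤ (ℝ ∙ n)ᗮ := by
      rintro _ ⟨w, rfl⟩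
      rw [Submodule.mem_orthogonal_singleton_iff_inner_right]
      have hw : w = w.re • (1 : ℂ) + w.im • Complex.I := by
        simp [Complex.re_add_im]
      rw [hw, map_add, map_smul, map_smul, inner_add_right, inner_smul_right, inner_smul_right]
      have e1 : inner ℝ n (fderiv ℝ f x 1) = 0 := by
        rw [EuclideanSpace.inner_eq_star_dotProduct]
        simp [hn]
      have e2 : inner ℝ n (fderiv ℝ f x Complex.I) = 0 := by
        rw [EuclideanSpace.inner_eq_star_dotProduct]
        simp [hn]
      simp [e1, e2]
    have : Fact (Module.finrank ℝ (EuclideanSpace ℝ (Fin 3)) = 2 + 1) := ⟨by simp⟩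
    have heq := Submodule.eq_of_le_of_finrank_eq hle (by
      rw [LinearMap.finrank_range_of_inj (hfi x), Submodule.finrank_orthogonal_span_singleton (n := 2) hn0,
        Complex.finrank_real_complex])
    intro y
    rw [← Submodule.mem_orthogonal_singleton_iff_inner_right, ← heq]
    rfl

/-- A smooth parametrization of a punctured sphere by the plane. -/
theorem exists_sphere_chart (p : EuclideanSpace ℝ (Fin 3)) {r : ℝ} (hr : 0 < r) :
    ∃ (j : ℂ → EuclideanSpace ℝ (Fin 3)) (k : EuclideanSpace ℝ (Fin 3) → ℂ),
      ContDiff ℝ ∞ j ∧ (∀ x, x ≠ p + EuclideanSpace.single 2 r → ContDiffAt ℝ ∞ k x) ∧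
      (∀ z, ‖j z - p‖ = r) ∧
      (∀ z, j z ≠ p + EuclideanSpace.single 2 r) ∧ (∀ z, k (j z) = z) ∧
      ∀ x, ‖x - p‖ = r → x ≠ p + EuclideanSpace.single 2 r → j (k x) = x := by
  set q := p + EuclideanSpace.single 2 r with hq
  let y : ℂ → EuclideanSpace ℝ (Fin 3) := fun z => !₂[z.re, z.im, -1]
  have hy : ∀ z, ‖y z‖ ^ 2 = z.re ^ 2 + z.im ^ 2 + 1 := fun z => by
    simp [y, EuclideanSpace.norm_sq_eq, Fin.sum_univ_three]
  have hy0 : ∀ z, 0 < ‖y z‖ ^ 2 := fun z => by rw [hy]; positivity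
  have hys : ContDiff ℝ ∞ y := by
    refine contDiff_euclidean.2 fun i => ?_
    fin_cases i
    · exact Complex.reCLM.contDiff
    · exact Complex.imCLM.contDiff
    · exact contDiff_const
  let w : EuclideanSpace ℝ (Fin 3) → EuclideanSpace ℝ (Fin 3) :=
    fun x => (2 * r / ‖x - q‖ ^ 2) • (x - q)
  have hws : ∀ x, x ≠ q → ContDiffAt ℝ ∞ w x := fun x hx => by
    have h1 : ContDiffAt ℝ ∞ (fun x => x - q) x := contDiffAt_id.sub contDiffAt_const
    have h2 : ‖x - q‖ ^ 2 ≠ 0 := by simpa [sub_eq_zero] using hx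
    exact (contDiffAt_const.div (h1.norm_sq ℝ) h2).smul h1
  refine ⟨fun z => q + (2 * r / ‖y z‖ ^ 2) • y z, fun x => ⟨w x 0, w x 1⟩, ?_, fun x hx => ?_,
    fun z => ?_, fun z h => ?_, fun z => ?_, fun x hxr hx => ?_⟩
  · exact contDiff_const.add ((contDiff_const.div (hys.norm_sq ℝ) fun z => (hy0 z).ne').smul hys)
  · have h0 := contDiffAt_euclidean.1 (hws x hx)
    exact Complex.equivRealProdCLM.symm.contDiff.contDiffAt.comp x ((h0 0).prodMk (h0 1))
  · have h1 : ‖q + (2 * r / ‖y z‖ ^ 2) • y z - p‖ ^ 2 = r ^ 2 := by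
      have h2 := hy z
      have h3 := (hy0 z).ne'
      rw [EuclideanSpace.norm_sq_eq, Fin.sum_univ_three]
      simp only [Real.norm_eq_abs, sq_abs]
      set c := ‖y z‖ ^ 2
      have e0 : (q + (2 * r / c) • y z - p) 0 = 2 * r / c * z.re := by simp [hq, y]
      have e1 : (q + (2 * r / c) • y z - p) 1 = 2 * r / c * z.im := by simp [hq, y]
      have e2 : (q + (2 * r / c) • y z - p) 2 = r - 2 * r / c := by simp [hq, y]; ring
      rw [e0, e1, e2]
      field_simp
      rw [h2]
      ring
    exact (pow_left_inj₀ (norm_nonneg _) hr.le two_ne_zero).1 h1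
  · have h1 : y z ≠ 0 := fun h0 => by simpa [h0] using hy0 z
    have h2 := (hy0 z).ne'
    rw [add_eq_left] at h
    exact smul_ne_zero (by positivity) h1 h
  · have h1 : w (q + (2 * r / ‖y z‖ ^ 2) • y z) = y z := by
      simp only [w, add_sub_cancel_left, norm_smul, smul_smul, mul_pow, Real.norm_eq_abs, sq_abs]
      have h3 := (hy0 z).ne'
      have : 2 * r / ((2 * r / ‖y z‖ ^ 2) ^ 2 * ‖y z‖ ^ 2) * (2 * r / ‖y z‖ ^ 2) = 1 := by
        generalize ‖y z‖ ^ 2 = c at h3 ⊢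
        field_simp
      rw [this, one_smul]
    simp only [h1]
    rfl
  · have hc : ‖x - q‖ ^ 2 ≠ 0 := by simpa [sub_eq_zero] using hx
    have h2 : w x 2 = -1 := by
      have h1 : ‖x - p‖ ^ 2 = r ^ 2 := by rw [hxr]
      have h3 : ‖x - q‖ ^ 2 = -(2 * r * (x - q) 2) := by
        rw [EuclideanSpace.norm_sq_eq, Fin.sum_univ_three] at h1 ⊢
        simp only [Real.norm_eq_abs, sq_abs] at h1 ⊢
        simp [hq] at h1 ⊢
        linarith
      simp only [w, PiLp.smul_apply, smul_eq_mul]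
      rw [div_mul_eq_mul_div, div_eq_iff hc]
      linarith
    have h3 : y ⟨w x 0, w x 1⟩ = w x := by
      ext i
      fin_cases i
      · rfl
      · rfl
      · exact h2.symm
    simp only [h3]
    simp only [w, norm_smul, smul_smul, mul_pow, Real.norm_eq_abs, sq_abs]
    have : 2 * r / ((2 * r / ‖x - q‖ ^ 2) ^ 2 * ‖x - q‖ ^ 2) * (2 * r / ‖x - q‖ ^ 2) = 1 := by
      generalize ‖x - q‖ ^ 2 = c at hc ⊢
      field_simp
    rw [this, one_smul, add_sub_cancel]

/-- A generic large sphere is transverse to a surface. -/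
theorem exists_transverse_sphere {f N : ℂ → EuclideanSpace ℝ (Fin 3)} (hf : ContDiff ℝ ∞ f)
    (hN : ContDiff ℝ ∞ N) (hN0 : ∀ x, N x ≠ 0)
    (hNf : ∀ x y, inner ℝ (N x) y = 0 ↔ y ∈ range (fderiv ℝ f x))
    {C : Set (EuclideanSpace ℝ (Fin 3))} (hC : Bornology.IsBounded C) :
    ∃ (p : EuclideanSpace ℝ (Fin 3)) (r : ℝ), 0 < r ∧ (∀ x ∈ C, ‖x - p‖ < r) ∧
      (∀ z, ‖f z - p‖ = r → ∃ v, inner ℝ (f z - p) (fderiv ℝ f z v) ≠ 0) ∧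
      p + EuclideanSpace.single 2 r ∉ range f := by
  obtain ⟨R, hR⟩ := hC.exists_norm_le
  set r := max R 0 + 1 with hr
  have hr0 : 0 < r := by positivity
  have hν : ContDiff ℝ ∞ fun x => ‖N x‖⁻¹ • N x :=
    ((hN.norm ℝ hN0).inv fun x => norm_ne_zero_iff.2 (hN0 x)).smul hN
  have hdim : ∀ g : ℂ → EuclideanSpace ℝ (Fin 3), ContDiff ℝ ∞ g →
      dimH (range g) < Module.finrank ℝ (EuclideanSpace ℝ (Fin 3)) := fun g hg => by
    refine ((hg.of_le (by simp)).dimH_range_le).trans_lt ?_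
    rw [Complex.finrank_real_complex, finrank_euclideanSpace_fin]
    norm_num
  have hdense := dense_compl_of_dimH_lt_finrank
    (s := range (fun z => f z + r • (‖N z‖⁻¹ • N z)) ∪ (range (fun z => f z - r • (‖N z‖⁻¹ • N z)) ∪
      range (fun z => f z - EuclideanSpace.single 2 r))) (by
      rw [dimH_union, dimH_union]
      exact max_lt (hdim _ (hf.add (hν.const_smul r)))
        (max_lt (hdim _ (hf.sub (hν.const_smul r))) (hdim _ (hf.sub contDiff_const))))
  obtain ⟨p, hp, hp1⟩ := hdense.exists_dist_lt 0 zero_lt_one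
  simp only [mem_compl_iff, mem_union, mem_range, not_or, not_exists] at hp
  rw [dist_zero_left] at hp1
  refine ⟨p, r, hr0, fun x hx => ?_, fun z hz => ?_, fun ⟨z, hz⟩ => hp.2.2 z ?_⟩
  · have := norm_sub_le x p
    have := hR x hx
    have := le_max_left R 0
    linarith
  · by_contra! h
    have hmem : f z - p ∈ (ℝ ∙ N z) := by
      rw [← Submodule.orthogonal_orthogonal (ℝ ∙ N z), Submodule.mem_orthogonal']
      intro u hu
      rw [Submodule.mem_orthogonal_singleton_iff_inner_right] at hu
      obtain ⟨v, rfl⟩ := (hNf z u).1 hu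
      exact h v
    obtain ⟨c, hc⟩ := Submodule.mem_span_singleton.1 hmem
    have hn : ‖N z‖ ≠ 0 := norm_ne_zero_iff.2 (hN0 z)
    have hcr : |c| * ‖N z‖ = r := by
      rw [← hz, ← hc, norm_smul, Real.norm_eq_abs]
    have hpz : p = f z - c • N z := by rw [hc]; abel
    rcases abs_choice c with h1 | h1
    · refine hp.2.1 z ?_
      rw [hpz, smul_smul, ← hcr, h1, mul_assoc, mul_inv_cancel₀ hn, mul_one]
    · refine hp.1 z ?_
      rw [hpz, smul_smul, ← hcr, h1, mul_assoc, mul_inv_cancel₀ hn, mul_one]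
      module
  · rw [hz, add_sub_cancel_right]

theorem hasFDerivAt_norm_sub_sq {E F : Type*} [NormedAddCommGroup E] [NormedSpace ℝ E]
    [NormedAddCommGroup F] [InnerProductSpace ℝ F] {f : E → F} {x : E} (hf : DifferentiableAt ℝ f x)
    (p : F) : HasFDerivAt (fun y => ‖f y - p‖ ^ 2)
      (2 • (innerSL ℝ (f x - p)).comp (fderiv ℝ f x)) x :=
  (hf.hasFDerivAt.sub_const p).norm_sq

/-- A large generic punctured sphere is a cut surface, one of whose curves goes around `0`. -/
theorem exists_cutSurface {f N : ℂ → EuclideanSpace ℝ (Fin 3)} (hf : ContDiff ℝ ∞ f)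
    (hfc : IsClosedEmbedding f) (hfi : ∀ x, Injective (fderiv ℝ f x))
    (hN : ContDiff ℝ ∞ N) (hN0 : ∀ x, N x ≠ 0)
    (hNf : ∀ x y, inner ℝ (N x) y = 0 ↔ y ∈ range (fderiv ℝ f x))
    {K : Set (EuclideanSpace ℝ (Fin 3))} (hK : IsCompact K) {Q : Set ℂ} (hQ : IsCompact Q)
    (h0 : 0 ∈ Q) :
    ∃ (ι : Type) (_ : Finite ι) (φ : ℂ → EuclideanSpace ℝ (Fin 3)) (a : ι → ℝ → ℂ)
      (B : ι → PlaneDiffeo) (i₀ : ι), CutSurface f K Q φ a B univ ∧ ‖(B i₀).symm 0‖ < 1 := by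
  obtain ⟨p, r, hr, hC, hreg, hq⟩ := exists_transverse_sphere hf hN hN0 hNf
    (hK.union (hQ.image hf.continuous)).isBounded
  obtain ⟨j, k, hj, hk, hjr, hjq, hkj, hjk⟩ := exists_sphere_chart p hr
  have hfd : Differentiable ℝ f := hf.differentiable (by simp)
  have hjd : Differentiable ℝ j := hj.differentiable (by simp)
  set g : ℂ → ℝ := fun z => ‖f z - p‖ ^ 2 with hgdef
  have hg : ContDiff ℝ ∞ g := (hf.sub contDiff_const).norm_sq ℝ
  have hgr : ∀ z, g z = r ^ 2 ↔ ‖f z - p‖ = r := fun z =>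
    pow_left_inj₀ (norm_nonneg _) hr.le two_ne_zero
  have hgQ : ∀ z ∈ Q, g z < r ^ 2 := fun z hz =>
    pow_lt_pow_left₀ (hC _ (Or.inr (mem_image_of_mem f hz))) (norm_nonneg _) two_ne_zero
  have hball : IsCompact (f ⁻¹' Metric.closedBall p r) :=
    hfc.isCompact_preimage (isCompact_closedBall p r)
  have hZ : IsCompact (g ⁻¹' {r ^ 2}) := by
    refine hball.of_isClosed_subset (isClosed_singleton.preimage hg.continuous) fun z hz => ?_
    rw [mem_preimage, mem_closedBall_iff_norm]
    exact ((hgr z).1 hz).le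
  obtain ⟨ι, hι, b, hb, hbU, hbd⟩ := exists_loops_of_regular_level hg hZ fun z hz h => by
    obtain ⟨v, hv⟩ := hreg z ((hgr z).1 hz)
    rw [(hasFDerivAt_norm_sub_sq (hfd z) p).fderiv] at h
    have := DFunLike.congr_fun h v
    refine hv ?_
    simpa [inner_sub_left] using this
  choose B hB using fun i => (hb i).good
  have hrange : ∀ i, range (b i) = {z | ‖(B i).symm z‖ = 1} := fun i => by
    rw [← PlaneDiffeo.range_comp_circ]
    exact congrArg range (funext (hB i))
  have hlevel : ∀ z, ‖f z - p‖ = r ↔ ∃ i, ‖(B i).symm z‖ = 1 := fun z => by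
    rw [← hgr]
    change z ∈ g ⁻¹' {r ^ 2} ↔ _
    simp [← hbU, hrange]
  have hdisj : ∀ i j z, ‖(B i).symm z‖ = 1 → ‖(B j).symm z‖ = 1 → i = j := by
    intro i j z hi hj
    by_contra hij
    have hij' : Disjoint (range (b i)) (range (b j)) := hbd hij
    rw [hrange, hrange] at hij'
    exact disjoint_left.1 hij' hi hj
  obtain ⟨i₀, hi₀⟩ : ∃ i, ‖(B i).symm 0‖ < 1 := by
    have hbdd : Bornology.IsBounded (f ⁻¹' Metric.closedBall p r ∪ ⋃ i, {z | ‖(B i).symm z‖ ≤ 1}) :=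
      hball.isBounded.union ((Bornology.isBounded_iUnion).2 fun i => (B i).isBounded_disc)
    obtain ⟨z₁, hz₁⟩ : ∃ z₁, z₁ ∉ f ⁻¹' Metric.closedBall p r ∪ ⋃ i, {z | ‖(B i).symm z‖ ≤ 1} := by
      by_contra! hall
      exact NormedSpace.unbounded_univ ℝ ℂ (hbdd.subset fun z _ => hall z)
    simp only [mem_union, mem_preimage, mem_closedBall_iff_norm, mem_iUnion, mem_ofPred_eq, not_or,
      not_exists, not_le] at hz₁
    refine exists_inside (g := fun z => g z - r ^ 2) (hg.continuous.sub continuous_const)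
      (fun z => by rw [sub_eq_zero, hgr, hlevel]) hdisj (sub_neg.2 (hgQ 0 h0)) (z₁ := z₁)
      (sub_pos.2 (pow_lt_pow_left₀ hz₁.1 hr.le two_ne_zero)) hz₁.2
  have hfb : ∀ i t, ‖f (b i t) - p‖ = r := fun i t =>
    (hlevel _).2 ⟨i, by rw [hB, PlaneDiffeo.symm_apply_apply, norm_circ]⟩
  have hqf : ∀ z, f z ≠ p + EuclideanSpace.single 2 r := fun z hz => hq ⟨z, hz⟩
  have hja : ∀ i t, j (k (f (b i t))) = f (b i t) := fun i t => hjk _ (hfb i t) (hqf _)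
  have has : ∀ i, ContDiff ℝ ∞ fun t => k (f (b i t)) := fun i => contDiff_iff_contDiffAt.2 fun t =>
    (hk _ (hqf _)).comp t (hf.comp (hb i).smooth).contDiffAt
  have hjinj : ∀ x, Injective (fderiv ℝ j x) := fun x =>
    fderiv_injective_of_leftInverse ((hk _ (hjq x)).differentiableAt (by simp)) (hjd x)
      (Eventually.of_forall hkj)
  have hjort : ∀ x v, inner ℝ (j x - p) (fderiv ℝ j x v) = 0 := fun x v => by
    have h1 := hasFDerivAt_norm_sub_sq (hjd x) p
    simp only [hjr] at h1
    have := DFunLike.congr_fun (h1.unique (hasFDerivAt_const (r ^ 2) x)) v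
    simpa [inner_sub_left] using this
  refine ⟨ι, hι, j, fun i t => k (f (b i t)), B, i₀, ⟨hj, fun x _ y _ hxy => ?_, fun x _ => ?_,
    fun x _ hx => ?_, fun i => ⟨has i, fun t => ?_, fun t h => ?_, fun s t hst => ?_⟩,
    fun _ _ => mem_univ _, fun i t => ?_, ?_, fun i t => ?_, hdisj, fun i z hz h => ?_⟩, hi₀⟩
  · rw [← hkj x, hxy, hkj]
  · exact hjinj x
  · exact (hC _ (Or.inl hx)).ne (hjr x)
  · simp only [(hb i).periodic t]
  · have h1 : HasDerivAt (fun t => k (f (b i t))) 0 t := by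
      rw [← h]
      exact ((has i).differentiable (by simp) t).hasDerivAt
    have h2 := (hjd (k (f (b i t)))).hasFDerivAt.comp_hasDerivAt t h1
    have h3 := (hfd (b i t)).hasFDerivAt.comp_hasDerivAt t ((hb i).differentiableAt t).hasDerivAt
    have h4 : (j ∘ fun t => k (f (b i t))) = f ∘ b i := funext fun t => hja i t
    rw [h4, map_zero] at h2
    exact (hb i).deriv_ne t (hfi _ ((h3.unique h2).trans (map_zero _).symm))
  · refine (hb i).inj s t (hfc.injective ?_)
    rw [← hja, hst, hja]
  · rw [hja, hB]
  · rintro x - ⟨z, hz⟩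
    obtain ⟨i, hi⟩ := (hlevel z).1 (by rw [hz, hjr])
    obtain ⟨t, ht⟩ : z ∈ range (b i) := by rwa [hrange]
    exact ⟨i, t, by rw [ht, hz, hkj]⟩
  · rw [← hB]
    by_contra! hall
    have hle : LinearMap.range (fderiv ℝ j (k (f (b i t))) : ℂ →ₗ[ℝ] EuclideanSpace ℝ (Fin 3)) ≤
        LinearMap.range (fderiv ℝ f (b i t) : ℂ →ₗ[ℝ] EuclideanSpace ℝ (Fin 3)) := by
      rintro _ ⟨v, rfl⟩
      exact hall v
    have heq := Submodule.eq_of_le_of_finrank_eq hle (by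
      rw [LinearMap.finrank_range_of_inj (hjinj _), LinearMap.finrank_range_of_inj (hfi _)])
    obtain ⟨v, hv⟩ := hreg _ (hfb i t)
    have hmem : fderiv ℝ f (b i t) v ∈
        LinearMap.range (fderiv ℝ j (k (f (b i t))) : ℂ →ₗ[ℝ] EuclideanSpace ℝ (Fin 3)) := by
      rw [heq]
      exact ⟨v, rfl⟩
    obtain ⟨w, hw⟩ := hmem
    refine hv ?_
    have := hjort (k (f (b i t))) w
    rw [hja] at this
    rw [← this]
    exact congrArg _ hw.symm
  · exact (hgQ z hz).ne ((hgr z).2 ((hlevel z).2 ⟨i, h⟩))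

theorem eq_of_continuous_of_exp_eq {h : ℝ → ℂ} (hh : Continuous h)
    (he : ∀ t, Complex.exp (h t) = Complex.exp (h 0)) (t : ℝ) : h t = h 0 := by
  have := Complex.isCoveringMap_exp.eq_of_comp_eq hh (continuous_const (y := h 0))
    (funext fun s => Subtype.ext (he s)) 0 rfl
  exact congrFun this t

/-- The standard circle is not null-homotopic in the complement of a point of the disc. -/
theorem circ_not_nullhomotopic {w : ℂ} (hw : ‖w‖ < 1) {G : ℝ × ℝ → ℂ}
    (hG : ContinuousOn G (Icc 0 1 ×ˢ Icc 0 1)) (hne : ∀ x ∈ Icc (0 : ℝ) 1 ×ˢ Icc (0 : ℝ) 1, G x ≠ w)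
    (hbot : ∀ t ∈ Icc (0 : ℝ) 1, G (t, 0) = circ t)
    (hside : ∀ s ∈ Icc (0 : ℝ) 1, G (0, s) = circ 0 ∧ G (1, s) = circ 0)
    (htop : ∀ t ∈ Icc (0 : ℝ) 1, G (t, 1) = circ 0) : False := by
  let c : ℝ → ℝ := fun t => projIcc (0 : ℝ) 1 zero_le_one t
  have hc : Continuous c := continuous_subtype_val.comp continuous_projIcc
  have hcI : ∀ t, c t ∈ Icc (0 : ℝ) 1 := fun t => (projIcc (0 : ℝ) 1 zero_le_one t).2
  have hc0 : c 0 = 0 := by simp [c]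
  have hc1 : c 1 = 1 := by simp [c]
  have hG' : Continuous fun x : ℝ × ℝ => G (c x.1, c x.2) - w :=
    (hG.comp_continuous (f := fun x : ℝ × ℝ => (c x.1, c x.2)) (by fun_prop)
      fun x => ⟨hcI _, hcI _⟩).sub continuous_const
  obtain ⟨L, hL, hLe⟩ := Complex.exists_continuousOn_eqOn_exp_comp (U := univ)
    ((Homeomorph.Set.univ (ℝ × ℝ)).toHomotopyEquiv.simplyConnectedSpace_iff.2 inferInstance) isOpen_univ hG'.continuousOn (by
      rintro ⟨x, -, hx⟩
      exact hne _ ⟨hcI x.1, hcI x.2⟩ (sub_eq_zero.1 hx))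
  rw [continuousOn_univ] at hL
  have hLx : ∀ t s, Complex.exp (L (t, s)) = G (c t, c s) - w := fun t s => hLe (mem_univ (t, s))
  have hl := eq_of_continuous_of_exp_eq (h := fun s => L (0, s)) (by fun_prop) (fun s => by
    simp only [hLx, hc0, (hside _ (hcI s)).1, (hside 0 (by simp)).1]) 1
  have hr := eq_of_continuous_of_exp_eq (h := fun s => L (1, s)) (by fun_prop) (fun s => by
    simp only [hLx, hc0, hc1, (hside _ (hcI s)).2, (hside 0 (by simp)).2]) 1
  have ht := eq_of_continuous_of_exp_eq (h := fun t => L (t, 1)) (by fun_prop) (fun t => by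
    simp only [hLx, hc0, hc1, htop _ (hcI t), htop 0 (by simp)]) 1
  have hcirc : ∀ t, circ t ≠ 0 := fun t => Complex.exp_ne_zero _
  have hslit : ∀ t, 1 - w / circ t ∈ Complex.slitPlane := by
    intro t
    refine Complex.mem_slitPlane_of_norm_lt_one (z := - (w / circ t)) ?_
    rwa [norm_neg, norm_div, norm_circ, div_one]
  have hcirc' : Continuous fun t => 1 - w / circ (c t) :=
    continuous_const.sub (continuous_const.div (continuous_circ.comp hc) fun t => hcirc _)
  have hb := eq_of_continuous_of_exp_eq
    (h := fun t => L (t, 0) - 2 * Real.pi * c t * Complex.I - Complex.log (1 - w / circ (c t)))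
    (((by fun_prop : Continuous fun t => L (t, 0)).sub (by fun_prop)).sub
      (hcirc'.clog fun t => hslit _)) (by
      suffices h : ∀ t, Complex.exp (L (t, 0) - 2 * Real.pi * c t * Complex.I -
          Complex.log (1 - w / circ (c t))) = 1 from fun t => (h t).trans (h 0).symm
      intro t
      have h1 : Complex.exp (2 * Real.pi * c t * Complex.I) = circ (c t) := rfl
      have h2 := hcirc (c t)
      have h3 := Complex.slitPlane_ne_zero (hslit (c t))
      rw [Complex.exp_sub, Complex.exp_sub, Complex.exp_log h3, h1, hLx, hc0, hbot _ (hcI t),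
        div_div, mul_sub, mul_one, mul_div_cancel₀ _ h2, div_self]
      rw [sub_ne_zero]
      rintro h
      rw [← h, norm_circ] at hw
      exact lt_irrefl _ hw) 1
  have hper : circ 1 = circ 0 := by simpa using isLoop_circ.periodic 0
  simp only [hc0, hc1, hper, Complex.ofReal_zero, Complex.ofReal_one, mul_zero, zero_mul,
    mul_one] at hb hl hr ht
  refine Complex.two_pi_I_ne_zero ?_
  linear_combination ht - hr + hl - hb

/-- A disc missing `K` and meeting the surface `f` exactly in a curve around `f 0`. -/
theorem exists_disc_of_isClosedEmbedding {f : ℂ → EuclideanSpace ℝ (Fin 3)} (hf : ContDiff ℝ ∞ f)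
    (hfc : IsClosedEmbedding f) (hfi : ∀ x, Injective (fderiv ℝ f x))
    {K : Set (EuclideanSpace ℝ (Fin 3))} (hK : IsCompact K) :
    ∃ (φ : ℂ → EuclideanSpace ℝ (Fin 3)) (B : PlaneDiffeo), ContDiff ℝ ∞ φ ∧
      InjOn φ (Metric.closedBall 0 1) ∧
      (∀ x ∈ Metric.closedBall 0 1, Injective (fderiv ℝ φ x)) ∧
      (∀ x ∈ Metric.closedBall 0 1, φ x ∉ K) ∧ (∀ t, φ (circ t) = f (B (circ t))) ∧
      (∀ x ∈ Metric.closedBall 0 1, φ x ∈ range f → ‖x‖ = 1) ∧ ‖B.symm 0‖ < 1 := by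
  obtain ⟨N, hN, hN0, hNf⟩ := exists_normal_field hf hfi
  obtain ⟨R, hR⟩ := (hfc.isCompact_preimage hK).isBounded.exists_norm_le
  obtain ⟨ι, hι, φ, a, B, i₀, h, hB⟩ := exists_cutSurface hf hfc hfi hN hN0 hNf hK
    (isCompact_closedBall (0 : ℂ) (max R 0)) (by simp)
  obtain ⟨A, hA⟩ := (h.loop i₀).good
  exact (h.restrict hfc.injective hA fun _ _ => mem_univ _).exists_disc hf hfc hfi hN hN0 hNf
    hK.isClosed (fun z hz => mem_closedBall_zero_iff.2 ((hR z hz).trans (le_max_left _ _)))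
    (convex_closedBall _ _).isPreconnected (by simp)
    (i₀ := ⟨i₀, fun t => by simp [hA, norm_circ]⟩) (by ext t; simp [hA]) hB

theorem repr_circ (t : ℝ) : Complex.orthonormalBasisOneI.repr (circ t) = circlePt t := by
  have h : circ t = Complex.exp ((2 * Real.pi * t : ℝ) * Complex.I) := by
    simp [circ]
  rw [h, circlePt]
  generalize 2 * Real.pi * t = θ
  ext i
  fin_cases i
  · simp [Complex.exp_ofReal_mul_I_re]
  · simp [Complex.exp_ofReal_mul_I_im]

/-- Let `H = range f` be a smooth proper hyperplane in ℝ³ whose complement has exactly two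
connected components.  For every compact `K ⊆ ℝ³` there is a "nice 2-disk" missing `K`:
a smooth embedded disk `φ(D²)` meeting `H` exactly in its boundary circle `φ(S¹) ⊆ H \ {0}`,
whose boundary loop is not null-homotopic in `H \ {0}`. -/
theorem exists_nice_disk
    (f : EuclideanSpace ℝ (Fin 2) → EuclideanSpace ℝ (Fin 3))
    (hf_smooth : ContDiff ℝ (⊤ : ℕ∞) f)
    (hf_inj : Function.Injective f)
    (hf_proper : IsProperMap f)
    (hf_imm : ∀ x, Function.Injective (fderiv ℝ f x))
    (hf_zero : f 0 = 0)
    -- `ℝ³ \ H` has exactly two connected components `C₁` and `C₂`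
    (C₁ C₂ : Set (EuclideanSpace ℝ (Fin 3)))
    (x₁ x₂ : EuclideanSpace ℝ (Fin 3))
    (hx₁ : x₁ ∈ (Set.range f)ᶜ) (hx₂ : x₂ ∈ (Set.range f)ᶜ)
    (hC₁ : C₁ = connectedComponentIn (Set.range f)ᶜ x₁)
    (hC₂ : C₂ = connectedComponentIn (Set.range f)ᶜ x₂)
    (hne : C₁ ≠ C₂)
    (hcover : C₁ ∪ C₂ = (Set.range f)ᶜ)
    (K : Set (EuclideanSpace ℝ (Fin 3))) (hK : IsCompact K) :
    ∃ φ : EuclideanSpace ℝ (Fin 2) → EuclideanSpace ℝ (Fin 3),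
      ContDiffOn ℝ (⊤ : ℕ∞) φ {x | ‖x‖ ≤ 1} ∧
      Set.InjOn φ {x | ‖x‖ ≤ 1} ∧
      (∀ x ∈ {x : EuclideanSpace ℝ (Fin 2) | ‖x‖ ≤ 1},
        Function.Injective (fderivWithin ℝ φ {x | ‖x‖ ≤ 1} x)) ∧
      (φ '' {x | ‖x‖ ≤ 1}) ∩ K = ∅ ∧
      (φ '' {x | ‖x‖ ≤ 1}) ∩ Set.range f = φ '' {x | ‖x‖ = 1} ∧
      φ '' {x | ‖x‖ = 1} ⊆ Set.range f \ {0} ∧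
      (φ '' ({x | ‖x‖ ≤ 1} \ {x | ‖x‖ = 1})) ∩ Set.range f = ∅ ∧
      -- the boundary loop `t ↦ φ (cos 2πt, sin 2πt)` is not path-homotopic in `H \ {0}`
      -- to a constant loop
      ¬ ∃ F : ℝ × ℝ → EuclideanSpace ℝ (Fin 3),
          ContinuousOn F (Set.Icc 0 1 ×ˢ Set.Icc 0 1) ∧
          (∀ t ∈ Set.Icc (0 : ℝ) 1, ∀ s ∈ Set.Icc (0 : ℝ) 1,
            F (t, s) ∈ Set.range f \ {0}) ∧
          (∀ t ∈ Set.Icc (0 : ℝ) 1, F (t, 0) = φ (circlePt t)) ∧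
          (∀ s ∈ Set.Icc (0 : ℝ) 1, F (0, s) = φ (circlePt 0) ∧ F (1, s) = φ (circlePt 0)) ∧
          (∀ t ∈ Set.Icc (0 : ℝ) 1, F (t, 1) = φ (circlePt 0)) := by
  set e : ℂ ≃ₗᵢ[ℝ] EuclideanSpace ℝ (Fin 2) := Complex.orthonormalBasisOneI.repr with he
  have hfc : IsClosedEmbedding fun z => f (e z) :=
    (IsClosedEmbedding.of_continuous_injective_isClosedMap hf_proper.continuous hf_inj
      hf_proper.isClosedMap).comp e.toHomeomorph.isClosedEmbedding
  have hfi : ∀ x, Injective (fderiv ℝ (fun z => f (e z)) x) := fun x => by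
    have h1 := ((hf_smooth.differentiable (by simp)) (e x)).hasFDerivAt.comp x
      e.toContinuousLinearEquiv.hasFDerivAt
    have h2 : fderiv ℝ (fun z => f (e z)) x = _ := h1.fderiv
    rw [h2]
    exact (hf_imm _).comp e.injective
  have hrange : range (fun z => f (e z)) = range f := e.surjective.range_comp f
  obtain ⟨φ, B, hφ, hinj, himm, havoid, hbdry, hinter, hB⟩ :=
    exists_disc_of_isClosedEmbedding (hf_smooth.comp e.contDiff) hfc hfi hK
  simp only [comp_def] at hbdry hinter
  rw [hrange] at hinter
  have hball : ∀ {x : EuclideanSpace ℝ (Fin 2)}, ‖x‖ ≤ 1 → e.symm x ∈ Metric.closedBall (0 : ℂ) 1 :=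
    fun {x} hx => by simpa using hx
  have hsphere : ∀ {x : EuclideanSpace ℝ (Fin 2)}, ‖x‖ = 1 →
      φ (e.symm x) ∈ range f \ {0} := fun {x} hx => by
    obtain ⟨t, ht⟩ := exists_circ_eq (z := e.symm x) (by simpa using hx)
    rw [← ht, hbdry]
    refine ⟨⟨_, rfl⟩, fun h0 => ?_⟩
    have h1 : e (B (circ t)) = 0 := hf_inj (h0.trans hf_zero.symm)
    rw [map_eq_zero_iff e e.injective] at h1
    rw [← h1, PlaneDiffeo.symm_apply_apply, norm_circ] at hB
    exact lt_irrefl _ hB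
  have hsmooth : ContDiff ℝ ∞ fun x => φ (e.symm x) := hφ.comp e.symm.contDiff
  have hloop : ∀ t, φ (e.symm (circlePt t)) = f (e (B (circ t))) := fun t => by
    rw [← repr_circ, ← he, e.symm_apply_apply, hbdry]
  refine ⟨fun x => φ (e.symm x), hsmooth.contDiffOn, fun x hx y hy hxy => e.symm.injective
    (hinj (hball hx) (hball hy) hxy), fun x hx => ?_, ?_, ?_, ?_, ?_, ?_⟩
  · have hu : UniqueDiffOn ℝ {x : EuclideanSpace ℝ (Fin 2) | ‖x‖ ≤ 1} := by
      have := uniqueDiffOn_convex (convex_closedBall (0 : EuclideanSpace ℝ (Fin 2)) 1) ⟨0, by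
        rw [interior_closedBall _ one_ne_zero]
        simp⟩
      simpa [Metric.closedBall, dist_zero_right] using this
    have h1 := ((hφ.differentiable (by simp)) (e.symm x)).hasFDerivAt.comp x
      e.symm.toContinuousLinearEquiv.hasFDerivAt
    have h2 := h1.hasFDerivWithinAt.fderivWithin (hu x hx)
    change fderivWithin ℝ (fun x => φ (e.symm x)) {x | ‖x‖ ≤ 1} x = _ at h2
    rw [h2]
    exact (himm _ (hball hx)).comp e.symm.injective
  · rw [eq_empty_iff_forall_notMem]
    rintro _ ⟨⟨x, hx, rfl⟩, hxK⟩
    exact havoid _ (hball hx) hxK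
  · ext y
    constructor
    · rintro ⟨⟨x, hx, rfl⟩, hxf⟩
      exact ⟨x, by simpa using hinter _ (hball hx) hxf, rfl⟩
    · rintro ⟨x, hx, rfl⟩
      exact ⟨⟨x, le_of_eq hx, rfl⟩, (hsphere hx).1⟩
  · rintro _ ⟨x, hx, rfl⟩
    exact hsphere hx
  · rw [eq_empty_iff_forall_notMem]
    rintro _ ⟨⟨x, ⟨hx, hx1⟩, rfl⟩, hxf⟩
    exact hx1 (by simpa using hinter _ (hball hx) hxf)
  · rintro ⟨F, hF, hFH, hbot, hside, htop⟩
    simp only [hloop] at hbot hside htop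
    let k : EuclideanSpace ℝ (Fin 3) → ℂ := invFun fun z => f (e z)
    have hk : ∀ z, k (f (e z)) = z := leftInverse_invFun hfc.injective
    have hkc : ContinuousOn k (range f) := by
      rw [← hrange]
      rintro _ ⟨z, rfl⟩
      rw [ContinuousWithinAt, ← hfc.isEmbedding.map_nhds_eq, hk, tendsto_map'_iff]
      exact tendsto_id.congr fun z => (hk z).symm
    have hkB : ∀ t, B.symm (k (f (e (B (circ t))))) = circ t := fun t => by
      rw [hk, PlaneDiffeo.symm_apply_apply]
    refine circ_not_nullhomotopic hB (G := fun x => B.symm (k (F x)))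
      (B.symm.continuous.comp_continuousOn (hkc.comp hF fun x hx => (hFH x.1 hx.1 x.2 hx.2).1))
      (fun x hx h => ?_) (fun t ht => ?_) (fun s hs => ⟨?_, ?_⟩) (fun t ht => ?_)
    · obtain ⟨⟨y, hy⟩, hx0⟩ := hFH x.1 hx.1 x.2 hx.2
      refine hx0 ?_
      have h1 := B.symm.injective h
      have h2 : F x = f (e (e.symm y)) := by rw [e.apply_symm_apply, hy]
      rw [h2, hk] at h1
      have h3 : F x = 0 := by rw [h2, h1, map_zero, hf_zero]
      exact h3
    · simp only [hbot t ht, hkB]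
    · simp only [(hside s hs).1, hkB]
    · simp only [(hside s hs).2, hkB]
    · simp only [htop t ht, hkB]
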